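/- Let n ≥ 2, let Ω ⊂ ℝⁿ be a bounded domain, and let f : Ω × ℝⁿ → ℝ be a Carathéodory function such that z ↦ f(x,z) is convex for almost every x ∈ Ω and such that there exist constants 1 ≤ L < ∞ and μ ≥ 0 with |z|^p ≤ f(x,z) ≤ L|z|^q + 1 and f(x,2z) ≤ μ + L·f(x,z) for all z ∈ ℝⁿ and almost every x ∈ Ω, where 1 ≤ p ≤ q < ∞ satisfy 1/q ≥ 1/p − 1/(n−1). Then every quasi-minimizer u ∈ W^{1,1}_loc(Ω) of the functional F[u,A] = ∫_A f(x,∇u(x)) dx belongs to L^∞_loc(Ω). -/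

import Mathlib

open MeasureTheory Metric Set
open scoped ENNReal NNReal Topology

noncomputable section

/-- `du` is the weak gradient of `u` on the open set `Ω ⊆ ℝⁿ`, in the sense of
integration by parts against smooth compactly supported test functions. -/
def IsWeakGradOn (n : ℕ) (Ω : Set (EuclideanSpace ℝ (Fin n)))
    (u : EuclideanSpace ℝ (Fin n) → ℝ)
    (du : EuclideanSpace ℝ (Fin n) → EuclideanSpace ℝ (Fin n)) : Prop :=
  ∀ φ : EuclideanSpace ℝ (Fin n) → ℝ,
    ContDiff ℝ (⊤ : ℕ∞) φ → HasCompactSupport φ → tsupport φ ⊆ Ω →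
    ∀ i : Fin n,
      (∫ x in Ω, u x * (fderiv ℝ φ x (EuclideanSpace.single i (1 : ℝ))))
        = - ∫ x in Ω, du x i * φ x

/-- `u ∈ W^{1,1}_loc(Ω)` (with weak gradient `du`) is a `Q`-minimizer of the functional
`F[v,A] = ∫_A f(x, ∇v(x)) dx`: for every `φ ∈ W^{1,1}(Ω)` (with weak gradient `dφ`)
whose support is compactly contained in `Ω`, `F[u, supp φ] < ∞` (encoded as
integrability of `x ↦ f x (du x)` on `supp φ`) and
`F[u, supp φ] ≤ Q · F[u + φ, supp φ]`. -/
def IsQMinimizer (n : ℕ) (Ω : Set (EuclideanSpace ℝ (Fin n)))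
    (f : EuclideanSpace ℝ (Fin n) → EuclideanSpace ℝ (Fin n) → ℝ) (Q : ℝ)
    (u : EuclideanSpace ℝ (Fin n) → ℝ)
    (du : EuclideanSpace ℝ (Fin n) → EuclideanSpace ℝ (Fin n)) : Prop :=
  IsWeakGradOn n Ω u du ∧ LocallyIntegrableOn u Ω ∧ LocallyIntegrableOn du Ω ∧
  ∀ (φ : EuclideanSpace ℝ (Fin n) → ℝ)
    (dφ : EuclideanSpace ℝ (Fin n) → EuclideanSpace ℝ (Fin n)),
    IsWeakGradOn n Ω φ dφ → IntegrableOn φ Ω → IntegrableOn dφ Ω →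
    IsCompact (tsupport φ) → tsupport φ ⊆ Ω →
    IntegrableOn (fun x => f x (du x)) (tsupport φ) ∧
    (IntegrableOn (fun x => f x (du x + dφ x)) (tsupport φ) →
      (∫ x in tsupport φ, f x (du x)) ≤ Q * ∫ x in tsupport φ, f x (du x + dφ x))

theorem gradient_coord {n : ℕ} (η : EuclideanSpace ℝ (Fin n) → ℝ) (x : EuclideanSpace ℝ (Fin n))
    (i : Fin n) : gradient η x i = fderiv ℝ η x (EuclideanSpace.single i (1 : ℝ)) := by
  have h := EuclideanSpace.inner_single_right (𝕜 := ℝ) i (1 : ℝ) (gradient η x)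
  rw [gradient, InnerProductSpace.toDual_symm_apply] at h
  rw [gradient]
  simpa using h.symm

theorem norm_gradient {n : ℕ} (η : EuclideanSpace ℝ (Fin n) → ℝ)
    (x : EuclideanSpace ℝ (Fin n)) : ‖gradient η x‖ = ‖fderiv ℝ η x‖ := by
  rw [gradient, LinearIsometryEquiv.norm_map]

theorem continuous_gradient {n : ℕ} {η : EuclideanSpace ℝ (Fin n) → ℝ}
    (hη : ContDiff ℝ (⊤ : ℕ∞) η) : Continuous (gradient η) := by
  have : Continuous (fderiv ℝ η) := hη.continuous_fderiv (by simp)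
  exact (LinearIsometryEquiv.continuous _).comp this

theorem gradient_eq_zero_of_notMem_tsupport {n : ℕ} {η : EuclideanSpace ℝ (Fin n) → ℝ}
    {x : EuclideanSpace ℝ (Fin n)} (hx : x ∉ tsupport η) : gradient η x = 0 := by
  have : fderiv ℝ η x = 0 := by
    by_contra h
    exact hx (support_fderiv_subset ℝ h)
  rw [gradient, this, map_zero]

/-- A weak gradient on the whole space restricts to a weak gradient on every subset. -/
theorem IsWeakGradOn.of_univ {n : ℕ} {u : EuclideanSpace ℝ (Fin n) → ℝ}
    {du : EuclideanSpace ℝ (Fin n) → EuclideanSpace ℝ (Fin n)}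
    (h : IsWeakGradOn n univ u du) (V : Set (EuclideanSpace ℝ (Fin n))) :
    IsWeakGradOn n V u du := by
  intro φ hφ hc hs i
  have := h φ hφ hc (subset_univ _) i
  rw [setIntegral_univ, setIntegral_univ] at this
  rw [setIntegral_eq_integral_of_forall_compl_eq_zero, this,
    setIntegral_eq_integral_of_forall_compl_eq_zero]
  · intro x hx
    rw [image_eq_zero_of_notMem_tsupport (fun h => hx (hs h)), mul_zero]
  · intro x hx
    rw [← gradient_coord, gradient_eq_zero_of_notMem_tsupport (fun h => hx (hs h))]
    simp

/-- Leibniz rule for a locally integrable weakly differentiable function and a smooth function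
with compact support. -/
theorem IsWeakGradOn.smooth_mul {n : ℕ} {U : Set (EuclideanSpace ℝ (Fin n))}
    {v : EuclideanSpace ℝ (Fin n) → ℝ}
    {dv : EuclideanSpace ℝ (Fin n) → EuclideanSpace ℝ (Fin n)}
    (hv : IsWeakGradOn n U v dv) (hvi : LocallyIntegrableOn v U) (hdvi : LocallyIntegrableOn dv U)
    {η : EuclideanSpace ℝ (Fin n) → ℝ} (hη : ContDiff ℝ (⊤ : ℕ∞) η) (hηc : HasCompactSupport η)
    (hηU : tsupport η ⊆ U) :
    IsWeakGradOn n univ (fun x => η x * v x) (fun x => η x • dv x + v x • gradient η x) := by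
  intro φ hφ hc _ i
  have key := hv (fun x => η x * φ x) (hη.mul hφ) (hηc.mul_right)
    ((tsupport_mul_subset_left).trans hηU) i
  have hK : IsCompact (tsupport η) := hηc
  have hgc : Continuous fun x => gradient η x i :=
    (EuclideanSpace.proj (𝕜 := ℝ) i).continuous.comp (continuous_gradient hη)
  have hφc : Continuous fun x => fderiv ℝ φ x (EuclideanSpace.single i (1 : ℝ)) :=
    (hφ.continuous_fderiv (by simp)).clm_apply continuous_const
  have hvK : IntegrableOn v (tsupport η) := hvi.integrableOn_compact_subset hηU hK
  have hdvK : IntegrableOn (fun x => dv x i) (tsupport η) :=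
    (EuclideanSpace.proj (𝕜 := ℝ) i).integrable_comp (hdvi.integrableOn_compact_subset hηU hK)
  have hd : ∀ x, fderiv ℝ (fun x => η x * φ x) x (EuclideanSpace.single i (1 : ℝ))
      = η x * fderiv ℝ φ x (EuclideanSpace.single i (1 : ℝ)) + φ x * gradient η x i := by
    intro x
    rw [fderiv_fun_mul (hη.differentiable (by simp) x) (hφ.differentiable (by simp) x)]
    simp [gradient_coord]
  have e0 : ∀ x ∉ tsupport η, η x = 0 := fun x hx => image_eq_zero_of_notMem_tsupport hx
  have e1 : ∀ x ∉ tsupport η, gradient η x = 0 :=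
    fun x hx => gradient_eq_zero_of_notMem_tsupport hx
  have toK : ∀ F : EuclideanSpace ℝ (Fin n) → ℝ, (∀ x ∉ tsupport η, F x = 0) →
      ∀ V, tsupport η ⊆ V → ∫ x in V, F x = ∫ x in tsupport η, F x := by
    intro F hF V hV
    rw [setIntegral_eq_integral_of_forall_compl_eq_zero (fun x hx => hF x hx),
      setIntegral_eq_integral_of_forall_compl_eq_zero (fun x hx => hF x (fun h => hx (hV h)))]
  rw [toK _ _ U hηU, toK _ _ U hηU] at key
  rotate_left
  · intro x hx; simp [e0 x hx]
  · intro x hx; rw [hd]; simp [e0 x hx, e1 x hx]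
  rw [toK _ _ univ (subset_univ _), toK _ _ univ (subset_univ _)]
  rotate_left
  · intro x hx; simp [e0 x hx, e1 x hx]
  · intro x hx; simp [e0 x hx]
  have i1 : IntegrableOn (fun x => v x * (η x * fderiv ℝ φ x (EuclideanSpace.single i (1 : ℝ))))
      (tsupport η) := hvK.mul_continuousOn (hη.continuous.mul hφc).continuousOn hK
  have i2 : IntegrableOn (fun x => v x * (φ x * gradient η x i)) (tsupport η) :=
    hvK.mul_continuousOn (hφ.continuous.mul hgc).continuousOn hK
  have i3 : IntegrableOn (fun x => dv x i * (η x * φ x)) (tsupport η) :=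
    hdvK.mul_continuousOn (hη.continuous.mul hφ.continuous).continuousOn hK
  have s1 : ∫ x in tsupport η,
      v x * (fderiv ℝ (fun x => η x * φ x) x) (EuclideanSpace.single i 1)
      = (∫ x in tsupport η, v x * (η x * fderiv ℝ φ x (EuclideanSpace.single i (1 : ℝ))))
        + ∫ x in tsupport η, v x * (φ x * gradient η x i) := by
    rw [← integral_add i1 i2]
    congr 1; ext x; rw [hd]; ring
  have s2 : ∫ x in tsupport η, (η x • dv x + v x • gradient η x) i * φ x
      = (∫ x in tsupport η, dv x i * (η x * φ x))
        + ∫ x in tsupport η, v x * (φ x * gradient η x i) := by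
    rw [← integral_add i3 i2]
    congr 1; ext x; simp; ring
  rw [s1] at key
  rw [s2]
  have s3 : ∫ x in tsupport η, η x * v x * fderiv ℝ φ x (EuclideanSpace.single i (1 : ℝ))
      = ∫ x in tsupport η, v x * (η x * fderiv ℝ φ x (EuclideanSpace.single i (1 : ℝ))) := by
    congr 1; ext x; ring
  rw [s3]
  linarith

/-- Global integrability of a locally integrable function times a compactly supported continuous
function. -/
theorem integrable_smul_of_tsupport_subset {n : ℕ} {F : Type*} [NormedAddCommGroup F]
    [NormedSpace ℝ F] {U : Set (EuclideanSpace ℝ (Fin n))} {g : EuclideanSpace ℝ (Fin n) → F}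
    (hg : LocallyIntegrableOn g U) {η : EuclideanSpace ℝ (Fin n) → ℝ} (hη : Continuous η)
    (hηc : HasCompactSupport η) (hηU : tsupport η ⊆ U) : Integrable (fun x => η x • g x) := by
  have hK : IsCompact (tsupport η) := hηc
  have h1 : IntegrableOn (fun x => η x • g x) (tsupport η) :=
    (hg.integrableOn_compact_subset hηU hK).continuousOn_smul hη.continuousOn hK
  refine (integrableOn_iff_integrable_of_support_subset ?_).1 h1
  intro x hx
  by_contra h
  exact hx (by simp [image_eq_zero_of_notMem_tsupport h])

theorem integrable_smul_gradient_of_tsupport_subset {n : ℕ}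
    {U : Set (EuclideanSpace ℝ (Fin n))} {g : EuclideanSpace ℝ (Fin n) → ℝ}
    (hg : LocallyIntegrableOn g U) {η : EuclideanSpace ℝ (Fin n) → ℝ}
    (hη : ContDiff ℝ (⊤ : ℕ∞) η)
    (hηc : HasCompactSupport η) (hηU : tsupport η ⊆ U) :
    Integrable (fun x => g x • gradient η x) := by
  have hK : IsCompact (tsupport η) := hηc
  have h1 : IntegrableOn (fun x => g x • gradient η x) (tsupport η) :=
    (hg.integrableOn_compact_subset hηU hK).smul_continuousOn
      (continuous_gradient hη).continuousOn hK
  refine (integrableOn_iff_integrable_of_support_subset ?_).1 h1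
  intro x hx
  by_contra h
  exact hx (by simp [gradient_eq_zero_of_notMem_tsupport h])

/-- The Euclidean space of dimension `n`. -/
abbrev Eu (n : ℕ) := EuclideanSpace ℝ (Fin n)

/-- The closed cube with centre `x₀` and half side length `r`. -/
def cube {n : ℕ} (x₀ : Eu n) (r : ℝ) : Set (Eu n) := {x | ∀ i, |x i - x₀ i| ≤ r}

theorem cube_eq_preimage {n : ℕ} (x₀ : Eu n) (r : ℝ) :
    cube x₀ r = (MeasurableEquiv.toLp 2 (Fin n → ℝ)).symm ⁻¹'
      (univ.pi fun i => Icc (x₀ i - r) (x₀ i + r)) := by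
  ext x
  simp only [cube, mem_ofPred_eq, mem_preimage, mem_univ_pi, mem_Icc, abs_le]
  refine forall_congr' fun i => ?_
  have : (MeasurableEquiv.toLp 2 (Fin n → ℝ)).symm x i = x i := rfl
  rw [this]
  constructor <;> intro h <;> constructor <;> linarith [h.1, h.2]

theorem cube_mono {n : ℕ} (x₀ : Eu n) {r s : ℝ} (h : r ≤ s) : cube x₀ r ⊆ cube x₀ s :=
  fun _ hx i => (hx i).trans h

theorem isClosed_cube {n : ℕ} (x₀ : Eu n) (r : ℝ) : IsClosed (cube x₀ r) := by
  have : cube x₀ r = ⋂ i, {x | |x i - x₀ i| ≤ r} := by ext; simp [cube]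
  rw [this]
  refine isClosed_iInter fun i => isClosed_le ?_ continuous_const
  fun_prop

theorem measurableSet_cube {n : ℕ} (x₀ : Eu n) (r : ℝ) : MeasurableSet (cube x₀ r) :=
  (isClosed_cube x₀ r).measurableSet

theorem cube_subset_closedBall {n : ℕ} (x₀ : Eu n) {r : ℝ} (hr : 0 ≤ r) :
    cube x₀ r ⊆ closedBall x₀ (√n * r) := by
  intro x hx
  rw [mem_closedBall, EuclideanSpace.dist_eq]
  calc √(∑ i, dist (x i) (x₀ i) ^ 2) ≤ √(∑ _i : Fin n, r ^ 2) := by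
        apply Real.sqrt_le_sqrt
        refine Finset.sum_le_sum fun i _ => ?_
        rw [Real.dist_eq]
        exact pow_le_pow_left₀ (abs_nonneg _) (hx i) 2
    _ = √n * r := by simp [Real.sqrt_sq hr]

theorem closedBall_subset_cube {n : ℕ} (x₀ : Eu n) (r : ℝ) : closedBall x₀ r ⊆ cube x₀ r := by
  intro x hx i
  have h := PiLp.norm_apply_le (x - x₀) i
  rw [mem_closedBall, dist_eq_norm] at hx
  have : ‖(x - x₀) i‖ = |x i - x₀ i| := by simp [Real.norm_eq_abs]
  linarith

theorem isCompact_cube {n : ℕ} (x₀ : Eu n) (r : ℝ) : IsCompact (cube x₀ r) := by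
  refine ((isCompact_closedBall x₀ (√n * |r|)).of_isClosed_subset (isClosed_cube _ _) ?_)
  exact (cube_mono x₀ (le_abs_self r)).trans (cube_subset_closedBall x₀ (abs_nonneg r))

theorem convex_cube {n : ℕ} (x₀ : Eu n) (r : ℝ) : Convex ℝ (cube x₀ r) := by
  intro x hx y hy a b ha hb hab i
  have e : (a • x + b • y) i - x₀ i = a * (x i - x₀ i) + b * (y i - x₀ i) := by
    simp only [PiLp.add_apply, PiLp.smul_apply, smul_eq_mul]
    linear_combination (x₀ i) * hab
  rw [e]
  calc |a * (x i - x₀ i) + b * (y i - x₀ i)| ≤ |a * (x i - x₀ i)| + |b * (y i - x₀ i)| :=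
        abs_add_le _ _
    _ = a * |x i - x₀ i| + b * |y i - x₀ i| := by
        rw [abs_mul, abs_mul, abs_of_nonneg ha, abs_of_nonneg hb]
    _ ≤ a * r + b * r := by gcongr; exacts [hx i, hy i]
    _ = r := by rw [← add_mul, hab, one_mul]

theorem volume_cube {n : ℕ} (x₀ : Eu n) (r : ℝ) :
    volume (cube x₀ r) = ENNReal.ofReal (2 * r) ^ n := by
  rw [cube_eq_preimage, ((EuclideanSpace.volume_preserving_symm_measurableEquiv_toLp
    (Fin n))).measure_preimage_equiv, volume_pi_pi]
  simp only [Real.volume_Icc]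
  rw [Finset.prod_congr rfl (g := fun _ => ENNReal.ofReal (2 * r))]
  · simp
  · intro i _; ring_nf

/-- Translations are continuous in `L^p`. -/
theorem tendsto_lintegral_enorm_translate {n : ℕ} {F : Type*} [NormedAddCommGroup F]
    {p : ℝ} (hp : 1 ≤ p) {g : Eu n → F} (hg : MemLp g (ENNReal.ofReal p)) :
    Filter.Tendsto (fun t => ∫⁻ x, ‖g (x - t) - g x‖ₑ ^ p) (𝓝 0) (𝓝 0) := by
  have hp0 : 0 < p := by linarith
  have : Fact (1 ≤ ENNReal.ofReal p) := ⟨by simpa using hp⟩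
  let τ : Eu n → C(Eu n, Eu n) := fun t => ⟨fun x => x - t, by fun_prop⟩
  have hτ : Continuous τ :=
    ContinuousMap.continuous_of_continuous_uncurry _ (by
      show Continuous fun z : Eu n × Eu n => z.2 - z.1
      fun_prop)
  have hm : ∀ t, MeasurePreserving (τ t) volume volume := fun t =>
    measurePreserving_sub_right volume t
  have key := (continuous_const (y := hg.toLp g)).compMeasurePreservingLp hτ hm ENNReal.ofReal_ne_top
  have k0 := key.tendsto 0
  rw [tendsto_iff_edist_tendsto_0] at k0
  have e : ∀ t, edist (Lp.compMeasurePreserving (τ t) (hm t) (hg.toLp g))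
      (Lp.compMeasurePreserving (τ 0) (hm 0) (hg.toLp g)) ^ p
      = ∫⁻ x, ‖g (x - t) - g x‖ₑ ^ p := by
    intro t
    rw [Lp.edist_def, eLpNorm_eq_lintegral_rpow_enorm_toReal (by simpa using hp0)
      ENNReal.ofReal_ne_top, ENNReal.toReal_ofReal hp0.le, ← ENNReal.rpow_mul,
      one_div, inv_mul_cancel₀ hp0.ne', ENNReal.rpow_one]
    refine lintegral_congr_ae ?_
    have h1 := Lp.coeFn_compMeasurePreserving (hg.toLp g) (hm t)
    have h2 := Lp.coeFn_compMeasurePreserving (hg.toLp g) (hm 0)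
    have h3 := (hm t).quasiMeasurePreserving.ae_eq_comp hg.coeFn_toLp
    have h4 := (hm 0).quasiMeasurePreserving.ae_eq_comp hg.coeFn_toLp
    filter_upwards [h1, h2, h3, h4] with x a1 a2 a3 a4
    rw [Pi.sub_apply, a1, a2, a3, a4]
    simp [τ]
  have := (ENNReal.continuous_rpow_const (y := p)).tendsto 0 |>.comp k0
  rw [ENNReal.zero_rpow_of_pos hp0] at this
  refine this.congr fun t => ?_
  exact e t

/-- A sequence of smooth functions supported in `S` which converges a.e. to `w` and whose
gradients converge in `L^p` to `dw`. -/
structure SmoothApprox (n : ℕ) (p : ℝ) (S : Set (Eu n)) (w : Eu n → ℝ) (dw : Eu n → Eu n)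
    (W : ℕ → Eu n → ℝ) : Prop where
  contDiff : ∀ j, ContDiff ℝ (⊤ : ℕ∞) (W j)
  tsupport_subset : ∀ j, tsupport (W j) ⊆ S
  tendsto_ae : ∀ᵐ x, Filter.Tendsto (fun j => W j x) Filter.atTop (𝓝 (w x))
  tendsto_gradient : Filter.Tendsto (fun j => ∫⁻ x, ‖gradient (W j) x - dw x‖ₑ ^ p)
    Filter.atTop (𝓝 0)

/-- A standard mollifier of radius `1 / (j + 1)`. -/
def molBump (n : ℕ) (δ : ℝ) (hδ : 0 < δ) (j : ℕ) : ContDiffBump (0 : Eu n) where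
  rIn := δ / (2 * (j + 1))
  rOut := δ / (j + 1)
  rIn_pos := by positivity
  rIn_lt_rOut := by
    apply div_lt_div_of_pos_left hδ (by positivity)
    have : (0 : ℝ) < (j : ℝ) + 1 := by positivity
    linarith

theorem gradient_convolution {n : ℕ} {ρ w : Eu n → ℝ} {dw : Eu n → Eu n}
    (hρ : ContDiff ℝ (⊤ : ℕ∞) ρ) (hρc : HasCompactSupport ρ) (hw : Integrable w)
    (hdw : Integrable dw) (h : IsWeakGradOn n univ w dw) (x : Eu n) :
    gradient (convolution ρ w (ContinuousLinearMap.lsmul ℝ ℝ) volume) x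
      = ∫ t, ρ t • dw (x - t) := by
  have hρd : ∀ y, HasFDerivAt ρ (fderiv ℝ ρ y) y := fun y =>
    (hρ.differentiable (by simp) y).hasFDerivAt
  have hder := hρc.hasFDerivAt_convolution_left (ContinuousLinearMap.lsmul ℝ ℝ) (μ := volume)
    (hρ.of_le (by simp)) hw.locallyIntegrable x
  have hex : ConvolutionExistsAt (fderiv ℝ ρ) w x
      ((ContinuousLinearMap.lsmul ℝ ℝ).precompL (Eu n)) volume :=
    (hρc.fderiv (𝕜 := ℝ)).convolutionExists_left _ (hρ.continuous_fderiv (by simp))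
      hw.locallyIntegrable x
  have h_int : Integrable fun t => ρ t • dw (x - t) := by
    obtain ⟨C, hC⟩ := hρc.exists_bound_of_continuous hρ.continuous
    exact (hdw.comp_sub_left x).bdd_smul C hρ.continuous.aestronglyMeasurable
      (Filter.Eventually.of_forall hC)
  ext i
  rw [gradient_coord, hder.fderiv]
  have e1 : (convolution (fderiv ℝ ρ) w ((ContinuousLinearMap.lsmul ℝ ℝ).precompL (Eu n)) volume x)
      (EuclideanSpace.single i (1 : ℝ))
      = ∫ t, fderiv ℝ ρ t (EuclideanSpace.single i (1 : ℝ)) * w (x - t) := by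
    rw [convolution, ContinuousLinearMap.integral_apply hex]
    rfl
  have e2 : (∫ t, ρ t • dw (x - t)) i = ∫ t, ρ t * dw (x - t) i := by
    have := (EuclideanSpace.proj (𝕜 := ℝ) i).integral_comp_comm h_int
    simpa using this.symm
  rw [e1, e2]
  have key := h (fun y => ρ (x - y)) (hρ.comp (contDiff_const.sub contDiff_id))
    (hρc.comp_homeomorph (Homeomorph.subLeft x)) (subset_univ _) i
  rw [setIntegral_univ, setIntegral_univ] at key
  have hd : ∀ y, fderiv ℝ (fun y => ρ (x - y)) y (EuclideanSpace.single i (1 : ℝ))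
      = - fderiv ℝ ρ (x - y) (EuclideanSpace.single i (1 : ℝ)) := by
    intro y
    have := (hρd (x - y)).comp y ((hasFDerivAt_id y).const_sub x)
    have h2 : HasFDerivAt (fun y => ρ (x - y)) _ y := this
    rw [h2.fderiv]
    simp
  simp only [hd, mul_neg, integral_neg, neg_inj] at key
  rw [← integral_sub_left_eq_self (fun t => fderiv ℝ ρ t (EuclideanSpace.single i (1 : ℝ))
    * w (x - t)) volume x, ← integral_sub_left_eq_self (fun t => ρ t * dw (x - t) i) volume x]
  simp only [sub_sub_cancel]
  rw [show (fun t => fderiv ℝ ρ (x - t) (EuclideanSpace.single i (1 : ℝ)) * w t)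
    = fun t => w t * fderiv ℝ ρ (x - t) (EuclideanSpace.single i (1 : ℝ)) from
    funext fun t => mul_comm _ _, key]
  congr 1; ext t; ring

/-- Jensen's inequality for an average with respect to a probability density. -/
theorem enorm_integral_smul_sub_rpow_le {n : ℕ} {p : ℝ} (hp : 1 ≤ p) {ρ : Eu n → ℝ}
    (hρ0 : ∀ t, 0 ≤ ρ t) (hρm : Measurable ρ) (hρ1 : ∫ t, ρ t = 1) {g : Eu n → Eu n} {c : Eu n}
    (hg : Integrable fun t => ρ t • g t) (hgm : AEStronglyMeasurable g) :
    ‖(∫ t, ρ t • g t) - c‖ₑ ^ p ≤ ∫⁻ t, ENNReal.ofReal (ρ t) * ‖g t - c‖ₑ ^ p := by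
  have hp0 : 0 < p := by linarith
  have hρi : Integrable ρ := by
    by_contra hcon
    rw [integral_undef hcon] at hρ1
    norm_num at hρ1
  let ν : Measure (Eu n) := volume.withDensity fun t => ENNReal.ofReal (ρ t)
  have hν : IsProbabilityMeasure ν := ⟨by
    rw [withDensity_apply _ MeasurableSet.univ, setLIntegral_univ,
      ← ofReal_integral_eq_lintegral_ofReal hρi (Filter.Eventually.of_forall hρ0), hρ1,
      ENNReal.ofReal_one]⟩
  have hac : ν ≪ volume := withDensity_absolutelyContinuous _ _
  have hgν : AEStronglyMeasurable (fun t => g t - c) ν := (hgm.mono_ac hac).sub aestronglyMeasurable_const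
  have hgc : AEMeasurable (fun t => ‖g t - c‖ₑ) :=
    (hgm.sub aestronglyMeasurable_const).enorm
  have hρe : AEMeasurable (fun t => ENNReal.ofReal (ρ t)) := hρm.ennreal_ofReal.aemeasurable
  have h1 : (∫ t, ρ t • g t) - c = ∫ t, ρ t • (g t - c) := by
    simp only [smul_sub]
    rw [integral_sub hg (hρi.smul_const c), integral_smul_const, hρ1, one_smul]
  have h2 : ‖(∫ t, ρ t • g t) - c‖ₑ ≤ ∫⁻ t, ‖g t - c‖ₑ ∂ν := by
    rw [h1, lintegral_withDensity_eq_lintegral_mul₀ hρe hgc]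
    refine (enorm_integral_le_lintegral_enorm _).trans (le_of_eq ?_)
    refine lintegral_congr fun t => ?_
    rw [enorm_smul, Real.enorm_of_nonneg (hρ0 t), Pi.mul_apply]
  have h3 : ∫⁻ t, ‖g t - c‖ₑ ∂ν ≤ (∫⁻ t, ‖g t - c‖ₑ ^ p ∂ν) ^ (1 / p) := by
    have := eLpNorm_le_eLpNorm_of_exponent_le (p := 1) (q := ENNReal.ofReal p)
      (by simpa using hp) hgν
    rwa [eLpNorm_one_eq_lintegral_enorm,
      eLpNorm_eq_lintegral_rpow_enorm_toReal (by simpa using hp0)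
      ENNReal.ofReal_ne_top, ENNReal.toReal_ofReal hp0.le] at this
  calc ‖(∫ t, ρ t • g t) - c‖ₑ ^ p ≤ ((∫⁻ t, ‖g t - c‖ₑ ^ p ∂ν) ^ (1 / p)) ^ p := by
        gcongr; exact h2.trans h3
    _ = ∫⁻ t, ‖g t - c‖ₑ ^ p ∂ν := by
        rw [← ENNReal.rpow_mul, one_div, inv_mul_cancel₀ hp0.ne', ENNReal.rpow_one]
    _ = _ := by
        rw [lintegral_withDensity_eq_lintegral_mul₀ hρe (hgc.pow_const p)]
        rfl

/-- Smooth approximation of weakly differentiable functions with compact support. -/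
theorem IsWeakGradOn.exists_smoothApprox {n : ℕ} {p : ℝ} (hp : 1 ≤ p) {w : Eu n → ℝ}
    {dw : Eu n → Eu n} (h : IsWeakGradOn n univ w dw) (hw : Integrable w)
    (hdw : Integrable dw) (hdwp : MemLp dw (ENNReal.ofReal p)) {x₀ : Eu n} {R R' : ℝ}
    (hsupp : ∀ x ∉ cube x₀ R, w x = 0) (hR : R < R') :
    ∃ W, SmoothApprox n p (cube x₀ R') w dw W := by
  have hp0 : 0 < p := by linarith
  have hδ : 0 < R' - R := by linarith
  let φ : ℕ → ContDiffBump (0 : Eu n) := fun j => molBump n (R' - R) hδ j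
  let ρ : ℕ → Eu n → ℝ := fun j => (φ j).normed volume
  let W : ℕ → Eu n → ℝ := fun j => convolution (ρ j) w (ContinuousLinearMap.lsmul ℝ ℝ) volume
  have hrout : Filter.Tendsto (fun j => (φ j).rOut) Filter.atTop (𝓝 0) := by
    have := tendsto_const_div_atTop_nhds_zero_nat (R' - R)
    refine (this.comp (Filter.tendsto_add_atTop_nat 1)).congr fun j => ?_
    simp [φ, molBump]
  have hrle : ∀ j, (φ j).rOut ≤ R' - R := by
    intro j
    show (R' - R) / (j + 1) ≤ R' - R
    apply div_le_self hδ.le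
    have : (0 : ℝ) ≤ j := by positivity
    linarith
  have hρs : ∀ j, ContDiff ℝ (⊤ : ℕ∞) (ρ j) := fun j => (φ j).contDiff_normed
  have hρc : ∀ j, HasCompactSupport (ρ j) := fun j => (φ j).hasCompactSupport_normed
  refine ⟨W, fun j => ?_, fun j => ?_, ?_, ?_⟩
  · exact (hρc j).contDiff_convolution_left _ (hρs j) hw.locallyIntegrable
  · refine closure_minimal ?_ (isClosed_cube _ _)
    refine (support_convolution_subset _).trans ?_
    rintro _ ⟨t, ht, y, hy, rfl⟩ i
    rw [show Function.support (ρ j) = ball 0 (φ j).rOut from (φ j).support_normed_eq] at ht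
    have hy' : y ∈ cube x₀ R := by
      by_contra hcon; exact hy (hsupp y hcon)
    have ht1 : |t i| ≤ ‖t‖ := PiLp.norm_apply_le t i
    have ht2 : ‖t‖ < (φ j).rOut := by simpa using ht
    have := hy' i
    have h5 := hrle j
    have e : (t + y) i - x₀ i = t i + (y i - x₀ i) := by simp; ring
    show |(t + y) i - x₀ i| ≤ R'
    rw [e]
    refine (abs_add_le _ _).trans ?_
    linarith
  · refine ContDiffBump.ae_convolution_tendsto_right_of_locallyIntegrable (K := 2) hrout
      (Filter.Eventually.of_forall fun j => ?_) hw.locallyIntegrable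
    show (R' - R) / (j + 1) ≤ 2 * ((R' - R) / (2 * (j + 1)))
    apply le_of_eq; field_simp
  · have hω := tendsto_lintegral_enorm_translate hp hdwp
    have hρ1 : ∀ j, ∫ t, ρ j t = 1 := fun j => (φ j).integral_normed
    have hρ0 : ∀ j t, 0 ≤ ρ j t := fun j t => (φ j).nonneg_normed t
    have hsub : ∀ x : Eu n, MeasurePreserving (fun t => x - t) volume volume := fun x =>
      Measure.measurePreserving_sub_left volume x
    have hmeas2 : AEStronglyMeasurable (fun z : Eu n × Eu n => dw (z.1 - z.2) - dw z.1)
        (volume.prod volume) :=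
      (hdw.aestronglyMeasurable.comp_quasiMeasurePreserving
        (quasiMeasurePreserving_sub volume volume)).sub hdw.aestronglyMeasurable.comp_fst
    have bound : ∀ j, ∫⁻ x, ‖gradient (W j) x - dw x‖ₑ ^ p
        ≤ ∫⁻ t, ENNReal.ofReal (ρ j t) * ∫⁻ x, ‖dw (x - t) - dw x‖ₑ ^ p := by
      intro j
      calc ∫⁻ x, ‖gradient (W j) x - dw x‖ₑ ^ p
          ≤ ∫⁻ x, ∫⁻ t, ENNReal.ofReal (ρ j t) * ‖dw (x - t) - dw x‖ₑ ^ p := by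
            refine lintegral_mono fun x => ?_
            simp only
            rw [gradient_convolution (hρs j) (hρc j) hw hdw h x]
            refine enorm_integral_smul_sub_rpow_le hp (hρ0 j) (hρs j).continuous.measurable (hρ1 j)
              ?_ (hdw.comp_sub_left x).aestronglyMeasurable
            obtain ⟨C, hC⟩ := (hρc j).exists_bound_of_continuous (hρs j).continuous
            exact (hdw.comp_sub_left x).bdd_smul C (hρs j).continuous.aestronglyMeasurable
              (Filter.Eventually.of_forall hC)
        _ = ∫⁻ t, ∫⁻ x, ENNReal.ofReal (ρ j t) * ‖dw (x - t) - dw x‖ₑ ^ p := by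
            rw [lintegral_lintegral_swap]
            refine AEMeasurable.mul ?_ (hmeas2.enorm.pow_const p)
            exact ((hρs j).continuous.measurable.ennreal_ofReal.comp measurable_snd).aemeasurable
        _ = _ := by
            refine lintegral_congr fun t => ?_
            rw [lintegral_const_mul' _ _ ENNReal.ofReal_ne_top]
    rw [ENNReal.tendsto_nhds_zero] at hω ⊢
    intro ε hε
    obtain ⟨δ, hδ0, hδ⟩ := Metric.eventually_nhds_iff.1 (hω ε hε)
    filter_upwards [hrout.eventually (gt_mem_nhds hδ0)] with j hj
    refine (bound j).trans ?_
    calc ∫⁻ t, ENNReal.ofReal (ρ j t) * ∫⁻ x, ‖dw (x - t) - dw x‖ₑ ^ p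
        ≤ ∫⁻ t, ENNReal.ofReal (ρ j t) * ε := by
          refine lintegral_mono fun t => ?_
          by_cases ht : ρ j t = 0
          · simp [ht]
          · have : t ∈ ball 0 (φ j).rOut := by
              rw [← (φ j).support_normed_eq (μ := volume)]; exact ht
            simp only
            gcongr
            exact hδ (lt_trans this hj)
      _ = ε := by
          rw [lintegral_mul_const _ (hρs j).continuous.measurable.ennreal_ofReal,
            ← ofReal_integral_eq_lintegral_ofReal (φ j).integrable_normed
              (Filter.Eventually.of_forall (hρ0 j)), hρ1 j, ENNReal.ofReal_one, one_mul]

open Manifold in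
/-- Smooth cutoff functions between a compact set and an open neighbourhood. -/
theorem exists_smooth_cutoff {E : Type*} [NormedAddCommGroup E] [NormedSpace ℝ E]
    [FiniteDimensional ℝ E] {K U : Set E} (hK : IsCompact K) (hU : IsOpen U)
    (hKU : K ⊆ U) : ∃ ψ : E → ℝ, ContDiff ℝ (⊤ : ℕ∞) ψ ∧ HasCompactSupport ψ ∧
      tsupport ψ ⊆ U ∧ (∀ᶠ x in 𝓝ˢ K, ψ x = 1) ∧ ∀ x, ψ x ∈ Icc (0 : ℝ) 1 := by
  have : ProperSpace E := FiniteDimensional.proper ℝ E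
  obtain ⟨V, hVc, hKV, hVU⟩ := exists_compact_between hK hU hKU
  obtain ⟨f, h1, h0, h01⟩ := exists_contMDiffMap_one_nhds_of_subset_interior (n := (⊤ : ℕ∞))
    (modelWithCornersSelf ℝ E) hK.isClosed hKV
  have hs : tsupport f ⊆ V := by
    refine closure_minimal (fun x hx => ?_) hVc.isClosed
    by_contra hcon
    exact hx (h0 x hcon)
  exact ⟨f, f.contMDiff.contDiff, hVc.of_isClosed_subset (isClosed_tsupport _) hs,
    hs.trans hVU, h1, h01⟩

theorem gradient_eq_zero_of_eventually_eq_one {n : ℕ} {ψ : Eu n → ℝ} {x : Eu n}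
    (h : ∀ᶠ y in 𝓝 x, ψ y = 1) : gradient ψ x = 0 := by
  have : ψ =ᶠ[𝓝 x] fun _ => (1 : ℝ) := h
  rw [gradient, this.fderiv_eq]
  simp

/-- Chain rule for weak gradients. -/
theorem IsWeakGradOn.comp_of_bounded {n : ℕ} {w : Eu n → ℝ} {dw : Eu n → Eu n}
    (h : IsWeakGradOn n univ w dw) (hw : Integrable w)
    (hdw : Integrable dw) {x₀ : Eu n} {R : ℝ} (hsupp : ∀ x ∉ cube x₀ R, w x = 0)
    {g g' : ℝ → ℝ} {M : ℝ} (hg : ∀ s, HasDerivAt g (g' s) s) (hg'c : Continuous g')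
    (hgM : ∀ s, |g s| ≤ M) (hg1 : ∀ s, |g' s| ≤ 1) :
    IsWeakGradOn n univ (fun x => g (w x)) (fun x => g' (w x) • dw x) := by
  intro φ hφ hφc _ i
  rw [setIntegral_univ, setIntegral_univ]
  obtain ⟨W, hW⟩ := h.exists_smoothApprox le_rfl hw hdw (by simpa using memLp_one_iff_integrable.2 hdw)
    hsupp (lt_add_one R)
  have hgc : Continuous g := continuous_iff_continuousAt.2 fun s => (hg s).continuousAt
  let e : Eu n := EuclideanSpace.single i (1 : ℝ)
  have he : ‖e‖ = 1 := by simp [e]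
  obtain ⟨C, hC⟩ := hφc.exists_bound_of_continuous hφ.continuous
  have hφd : Continuous fun x => fderiv ℝ φ x e :=
    (hφ.continuous_fderiv (by simp)).clm_apply continuous_const
  have hφdi : Integrable fun x => fderiv ℝ φ x e :=
    hφd.integrable_of_hasCompactSupport (hφc.fderiv_apply (𝕜 := ℝ) e)
  have hφi : Integrable φ := hφ.continuous.integrable_of_hasCompactSupport hφc
  have hgrad : ∀ j, Continuous fun x => gradient (W j) x i := fun j =>
    (EuclideanSpace.proj (𝕜 := ℝ) i).continuous.comp (continuous_gradient (hW.contDiff j))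
  have hdwi : Integrable fun x => dw x i := (EuclideanSpace.proj (𝕜 := ℝ) i).integrable_comp hdw
  have hsm : ∀ j, ∫ x, g (W j x) * fderiv ℝ φ x e = - ∫ x, g' (W j x) * gradient (W j) x i * φ x := by
    intro j
    have hd : ∀ x, HasFDerivAt (fun x => g (W j x)) (g' (W j x) • fderiv ℝ (W j) x) x := fun x =>
      (hg (W j x)).comp_hasFDerivAt x ((hW.contDiff j).differentiable (by simp) x).hasFDerivAt
    have hd' : ∀ x, fderiv ℝ (fun x => g (W j x)) x e = g' (W j x) * gradient (W j) x i := by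
      intro x
      rw [(hd x).fderiv, gradient_coord]; simp [e]
    have hcont : Continuous fun x => g' (W j x) * gradient (W j) x i :=
      (hg'c.comp (hW.contDiff j).continuous).mul (hgrad j)
    have hgW : Continuous fun x => g (W j x) := hgc.comp (hW.contDiff j).continuous
    rw [integral_mul_fderiv_eq_neg_fderiv_mul_of_integrable]
    · simp only [hd']
    · simp only [hd']
      exact (hcont.mul hφ.continuous).integrable_of_hasCompactSupport hφc.mul_left
    · exact (hgW.mul hφd).integrable_of_hasCompactSupport (hφc.fderiv_apply (𝕜 := ℝ) e).mul_left
    · exact (hgW.mul hφ.continuous).integrable_of_hasCompactSupport hφc.mul_left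
    · exact fun x _ => (hd x).differentiableAt
    · exact fun x _ => hφ.differentiable (by simp) x
  have l1 : Filter.Tendsto (fun j => ∫ x, g (W j x) * fderiv ℝ φ x e) Filter.atTop
      (𝓝 (∫ x, g (w x) * fderiv ℝ φ x e)) := by
    refine tendsto_integral_of_dominated_convergence (fun x => M * ‖fderiv ℝ φ x e‖) ?_
      (hφdi.norm.const_mul M) ?_ ?_
    · exact fun j => ((hgc.comp (hW.contDiff j).continuous).mul hφd).aestronglyMeasurable
    · refine fun j => Filter.Eventually.of_forall fun x => ?_
      rw [norm_mul]; gcongr; exact hgM _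
    · filter_upwards [hW.tendsto_ae] with x hx
      exact ((hgc.tendsto _).comp hx).mul_const _
  have l2 : Filter.Tendsto (fun j => ∫ x, g' (W j x) * dw x i * φ x) Filter.atTop
      (𝓝 (∫ x, g' (w x) * dw x i * φ x)) := by
    refine tendsto_integral_of_dominated_convergence (fun x => ‖dw x i‖ * C) ?_
      (hdwi.norm.mul_const C) ?_ ?_
    · exact fun j => ((hg'c.comp (hW.contDiff j).continuous).aestronglyMeasurable.mul
        hdwi.aestronglyMeasurable).mul hφ.continuous.aestronglyMeasurable
    · refine fun j => Filter.Eventually.of_forall fun x => ?_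
      rw [norm_mul, norm_mul]
      have := hg1 (W j x)
      have h3 : ‖g' (W j x)‖ * ‖dw x i‖ ≤ 1 * ‖dw x i‖ := by gcongr; exact this
      rw [one_mul] at h3
      exact mul_le_mul h3 (hC x) (norm_nonneg _) (norm_nonneg _)
    · filter_upwards [hW.tendsto_ae] with x hx
      exact (((hg'c.tendsto _).comp hx).mul_const _).mul_const _
  have i2 : ∀ j, Integrable fun x => g' (W j x) * dw x i * φ x := by
    intro j
    refine (hdwi.norm.mul_const C).mono' (((hg'c.comp
      (hW.contDiff j).continuous).aestronglyMeasurable.mul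
        hdwi.aestronglyMeasurable).mul hφ.continuous.aestronglyMeasurable)
      (Filter.Eventually.of_forall fun x => ?_)
    rw [norm_mul, norm_mul]
    have := hg1 (W j x)
    have h3 : ‖g' (W j x)‖ * ‖dw x i‖ ≤ 1 * ‖dw x i‖ := by gcongr; exact this
    rw [one_mul] at h3
    exact mul_le_mul h3 (hC x) (norm_nonneg _) (norm_nonneg _)
  have i1 : ∀ j, Integrable fun x => g' (W j x) * gradient (W j) x i * φ x := fun j =>
    (((hg'c.comp (hW.contDiff j).continuous).mul (hgrad j)).mul
      hφ.continuous).integrable_of_hasCompactSupport hφc.mul_left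
  have l3 : Filter.Tendsto (fun j => (∫ x, g' (W j x) * gradient (W j) x i * φ x)
      - ∫ x, g' (W j x) * dw x i * φ x) Filter.atTop (𝓝 0) := by
    rw [tendsto_zero_iff_enorm_tendsto_zero]
    have hz : Filter.Tendsto (fun j => (∫⁻ x, ‖gradient (W j) x - dw x‖ₑ ^ (1 : ℝ))
        * ENNReal.ofReal C) Filter.atTop (𝓝 0) := by
      have := ENNReal.Tendsto.mul_const hW.tendsto_gradient (b := ENNReal.ofReal C)
        (Or.inr ENNReal.ofReal_ne_top)
      simpa using this
    refine tendsto_of_tendsto_of_tendsto_of_le_of_le tendsto_const_nhds hz (fun _ => zero_le)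
      fun j => ?_
    simp only
    rw [← integral_sub (i1 j) (i2 j), ← lintegral_mul_const' _ _ ENNReal.ofReal_ne_top]
    refine (enorm_integral_le_lintegral_enorm _).trans (lintegral_mono fun x => ?_)
    have e1 : g' (W j x) * gradient (W j) x i * φ x - g' (W j x) * dw x i * φ x
      = g' (W j x) * (gradient (W j) x - dw x) i * φ x := by simp; ring
    simp only [ENNReal.rpow_one]
    rw [e1, ← ofReal_norm, ← ofReal_norm, ← ENNReal.ofReal_mul (norm_nonneg _)]
    apply ENNReal.ofReal_le_ofReal
    rw [norm_mul, norm_mul]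
    have h3 : ‖g' (W j x)‖ * ‖(gradient (W j) x - dw x) i‖ ≤ 1 * ‖gradient (W j) x - dw x‖ :=
      mul_le_mul (hg1 _) (PiLp.norm_apply_le _ i) (norm_nonneg _) zero_le_one
    rw [one_mul] at h3
    exact mul_le_mul h3 (hC x) (norm_nonneg _) (norm_nonneg _)
  have l4 := l3.add l2
  simp only [sub_add_cancel, zero_add] at l4
  have := tendsto_nhds_unique l1 (l4.neg.congr fun j => (hsm j).symm)
  simpa [e] using this

/-- A continuous trapezoid approximating the indicator function of an open interval. -/
def trapezoid (k M : ℝ) (j : ℕ) (s : ℝ) : ℝ := max 0 (min 1 (j * min (s - k) (k + M - s)))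

theorem continuous_trapezoid (k M : ℝ) (j : ℕ) : Continuous (trapezoid k M j) := by
  unfold trapezoid; fun_prop

theorem trapezoid_mem (k M : ℝ) (j : ℕ) (s : ℝ) : trapezoid k M j s ∈ Icc (0 : ℝ) 1 :=
  ⟨le_max_left _ _, max_le zero_le_one (min_le_left _ _)⟩

theorem trapezoid_eq_zero {k M : ℝ} (j : ℕ) {s : ℝ} (hs : s ∉ Ioo k (k + M)) :
    trapezoid k M j s = 0 := by
  have : min (s - k) (k + M - s) ≤ 0 := by
    by_contra hcon
    rw [not_le, lt_min_iff] at hcon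
    exact hs ⟨by linarith [hcon.1], by linarith [hcon.2]⟩
  exact max_eq_left ((min_le_right _ _).trans (mul_nonpos_of_nonneg_of_nonpos (by positivity) this))

theorem tendsto_trapezoid (k M s : ℝ) : Filter.Tendsto (fun j => trapezoid k M j s) Filter.atTop
    (𝓝 ((Ioo k (k + M)).indicator 1 s)) := by
  by_cases hs : s ∈ Ioo k (k + M)
  · rw [indicator_of_mem hs]
    have h0 : 0 < min (s - k) (k + M - s) := lt_min (by linarith [hs.1]) (by linarith [hs.2])
    have ht := (tendsto_natCast_atTop_atTop (R := ℝ)).atTop_mul_const h0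
    refine tendsto_const_nhds.congr' ?_
    filter_upwards [ht.eventually_ge_atTop 1] with j hj
    simp [trapezoid, min_eq_left hj]
  · rw [indicator_of_notMem hs]
    exact tendsto_const_nhds.congr fun j => (trapezoid_eq_zero j hs).symm

theorem integral_indicator_Ioo {k M : ℝ} (hM : 0 ≤ M) (s : ℝ) :
    ∫ t in k..s, (Ioo k (k + M)).indicator (1 : ℝ → ℝ) t = max 0 (min (s - k) M) := by
  rcases le_total s k with h | h
  · rw [intervalIntegral.integral_symm, intervalIntegral.integral_of_le h]
    rw [setIntegral_eq_zero_of_forall_eq_zero]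
    · rw [max_eq_left]; simp
      exact (min_le_left _ _).trans (by linarith)
    · intro t ht
      exact indicator_of_notMem (fun h' => absurd ht.2 (not_le.2 h'.1)) _
  · rw [intervalIntegral.integral_of_le h, integral_indicator measurableSet_Ioo,
      Measure.restrict_restrict measurableSet_Ioo]
    have e : (∫ x in Ioo k (k + M) ∩ Ioc k s, (1 : ℝ → ℝ) x) =
        ∫ x in Ioc k (min (k + M) s), (1 : ℝ → ℝ) x := by
      refine setIntegral_congr_set ?_
      have h1 : (Ioo k (k + M) ∩ Ioc k s : Set ℝ) =ᵐ[volume] (Ioc k (k + M) ∩ Ioc k s : Set ℝ) :=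
        Ioo_ae_eq_Ioc.inter (ae_eq_refl _)
      rwa [Ioc_inter_Ioc, sup_idem] at h1
    rw [e]
    have hle : k ≤ min (k + M) s := le_min (by linarith) h
    simp only [Pi.one_apply, integral_const, smul_eq_mul, mul_one, measureReal_restrict_apply_univ,
      Real.volume_real_Ioc_of_le hle]
    rw [max_eq_right (le_min (by linarith) hM), min_comm, ← min_sub_sub_right]
    congr 1; ring

/-- Truncations of weakly differentiable functions. -/
theorem IsWeakGradOn.truncate {n : ℕ} {U : Set (Eu n)} (hU : IsOpen U) {u : Eu n → ℝ}
    {du : Eu n → Eu n} (h : IsWeakGradOn n U u du) (hu : LocallyIntegrableOn u U)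
    (hdu : LocallyIntegrableOn du U) (k : ℝ) {M : ℝ} (hM : 0 ≤ M) :
    IsWeakGradOn n U (fun x => max 0 (min (u x - k) M))
      (fun x => (Ioo k (k + M)).indicator (1 : ℝ → ℝ) (u x) • du x) := by
  intro φ hφ hφc hφU i
  obtain ⟨ψ, hψ, hψc, hψU, hψ1, hψ01⟩ := exists_smooth_cutoff hφc hU hφU
  have hψ1' : ∀ x ∈ tsupport φ, ∀ᶠ y in 𝓝 x, ψ y = 1 := fun x hx =>
    Filter.Eventually.filter_mono (nhds_le_nhdsSet hx) hψ1
  let w : Eu n → ℝ := fun x => ψ x * u x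
  let dw : Eu n → Eu n := fun x => ψ x • du x + u x • gradient ψ x
  have hwg : IsWeakGradOn n univ w dw := h.smooth_mul hu hdu hψ hψc hψU
  have hw : Integrable w := integrable_smul_of_tsupport_subset hu hψ.continuous hψc hψU
  have hdw : Integrable dw := (integrable_smul_of_tsupport_subset hdu hψ.continuous hψc hψU).add
    (integrable_smul_gradient_of_tsupport_subset hu hψ hψc hψU)
  obtain ⟨R, hR⟩ := (isCompact_iff_isClosed_bounded.1 hψc).2.subset_closedBall (0 : Eu n)
  have hsupp : ∀ x ∉ cube (0 : Eu n) R, w x = 0 := by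
    intro x hx
    have : x ∉ tsupport ψ := fun hx' => hx (closedBall_subset_cube 0 R (hR hx'))
    simp [w, image_eq_zero_of_notMem_tsupport this]
  have hwu : ∀ x ∈ tsupport φ, w x = u x := fun x hx => by
    simp [w, (hψ1' x hx).self_of_nhds]
  have hdwu : ∀ x ∈ tsupport φ, dw x = du x := fun x hx => by
    simp [dw, (hψ1' x hx).self_of_nhds, gradient_eq_zero_of_eventually_eq_one (hψ1' x hx)]
  let e : Eu n := EuclideanSpace.single i (1 : ℝ)
  obtain ⟨C, hC⟩ := hφc.exists_bound_of_continuous hφ.continuous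
  have hφd : Continuous fun x => fderiv ℝ φ x e :=
    (hφ.continuous_fderiv (by simp)).clm_apply continuous_const
  have hφdi : Integrable fun x => fderiv ℝ φ x e :=
    hφd.integrable_of_hasCompactSupport (hφc.fderiv_apply (𝕜 := ℝ) e)
  have hdwi : Integrable fun x => dw x i := (EuclideanSpace.proj (𝕜 := ℝ) i).integrable_comp hdw
  let G : ℕ → ℝ → ℝ := fun j s => ∫ t in k..s, trapezoid k M j t
  have hGd : ∀ j s, HasDerivAt (G j) (trapezoid k M j s) s := fun j s =>
    intervalIntegral.integral_hasDerivAt_right ((continuous_trapezoid k M j).intervalIntegrable _ _)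
      (continuous_trapezoid k M j).stronglyMeasurable.stronglyMeasurableAtFilter
      (continuous_trapezoid k M j).continuousAt
  have hGle : ∀ j s, |G j s| ≤ M := by
    intro j s
    have hind : ∀ t, ‖trapezoid k M j t‖ ≤ (Ioo k (k + M)).indicator (1 : ℝ → ℝ) t := by
      intro t
      by_cases ht : t ∈ Ioo k (k + M)
      · rw [indicator_of_mem ht, Real.norm_of_nonneg (trapezoid_mem k M j t).1]
        exact (trapezoid_mem k M j t).2
      · rw [indicator_of_notMem ht, trapezoid_eq_zero j ht]; simp
    have hii : IntervalIntegrable ((Ioo k (k + M)).indicator (1 : ℝ → ℝ)) volume k s := by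
      refine (Integrable.integrableOn ?_).intervalIntegrable
      exact (integrable_indicator_iff measurableSet_Ioo).2
        (integrableOn_const (C := (1 : ℝ)) (by simp))
    have := intervalIntegral.norm_integral_le_abs_of_norm_le (μ := volume) (a := k) (b := s)
      (Filter.Eventually.of_forall fun t => hind t) hii
    rw [integral_indicator_Ioo hM, abs_of_nonneg (le_max_left _ _)] at this
    exact this.trans (max_le hM (min_le_right _ _))
  have hGlim : ∀ s, Filter.Tendsto (fun j => G j s) Filter.atTop (𝓝 (max 0 (min (s - k) M))) := by
    intro s
    rw [← integral_indicator_Ioo hM s]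
    refine intervalIntegral.tendsto_integral_filter_of_dominated_convergence (fun _ => 1) ?_ ?_
      (by simp) ?_
    · exact Filter.Eventually.of_forall fun j => (continuous_trapezoid k M j).aestronglyMeasurable
    · refine Filter.Eventually.of_forall fun j => Filter.Eventually.of_forall fun t _ => ?_
      rw [Real.norm_of_nonneg (trapezoid_mem k M j t).1]
      exact (trapezoid_mem k M j t).2
    · exact Filter.Eventually.of_forall fun t _ => tendsto_trapezoid k M t
  have hGc : ∀ j, Continuous (G j) := fun j =>
    continuous_iff_continuousAt.2 fun s => (hGd j s).continuousAt
  have key : ∀ j, ∫ x, G j (w x) * fderiv ℝ φ x e = - ∫ x, trapezoid k M j (w x) * dw x i * φ x := by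
    intro j
    have := hwg.comp_of_bounded hw hdw hsupp (hGd j) (continuous_trapezoid k M j) (hGle j)
      (fun s => by rw [abs_of_nonneg (trapezoid_mem k M j s).1]; exact (trapezoid_mem k M j s).2)
      φ hφ hφc (subset_univ _) i
    simpa using this
  have l1 : Filter.Tendsto (fun j => ∫ x, G j (w x) * fderiv ℝ φ x e) Filter.atTop
      (𝓝 (∫ x, max 0 (min (w x - k) M) * fderiv ℝ φ x e)) := by
    refine tendsto_integral_of_dominated_convergence (fun x => M * ‖fderiv ℝ φ x e‖) ?_
      (hφdi.norm.const_mul M) ?_ ?_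
    · exact fun j => ((hGc j).comp_aestronglyMeasurable hw.aestronglyMeasurable).mul
        hφd.aestronglyMeasurable
    · refine fun j => Filter.Eventually.of_forall fun x => ?_
      rw [norm_mul]; gcongr; exact hGle _ _
    · exact Filter.Eventually.of_forall fun x => (hGlim _).mul_const _
  have l2 : Filter.Tendsto (fun j => ∫ x, trapezoid k M j (w x) * dw x i * φ x) Filter.atTop
      (𝓝 (∫ x, (Ioo k (k + M)).indicator (1 : ℝ → ℝ) (w x) * dw x i * φ x)) := by
    refine tendsto_integral_of_dominated_convergence (fun x => ‖dw x i‖ * C) ?_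
      (hdwi.norm.mul_const C) ?_ ?_
    · exact fun j => (((continuous_trapezoid k M j).comp_aestronglyMeasurable
        hw.aestronglyMeasurable).mul
        hdwi.aestronglyMeasurable).mul hφ.continuous.aestronglyMeasurable
    · refine fun j => Filter.Eventually.of_forall fun x => ?_
      rw [norm_mul, norm_mul]
      have h3 : ‖trapezoid k M j (w x)‖ * ‖dw x i‖ ≤ 1 * ‖dw x i‖ := by
        gcongr
        rw [Real.norm_of_nonneg (trapezoid_mem k M j _).1]; exact (trapezoid_mem k M j _).2
      rw [one_mul] at h3
      exact mul_le_mul h3 (hC x) (norm_nonneg _) (norm_nonneg _)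
    · exact Filter.Eventually.of_forall fun x =>
        ((tendsto_trapezoid k M (w x)).mul_const _).mul_const _
  have fin := tendsto_nhds_unique l1 (l2.neg.congr fun j => (key j).symm)
  have z1 : ∀ x ∉ tsupport φ, fderiv ℝ φ x e = 0 := fun x hx => by
    rw [← gradient_coord, gradient_eq_zero_of_notMem_tsupport hx]; simp
  rw [setIntegral_eq_integral_of_forall_compl_eq_zero,
    setIntegral_eq_integral_of_forall_compl_eq_zero]
  · convert fin using 1
    · congr 1; ext x
      by_cases hx : x ∈ tsupport φ
      · rw [hwu x hx]
      · rw [show fderiv ℝ φ x (EuclideanSpace.single i (1 : ℝ)) = 0 from z1 x hx]; simp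
    · congr 2; ext x
      by_cases hx : x ∈ tsupport φ
      · rw [hwu x hx, hdwu x hx]; simp
      · rw [image_eq_zero_of_notMem_tsupport hx]; simp
  · intro x hx
    rw [image_eq_zero_of_notMem_tsupport (fun h' => hx (hφU h')), mul_zero]
  · intro x hx
    rw [show fderiv ℝ φ x (EuclideanSpace.single i (1 : ℝ)) = 0 from
      z1 x (fun h' => hx (hφU h')), mul_zero]

theorem lintegral_rpow_le_of_prob {α : Type*} [MeasurableSpace α] {ν : Measure α}
    [IsProbabilityMeasure ν] {p : ℝ} (hp : 1 ≤ p) {f : α → ℝ≥0∞} (hf : AEMeasurable f ν) :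
    (∫⁻ t, f t ∂ν) ^ p ≤ ∫⁻ t, f t ^ p ∂ν := by
  have hp0 : 0 < p := by linarith
  have := eLpNorm_le_eLpNorm_of_exponent_le (p := 1) (q := ENNReal.ofReal p) (μ := ν) (f := f)
    (by simpa using hp) hf.aestronglyMeasurable
  rw [eLpNorm_one_eq_lintegral_enorm,
    eLpNorm_eq_lintegral_rpow_enorm_toReal (by simpa using hp0)
    ENNReal.ofReal_ne_top, ENNReal.toReal_ofReal hp0.le] at this
  simp only [enorm_eq_self] at this
  calc (∫⁻ t, f t ∂ν) ^ p ≤ ((∫⁻ t, f t ^ p ∂ν) ^ (1 / p)) ^ p := by gcongr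
    _ = _ := by rw [← ENNReal.rpow_mul, one_div, inv_mul_cancel₀ hp0.ne', ENNReal.rpow_one]

theorem enorm_rpow_le_two_rpow_mul {F : Type*} [NormedAddCommGroup F] {p : ℝ} (hp : 1 ≤ p)
    (a b : F) : ‖a‖ₑ ^ p ≤ 2 ^ (p - 1) * (‖b‖ₑ ^ p + ‖a - b‖ₑ ^ p) := by
  have h : ‖a‖ₑ ≤ ‖b‖ₑ + ‖a - b‖ₑ := by
    calc ‖a‖ₑ = ‖b + (a - b)‖ₑ := by congr 1; abel
      _ ≤ _ := enorm_add_le _ _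
  exact (ENNReal.rpow_le_rpow h (by linarith)).trans (ENNReal.rpow_add_le_mul_rpow_add_rpow _ _ hp)

theorem enorm_sub_rpow_le_of_contDiff {n : ℕ} {p : ℝ} (hp : 1 ≤ p) {W : Eu n → ℝ}
    (hW : ContDiff ℝ (⊤ : ℕ∞) W) (x z : Eu n) :
    ‖W (x + z) - W x‖ₑ ^ p
      ≤ ‖z‖ₑ ^ p * ∫⁻ t in Ioc (0 : ℝ) 1, ‖gradient W (x + t • z)‖ₑ ^ p := by
  have hd : ∀ t : ℝ, HasDerivAt (fun t : ℝ => W (x + t • z)) (fderiv ℝ W (x + t • z) z) t := by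
    intro t
    have h1 : HasDerivAt (fun t : ℝ => x + t • z) z t := by
      simpa using ((hasDerivAt_id t).smul_const z).const_add x
    exact (hW.differentiable (by simp) _).hasFDerivAt.comp_hasDerivAt t h1
  have hc : Continuous fun t : ℝ => fderiv ℝ W (x + t • z) z :=
    ((hW.continuous_fderiv (by simp)).comp (by fun_prop)).clm_apply continuous_const
  have hgc : Continuous fun t : ℝ => gradient W (x + t • z) :=
    (continuous_gradient hW).comp (by fun_prop)
  have hftc := intervalIntegral.integral_eq_sub_of_hasDerivAt (a := 0) (b := 1)
    (fun t _ => hd t) (hc.intervalIntegrable _ _)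
  simp only [one_smul, zero_smul, add_zero] at hftc
  rw [← hftc, intervalIntegral.integral_of_le zero_le_one]
  have hν : IsProbabilityMeasure (volume.restrict (Ioc (0 : ℝ) 1)) := ⟨by simp⟩
  have hgm : AEMeasurable (fun t : ℝ => ‖gradient W (x + t • z)‖ₑ)
      (volume.restrict (Ioc (0 : ℝ) 1)) := hgc.enorm.aemeasurable
  calc ‖∫ t in Ioc (0 : ℝ) 1, fderiv ℝ W (x + t • z) z‖ₑ ^ p
      ≤ (∫⁻ t in Ioc (0 : ℝ) 1, ‖gradient W (x + t • z)‖ₑ * ‖z‖ₑ) ^ p := by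
        refine ENNReal.rpow_le_rpow ?_ (by linarith)
        refine (enorm_integral_le_lintegral_enorm _).trans (lintegral_mono fun t => ?_)
        simp only
        rw [← ofReal_norm, ← ofReal_norm, ← ofReal_norm, ← ENNReal.ofReal_mul (norm_nonneg _),
          norm_gradient]
        exact ENNReal.ofReal_le_ofReal (ContinuousLinearMap.le_opNorm _ _)
    _ = ‖z‖ₑ ^ p * (∫⁻ t in Ioc (0 : ℝ) 1, ‖gradient W (x + t • z)‖ₑ) ^ p := by
        rw [lintegral_mul_const' _ _ enorm_ne_top, ENNReal.mul_rpow_of_nonneg _ _ (by linarith),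
          mul_comm]
    _ ≤ _ := by gcongr; exact lintegral_rpow_le_of_prob hp hgm

theorem lintegral_translate_sub_le_of_contDiff {n : ℕ} {p : ℝ} (hp : 1 ≤ p) {W : Eu n → ℝ}
    (hW : ContDiff ℝ (⊤ : ℕ∞) W) {Q : Set (Eu n)} (hQc : Convex ℝ Q) (hQ : MeasurableSet Q)
    (z : Eu n) :
    ∫⁻ x in Q ∩ (fun x => x + z) ⁻¹' Q, ‖W (x + z) - W x‖ₑ ^ p
      ≤ ‖z‖ₑ ^ p * ∫⁻ x in Q, ‖gradient W x‖ₑ ^ p := by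
  have hN : MeasurableSet (Q ∩ (fun x => x + z) ⁻¹' Q) :=
    hQ.inter (measurable_add_const z hQ)
  have hp0 : 0 ≤ p := by linarith
  have hz : ‖z‖ₑ ^ p ≠ ⊤ := ENNReal.rpow_ne_top_of_nonneg hp0 enorm_ne_top
  calc ∫⁻ x in Q ∩ (fun x => x + z) ⁻¹' Q, ‖W (x + z) - W x‖ₑ ^ p
      ≤ ∫⁻ x in Q ∩ (fun x => x + z) ⁻¹' Q,
          ‖z‖ₑ ^ p * ∫⁻ t in Ioc (0 : ℝ) 1, ‖gradient W (x + t • z)‖ₑ ^ p :=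
        lintegral_mono fun x => enorm_sub_rpow_le_of_contDiff hp hW x z
    _ = ‖z‖ₑ ^ p * ∫⁻ t in Ioc (0 : ℝ) 1, ∫⁻ x in Q ∩ (fun x => x + z) ⁻¹' Q,
          ‖gradient W (x + t • z)‖ₑ ^ p := by
        rw [lintegral_const_mul' _ _ hz, lintegral_lintegral_swap]
        have : Continuous fun a : Eu n × ℝ => ‖gradient W (a.1 + a.2 • z)‖ₑ ^ p :=
          ENNReal.continuous_rpow_const.comp
            (((continuous_gradient hW).comp (by fun_prop)).enorm)
        exact this.measurable.aemeasurable
    _ ≤ ‖z‖ₑ ^ p * ∫⁻ t in Ioc (0 : ℝ) 1, ∫⁻ x in Q, ‖gradient W x‖ₑ ^ p := by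
        refine mul_le_mul' le_rfl (setLIntegral_mono' measurableSet_Ioc fun t ht => ?_)
        rw [← lintegral_indicator hN, ← lintegral_indicator hQ,
          ← lintegral_add_right_eq_self (μ := (volume : Measure (Eu n)))
            (Q.indicator fun x => ‖gradient W x‖ₑ ^ p) (t • z)]
        refine lintegral_mono fun x => ?_
        by_cases hx : x ∈ Q ∩ (fun x => x + z) ⁻¹' Q
        · have : x + t • z ∈ Q := by
            have := hQc hx.1 hx.2 (by linarith [ht.2] : 0 ≤ 1 - t) ht.1.le (by ring)
            convert this using 1
            module
          rw [indicator_of_mem hx, indicator_of_mem this]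
        · rw [indicator_of_notMem hx]; exact zero_le
    _ = _ := by simp

namespace SmoothApprox

variable {n : ℕ} {p : ℝ} {S : Set (Eu n)} {w : Eu n → ℝ} {dw : Eu n → Eu n}
    {W : ℕ → Eu n → ℝ}

theorem lintegral_gradient_le (hp : 1 ≤ p)
    (hdw : AEStronglyMeasurable dw) (j : ℕ) (Q : Set (Eu n)) :
    ∫⁻ x in Q, ‖gradient (W j) x‖ₑ ^ p
      ≤ 2 ^ (p - 1) * ((∫⁻ x in Q, ‖dw x‖ₑ ^ p) + ∫⁻ x, ‖gradient (W j) x - dw x‖ₑ ^ p) := by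
  have h2 : (2 : ℝ≥0∞) ^ (p - 1) ≠ ⊤ := ENNReal.rpow_ne_top_of_nonneg (by linarith) (by simp)
  calc ∫⁻ x in Q, ‖gradient (W j) x‖ₑ ^ p
      ≤ ∫⁻ x in Q, 2 ^ (p - 1) * (‖dw x‖ₑ ^ p + ‖gradient (W j) x - dw x‖ₑ ^ p) :=
        lintegral_mono fun x => enorm_rpow_le_two_rpow_mul hp _ _
    _ = 2 ^ (p - 1) * ((∫⁻ x in Q, ‖dw x‖ₑ ^ p) + ∫⁻ x in Q, ‖gradient (W j) x - dw x‖ₑ ^ p) := by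
        rw [lintegral_const_mul' _ _ h2, lintegral_add_left' (hdw.enorm.pow_const p).restrict]
    _ ≤ _ := by gcongr; exact Measure.restrict_le_self

theorem lintegral_translate_sub_le (h : SmoothApprox n p S w dw W) (hp : 1 ≤ p)
    (hdw : AEStronglyMeasurable dw) {Q : Set (Eu n)} (hQc : Convex ℝ Q) (hQ : MeasurableSet Q)
    (z : Eu n) :
    ∫⁻ x in Q ∩ (fun x => x + z) ⁻¹' Q, ‖w (x + z) - w x‖ₑ ^ p
      ≤ 2 ^ (p - 1) * ‖z‖ₑ ^ p * ∫⁻ x in Q, ‖dw x‖ₑ ^ p := by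
  have hp0 : 0 ≤ p := by linarith
  have hz : ‖z‖ₑ ^ p ≠ ⊤ := ENNReal.rpow_ne_top_of_nonneg hp0 enorm_ne_top
  have h2 : (2 : ℝ≥0∞) ^ (p - 1) ≠ ⊤ := ENNReal.rpow_ne_top_of_nonneg (by linarith) (by simp)
  have hlim : ∀ᵐ x, Filter.Tendsto (fun j => ‖W j (x + z) - W j x‖ₑ ^ p) Filter.atTop
      (𝓝 (‖w (x + z) - w x‖ₑ ^ p)) := by
    have h1 := (measurePreserving_add_right (volume : Measure (Eu n)) z).quasiMeasurePreserving.ae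
      h.tendsto_ae
    filter_upwards [h.tendsto_ae, h1] with x a b
    exact (ENNReal.continuous_rpow_const.tendsto _).comp
      ((continuous_enorm.tendsto _).comp (b.sub a))
  calc ∫⁻ x in Q ∩ (fun x => x + z) ⁻¹' Q, ‖w (x + z) - w x‖ₑ ^ p
      = ∫⁻ x in Q ∩ (fun x => x + z) ⁻¹' Q,
          Filter.liminf (fun j => ‖W j (x + z) - W j x‖ₑ ^ p) Filter.atTop := by
        refine lintegral_congr_ae (ae_restrict_of_ae ?_)
        filter_upwards [hlim] with x hx
        exact hx.liminf_eq.symm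
    _ ≤ Filter.liminf (fun j => ∫⁻ x in Q ∩ (fun x => x + z) ⁻¹' Q,
          ‖W j (x + z) - W j x‖ₑ ^ p) Filter.atTop := by
        refine lintegral_liminf_le fun j => ?_
        have hc : Continuous (W j) := (h.contDiff j).continuous
        exact (ENNReal.continuous_rpow_const.comp ((hc.comp (by fun_prop)).sub hc).enorm).measurable
    _ ≤ Filter.liminf (fun j => 2 ^ (p - 1) * ‖z‖ₑ ^ p * ((∫⁻ x in Q, ‖dw x‖ₑ ^ p)
          + ∫⁻ x, ‖gradient (W j) x - dw x‖ₑ ^ p)) Filter.atTop := by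
        refine Filter.liminf_le_liminf (Filter.Eventually.of_forall fun j => ?_)
        refine (lintegral_translate_sub_le_of_contDiff hp (h.contDiff j) hQc hQ z).trans ?_
        rw [mul_comm (2 ^ (p - 1)), mul_assoc]
        gcongr
        exact lintegral_gradient_le hp hdw j Q
    _ = _ := by
        refine Filter.Tendsto.liminf_eq ?_
        have := ENNReal.Tendsto.const_mul (h.tendsto_gradient.const_add (∫⁻ x in Q, ‖dw x‖ₑ ^ p))
          (a := 2 ^ (p - 1) * ‖z‖ₑ ^ p) (Or.inr (ENNReal.mul_ne_top h2 hz))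
        simpa using this

end SmoothApprox

/-- Poincaré inequality on a cube for functions vanishing on a large part of the cube, with a gain
depending on the measure of the set where the function does not vanish. -/
theorem exists_poincare_const (n : ℕ) {p : ℝ} (hp : 1 ≤ p) : ∃ C : ℝ≥0, ∀ (S : Set (Eu n))
    (w : Eu n → ℝ) (dw : Eu n → Eu n) (W : ℕ → Eu n → ℝ), SmoothApprox n p S w dw W →
    AEStronglyMeasurable w → AEStronglyMeasurable dw → ∀ (x₀ : Eu n) (s r : ℝ), 0 < s → s ≤ r →
    volume {x | x ∈ cube x₀ r ∧ w x ≠ 0} ≤ ENNReal.ofReal s ^ n / 2 →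
    ∫⁻ x in cube x₀ r, ‖w x‖ₑ ^ p ≤ C * ENNReal.ofReal s ^ p * ∫⁻ x in cube x₀ r, ‖dw x‖ₑ ^ p := by
  have hp0 : 0 < p := by linarith
  have h2 : (2 : ℝ≥0∞) ^ (p - 1) ≠ ⊤ := ENNReal.rpow_ne_top_of_nonneg (by linarith) (by simp)
  let C₀ : ℝ≥0∞ := 2 * (2 ^ n * (2 ^ (p - 1) * ENNReal.ofReal √n ^ p))
  have hC₀ : C₀ ≠ ⊤ := by
    refine ENNReal.mul_ne_top (by simp) (ENNReal.mul_ne_top (by simp) (ENNReal.mul_ne_top h2 ?_))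
    exact ENNReal.rpow_ne_top_of_nonneg hp0.le ENNReal.ofReal_ne_top
  refine ⟨C₀.toNNReal, ?_⟩
  rw [ENNReal.coe_toNNReal hC₀]
  intro S w dw W h hw hdw x₀ s r hs hsr hvol
  set Q := cube x₀ r with hQdef
  have hQ : MeasurableSet Q := measurableSet_cube _ _
  have hQc : Convex ℝ Q := convex_cube _ _
  have hsn0 : ENNReal.ofReal s ^ n ≠ 0 := pow_ne_zero _ (by simpa using hs)
  have hsnt : ENNReal.ofReal s ^ n ≠ ⊤ := ENNReal.pow_ne_top ENNReal.ofReal_ne_top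
  let f : Eu n → Eu n → ℝ≥0∞ := fun x z => Q.indicator 1 (x + z) * ‖w (x + z) - w x‖ₑ ^ p
  have hpt : ∀ x ∈ Q, ‖w x‖ₑ ^ p * (ENNReal.ofReal s ^ n / 2) ≤ ∫⁻ z in cube 0 s, f x z := by
    intro x hx
    let A := {z | z ∈ cube (0 : Eu n) s ∧ x + z ∈ Q ∧ w (x + z) = 0}
    have hA : ENNReal.ofReal s ^ n / 2 ≤ volume A := by
      let c : Eu n := WithLp.toLp 2 fun i => if x₀ i ≤ x i then - (s / 2) else s / 2
      have hcsub : cube c (s / 2) ⊆ A ∪ (fun z => x + z) ⁻¹' {y | y ∈ Q ∧ w y ≠ 0} := by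
        intro z hz
        have hz1 : z ∈ cube (0 : Eu n) s ∧ x + z ∈ Q := by
          constructor
          · intro i
            have := hz i
            simp only [c] at this
            rw [abs_le] at this
            have h0 : (0 : Eu n) i = 0 := rfl
            rw [h0, sub_zero, abs_le]
            split_ifs at this <;> constructor <;> linarith [this.1, this.2]
          · intro i
            have := hz i
            have hxi := hx i
            simp only [c] at this
            rw [abs_le] at this hxi
            rw [PiLp.add_apply, abs_le]
            split_ifs at this <;> constructor <;> linarith [this.1, this.2, hxi.1, hxi.2]
        by_cases hwz : w (x + z) = 0
        · exact Or.inl ⟨hz1.1, hz1.2, hwz⟩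
        · exact Or.inr ⟨hz1.2, hwz⟩
      have hle := (measure_mono hcsub).trans (measure_union_le (μ := volume) _ _)
      rw [volume_cube, measure_preimage_add, mul_div_cancel₀ s two_ne_zero] at hle
      have h3 : ENNReal.ofReal s ^ n / 2 + ENNReal.ofReal s ^ n / 2
          ≤ volume A + ENNReal.ofReal s ^ n / 2 := by
        rw [ENNReal.add_halves]; exact hle.trans (by gcongr)
      exact (ENNReal.add_le_add_iff_right (ENNReal.div_ne_top hsnt (by simp))).1 h3
    have hfm : AEMeasurable (f x) (volume.restrict (cube 0 s)) := by
      refine AEMeasurable.restrict (AEMeasurable.mul ?_ ?_)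
      · exact ((measurable_one.indicator hQ).comp (measurable_const_add x)).aemeasurable
      · exact ((hw.comp_quasiMeasurePreserving
          (measurePreserving_add_left volume x).quasiMeasurePreserving).sub
          aestronglyMeasurable_const).enorm.pow_const p
    refine le_trans ?_ (mul_meas_ge_le_lintegral₀ hfm (‖w x‖ₑ ^ p))
    gcongr
    rw [Measure.restrict_apply' (measurableSet_cube _ _)]
    refine hA.trans (measure_mono ?_)
    rintro z ⟨hz1, hz2, hz3⟩
    refine ⟨?_, hz1⟩
    show ‖w x‖ₑ ^ p ≤ f x z
    simp [f, hz2, hz3]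
  have hfm : AEMeasurable (Function.uncurry f) ((volume.restrict Q).prod
      (volume.restrict (cube 0 s))) := by
    rw [Measure.prod_restrict]
    refine AEMeasurable.restrict (AEMeasurable.mul ?_ ?_)
    · exact ((measurable_one.indicator hQ).comp measurable_add).aemeasurable
    · exact ((hw.comp_quasiMeasurePreserving
          (quasiMeasurePreserving_add volume volume)).sub
          hw.comp_fst).enorm.pow_const p
  have hmain : (∫⁻ x in Q, ‖w x‖ₑ ^ p) * (ENNReal.ofReal s ^ n / 2)
      ≤ ENNReal.ofReal (2 * s) ^ n * (2 ^ (p - 1) * ENNReal.ofReal (√n * s) ^ p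
        * ∫⁻ x in Q, ‖dw x‖ₑ ^ p) := by
    calc (∫⁻ x in Q, ‖w x‖ₑ ^ p) * (ENNReal.ofReal s ^ n / 2)
        = ∫⁻ x in Q, ‖w x‖ₑ ^ p * (ENNReal.ofReal s ^ n / 2) :=
          (lintegral_mul_const' _ _ (ENNReal.div_ne_top hsnt (by simp))).symm
      _ ≤ ∫⁻ x in Q, ∫⁻ z in cube 0 s, f x z := setLIntegral_mono' hQ hpt
      _ = ∫⁻ z in cube 0 s, ∫⁻ x in Q, f x z := lintegral_lintegral_swap hfm
      _ ≤ ∫⁻ z in cube (0 : Eu n) s, 2 ^ (p - 1) * ENNReal.ofReal (√n * s) ^ p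
            * ∫⁻ x in Q, ‖dw x‖ₑ ^ p := by
          refine setLIntegral_mono' (measurableSet_cube _ _) fun z hz => ?_
          have hzn : ‖z‖ₑ ≤ ENNReal.ofReal (√n * s) := by
            rw [← ofReal_norm]
            apply ENNReal.ofReal_le_ofReal
            simpa using cube_subset_closedBall 0 hs.le hz
          have hle := h.lintegral_translate_sub_le hp hdw hQc hQ z
          calc ∫⁻ x in Q, f x z
              = ∫⁻ x in Q ∩ (fun x => x + z) ⁻¹' Q, ‖w (x + z) - w x‖ₑ ^ p := by
                rw [inter_comm, ← Measure.restrict_restrict (measurable_add_const z hQ),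
                  ← lintegral_indicator (measurable_add_const z hQ)]
                refine lintegral_congr fun x => ?_
                by_cases hx : x + z ∈ Q
                · rw [indicator_of_mem (show x ∈ (fun x => x + z) ⁻¹' Q from hx)]
                  simp [f, hx]
                · rw [indicator_of_notMem (show x ∉ (fun x => x + z) ⁻¹' Q from hx)]
                  simp [f, hx]
            _ ≤ _ := hle
            _ ≤ _ := by gcongr
      _ = _ := by
          rw [setLIntegral_const, volume_cube, mul_comm]
  have hb0 : ENNReal.ofReal s ^ n / 2 ≠ 0 := by simp [ENNReal.div_eq_zero_iff, hs]
  have hbt : ENNReal.ofReal s ^ n / 2 ≠ ⊤ := ENNReal.div_ne_top hsnt (by simp)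
  rw [← ENNReal.mul_le_mul_iff_left hb0 hbt]
  refine hmain.trans (le_of_eq ?_)
  rw [ENNReal.ofReal_mul (by positivity), ENNReal.ofReal_mul (by positivity), mul_pow,
    ENNReal.mul_rpow_of_nonneg _ _ hp0.le]
  have e2 : (2 : ℝ≥0∞) * (ENNReal.ofReal s ^ n / 2) = ENNReal.ofReal s ^ n :=
    ENNReal.mul_div_cancel (by simp) (by simp)
  simp only [C₀, ENNReal.ofReal_ofNat]
  rw [show ∀ a b c d e f : ℝ≥0∞, 2 * (a * (b * c)) * d * e * f = a * (2 * f) * (b * (c * d) * e)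
    from fun a b c d e f => by ring, e2]

/-- Exponents `p < q` for which the Sobolev inequality holds in dimension `m`: either the critical
exponents, or `m = p = 1`. -/
structure SobolevExponents (m : ℕ) (p q : ℝ) : Prop where
  one_le : 1 ≤ p
  lt : p < q
  critical : (m = 1 ∧ p = 1) ∨ (p < m ∧ 1 / q = 1 / p - 1 / m)

theorem HasCompactSupport.lintegral_rpow_le_of_fin_one {q : ℝ} (hq : 0 < q) {g : (Fin 1 → ℝ) → ℝ}
    (hg : ContDiff ℝ 1 g) (hgc : HasCompactSupport g) {c : Fin 1 → ℝ} {R : ℝ}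
    (hgs : ∀ y, g y ≠ 0 → |y 0 - c 0| ≤ R) :
    ∫⁻ y, ‖g y‖ₑ ^ q ≤ ENNReal.ofReal (2 * R) * (∫⁻ y, ‖fderiv ℝ g y‖ₑ) ^ q := by
  let e : ℝ →L[ℝ] (Fin 1 → ℝ) := ContinuousLinearMap.pi fun _ => ContinuousLinearMap.id ℝ ℝ
  have he : ∀ y : Fin 1 → ℝ, e (y 0) = y := fun y => by
    ext j; simp [e, Subsingleton.elim j 0]
  have hen : ‖e‖ ≤ 1 := ContinuousLinearMap.opNorm_le_bound _ zero_le_one fun t => by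
    rw [one_mul, pi_norm_le_iff_of_nonneg (norm_nonneg _)]
    intro i; simp [e]
  have hmp := volume_preserving_funUnique (Fin 1) ℝ
  have h_int : ∀ F : (Fin 1 → ℝ) → ℝ≥0∞, ∫⁻ y, F y = ∫⁻ t : ℝ, F (e t) := by
    intro F
    exact (hmp.symm.lintegral_comp_emb (MeasurableEquiv.measurableEmbedding _) F).symm
  have hh : ContDiff ℝ 1 (g ∘ e) := hg.comp e.contDiff
  have hcl : Topology.IsClosedEmbedding e :=
    (Topology.IsClosedEmbedding.of_continuous_injective_isClosedMap e.continuous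
      (fun a b hab => by simpa [e] using congrFun hab 0)
      (fun s hs => by
        have : e '' s = (fun y : Fin 1 → ℝ => y 0) ⁻¹' s := by
          ext y; constructor
          · rintro ⟨t, ht, rfl⟩; simpa [e] using ht
          · intro hy; exact ⟨y 0, hy, he y⟩
        rw [this]; exact hs.preimage (continuous_apply 0)))
  have hhc : HasCompactSupport (g ∘ e) := hgc.comp_isClosedEmbedding hcl
  have hb : ∀ t, ‖g (e t)‖ₑ ≤ ∫⁻ y, ‖fderiv ℝ g y‖ₑ := by
    intro t
    refine (hhc.enorm_le_lintegral_Ici_deriv hh t).trans ?_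
    rw [h_int]
    refine (lintegral_mono_set (subset_univ _)).trans ?_
    rw [setLIntegral_univ]
    refine lintegral_mono fun s => ?_
    have hd : HasFDerivAt (g ∘ e) ((fderiv ℝ g (e s)).comp e) s :=
      ((hg.differentiable (by simp)) (e s)).hasFDerivAt.comp s e.hasFDerivAt
    rw [hd.hasDerivAt.deriv]
    rw [← ofReal_norm, ← ofReal_norm]
    refine ENNReal.ofReal_le_ofReal ?_
    refine (ContinuousLinearMap.le_opNorm _ _).trans ?_
    rw [norm_one, mul_one]
    refine (ContinuousLinearMap.opNorm_comp_le _ _).trans ?_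
    exact mul_le_of_le_one_right (norm_nonneg _) hen
  rw [h_int]
  calc ∫⁻ t, ‖g (e t)‖ₑ ^ q ≤ ∫⁻ t, (Icc (c 0 - R) (c 0 + R)).indicator
        (fun _ => (∫⁻ y, ‖fderiv ℝ g y‖ₑ) ^ q) t := by
        refine lintegral_mono fun t => ?_
        by_cases ht : t ∈ Icc (c 0 - R) (c 0 + R)
        · rw [indicator_of_mem ht]
          exact ENNReal.rpow_le_rpow (hb t) hq.le
        · rw [indicator_of_notMem ht]
          have : g (e t) = 0 := by
            by_contra h
            have := hgs _ h
            simp only [e, ContinuousLinearMap.coe_pi', ContinuousLinearMap.coe_id', id_eq,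
              abs_le] at this
            exact ht ⟨by linarith [this.1], by linarith [this.2]⟩
          simp [this, hq]
    _ = _ := by
        rw [lintegral_indicator measurableSet_Icc, setLIntegral_const, Real.volume_Icc, mul_comm]
        ring_nf

/-- The Sobolev inequality for the exponents of `SobolevExponents`, with the correct scaling. -/
theorem SobolevExponents.exists_const {m : ℕ} {p q : ℝ} (h : SobolevExponents m p q) :
    ∃ C : ℝ≥0, ∀ (g : (Fin m → ℝ) → ℝ) (c : Fin m → ℝ) (R : ℝ), 0 < R → ContDiff ℝ 1 g →
      HasCompactSupport g → (∀ y, g y ≠ 0 → ∀ i, |y i - c i| ≤ R) →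
      ∫⁻ y, ‖g y‖ₑ ^ q ≤ C * ENNReal.ofReal R ^ (m + q - m * q / p)
        * (∫⁻ y, ‖fderiv ℝ g y‖ₑ ^ p) ^ (q / p) := by
  have hp := h.one_le
  have hpq := h.lt
  have hp0 : 0 < p := by linarith
  have hq0 : 0 < q := by linarith
  rcases h.critical with ⟨rfl, rfl⟩ | ⟨hpm, hcrit⟩
  · refine ⟨2, fun g c R hR hg hgc hgs => ?_⟩
    refine (HasCompactSupport.lintegral_rpow_le_of_fin_one hq0 hg hgc
      (fun y hy => hgs y hy 0)).trans ?_
    have e : ((1 : ℕ) : ℝ) + q - ((1 : ℕ) : ℝ) * q / 1 = 1 := by push_cast; ring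
    rw [e, ENNReal.rpow_one, ENNReal.ofReal_mul (by norm_num)]
    simp
  · have hm0 : (0 : ℝ) < m := by linarith
    lift p to ℝ≥0 using hp0.le
    lift q to ℝ≥0 using hq0.le
    refine ⟨SNormLESNormFDerivOfEqConst ℝ (volume : Measure (Fin m → ℝ)) p ^ (q : ℝ), ?_⟩
    intro g c R hR hg hgc hgs
    have e : (m : ℝ) + q - m * q / p = 0 := by
      have hpp : (p : ℝ) ≠ 0 := hp0.ne'
      have hqq : (q : ℝ) ≠ 0 := hq0.ne'
      have : (p : ℝ) * m = q * m - q * p := by field_simp at hcrit; linarith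
      field_simp; linarith
    rw [e, ENNReal.rpow_zero, mul_one]
    have key := eLpNorm_le_eLpNorm_fderiv_of_eq (F := ℝ) (volume : Measure (Fin m → ℝ)) hg hgc
      (p := p) (p' := q) (by exact_mod_cast hp) (by simpa using hm0)
      (by simpa [one_div] using hcrit)
    rw [eLpNorm_eq_lintegral_rpow_enorm_toReal (by simpa using hq0.ne') ENNReal.coe_ne_top,
      eLpNorm_eq_lintegral_rpow_enorm_toReal (by simpa using hp0.ne') ENNReal.coe_ne_top] at key
    simp only [ENNReal.coe_toReal] at key
    have := ENNReal.rpow_le_rpow key hq0.le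
    rw [← ENNReal.rpow_mul, one_div, inv_mul_cancel₀ hq0.ne', ENNReal.rpow_one,
      ENNReal.mul_rpow_of_nonneg _ _ hq0.le, ← ENNReal.rpow_mul] at this
    refine this.trans (le_of_eq ?_)
    rw [ENNReal.coe_rpow_of_nonneg _ hq0.le]
    congr 2
    rw [one_div, div_eq_inv_mul]

/-- The parametrization of the hyperplane `{x | x i = t}`. -/
def sliceEmb {m : ℕ} (i : Fin (m + 1)) (t : ℝ) (y : Fin m → ℝ) : Eu (m + 1) :=
  WithLp.toLp 2 (i.insertNth t y)

theorem sliceEmb_same {m : ℕ} (i : Fin (m + 1)) (t : ℝ) (y : Fin m → ℝ) :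
    sliceEmb i t y i = t := by simp [sliceEmb]

theorem sliceEmb_succAbove {m : ℕ} (i : Fin (m + 1)) (t : ℝ) (y : Fin m → ℝ) (j : Fin m) :
    sliceEmb i t y (i.succAbove j) = y j := by simp [sliceEmb]

theorem measurePreserving_sliceEmb {m : ℕ} (i : Fin (m + 1)) :
    MeasurePreserving (fun z : ℝ × (Fin m → ℝ) => sliceEmb i z.1 z.2) volume volume :=
  (EuclideanSpace.volume_preserving_symm_measurableEquiv_toLp (Fin (m + 1))).symm.comp
    (volume_preserving_piFinSuccAbove (fun _ => ℝ) i).symm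

theorem lintegral_eq_lintegral_sliceEmb {m : ℕ} (i : Fin (m + 1)) {F : Eu (m + 1) → ℝ≥0∞}
    (hF : AEMeasurable F) : ∫⁻ x, F x = ∫⁻ t, ∫⁻ y, F (sliceEmb i t y) := by
  have hm := measurePreserving_sliceEmb i
  rw [← hm.map_eq, lintegral_map' (by rwa [hm.map_eq]) hm.aemeasurable, Measure.volume_eq_prod,
    lintegral_prod]
  exact hF.comp_quasiMeasurePreserving hm.quasiMeasurePreserving

theorem exists_slice_const {m : ℕ} {p q : ℝ} (h : SobolevExponents m p q) :
    ∃ C : ℝ≥0, ∀ (W : Eu (m + 1) → ℝ) (x₀ : Eu (m + 1)) (R : ℝ), 0 < R →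
      ContDiff ℝ (⊤ : ℕ∞) W → tsupport W ⊆ cube x₀ R → ∀ i t,
      ∫⁻ y, ‖W (sliceEmb i t y)‖ₑ ^ q ≤ C * ENNReal.ofReal R ^ (m + q - m * q / p)
        * (∫⁻ y, ‖gradient W (sliceEmb i t y)‖ₑ ^ p) ^ (q / p) := by
  have hp := h.one_le
  have hpq := h.lt
  have hp0 : 0 < p := by linarith
  have hq0 : 0 < q := by linarith
  obtain ⟨C, hC⟩ := h.exists_const
  let L : Fin (m + 1) → (Fin m → ℝ) →L[ℝ] Eu (m + 1) := fun i => LinearMap.toContinuousLinearMap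
    { toFun := fun y => WithLp.toLp 2 (i.insertNth (α := fun _ => ℝ) 0 y)
      map_add' := fun y z => by
        ext j; refine Fin.succAboveCases i ?_ (fun k => ?_) j <;> simp
      map_smul' := fun a y => by
        ext j; refine Fin.succAboveCases i ?_ (fun k => ?_) j <;> simp }
  have hL : ∀ i t y, sliceEmb i t y = L i y + sliceEmb i t 0 := by
    intro i t y
    ext j; refine Fin.succAboveCases i ?_ (fun k => ?_) j <;> simp [L, sliceEmb]
  let B : ℝ≥0 := ∑ i, ‖L i‖₊
  have hB : ∀ i, ‖L i‖₊ ≤ B := fun i => Finset.single_le_sum (f := fun i => ‖L i‖₊)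
    (fun _ _ => zero_le) (Finset.mem_univ i)
  refine ⟨C * B ^ q, fun W x₀ R hR hW hWs i t => ?_⟩
  have hemb : ContDiff ℝ 1 (sliceEmb i t) := by
    have : sliceEmb i t = fun y => L i y + sliceEmb i t 0 := funext (hL i t)
    rw [this]; exact (L i).contDiff.add contDiff_const
  have hW1 : ContDiff ℝ 1 W := hW.of_le (by simp)
  have hsupp : ∀ y, W (sliceEmb i t y) ≠ 0 → ∀ j, |y j - x₀ (i.succAbove j)| ≤ R := by
    intro y hy j
    have := hWs (subset_tsupport W hy) (i.succAbove j)
    rwa [sliceEmb_succAbove] at this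
  have hcs : HasCompactSupport (W ∘ sliceEmb i t) := by
    refine HasCompactSupport.of_support_subset_isCompact
      (isCompact_closedBall (fun j => x₀ (i.succAbove j)) R) ?_
    intro y hy
    rw [mem_closedBall, dist_pi_le_iff hR.le]
    exact fun j => hsupp y hy j
  refine (hC (W ∘ sliceEmb i t) (fun j => x₀ (i.succAbove j)) R hR (hW1.comp hemb) hcs
    hsupp).trans ?_
  have hfd : ∀ y, ‖fderiv ℝ (W ∘ sliceEmb i t) y‖ₑ ≤ B * ‖gradient W (sliceEmb i t y)‖ₑ := by
    intro y
    have h1 : HasFDerivAt (sliceEmb i t) (L i) y := by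
      have : sliceEmb i t = fun y => L i y + sliceEmb i t 0 := funext (hL i t)
      rw [this]; exact (L i).hasFDerivAt.add_const _
    have h2 := ((hW1.differentiable (by simp)) (sliceEmb i t y)).hasFDerivAt.comp y h1
    rw [h2.fderiv, enorm_eq_nnnorm, enorm_eq_nnnorm, ← ENNReal.coe_mul, ENNReal.coe_le_coe]
    have h3 : ‖gradient W (sliceEmb i t y)‖₊ = ‖fderiv ℝ W (sliceEmb i t y)‖₊ :=
      NNReal.eq (norm_gradient _ _)
    rw [h3, mul_comm]
    exact (ContinuousLinearMap.opNNNorm_comp_le _ _).trans (by gcongr; exact hB i)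
  calc _ ≤ C * ENNReal.ofReal R ^ (m + q - m * q / p)
        * (∫⁻ y, (B : ℝ≥0∞) ^ p * ‖gradient W (sliceEmb i t y)‖ₑ ^ p) ^ (q / p) := by
        gcongr with y
        rw [← ENNReal.mul_rpow_of_nonneg _ _ hp0.le]
        exact ENNReal.rpow_le_rpow (hfd y) hp0.le
    _ = _ := by
        rw [lintegral_const_mul' _ _ (ENNReal.rpow_ne_top_of_nonneg hp0.le ENNReal.coe_ne_top),
          ENNReal.mul_rpow_of_nonneg _ _ (by positivity), ← ENNReal.rpow_mul,
          mul_div_cancel₀ q hp0.ne', ENNReal.coe_mul, ENNReal.coe_rpow_of_nonneg _ hq0.le]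
        ring

namespace SmoothApprox

/-- The Sobolev inequality on almost every slice. -/
theorem ae_slice_le {m : ℕ} {p q : ℝ} (hpq : SobolevExponents m p q) {C : ℝ≥0} {x₀ : Eu (m + 1)}
    {R : ℝ} {w : Eu (m + 1) → ℝ} {dw : Eu (m + 1) → Eu (m + 1)} {W : ℕ → Eu (m + 1) → ℝ}
    (h : SmoothApprox (m + 1) p (cube x₀ R) w dw W) (hR : 0 < R) (hdw : AEStronglyMeasurable dw)
    (hC : ∀ (W : Eu (m + 1) → ℝ) (x₀ : Eu (m + 1)) (R : ℝ), 0 < R →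
      ContDiff ℝ (⊤ : ℕ∞) W → tsupport W ⊆ cube x₀ R → ∀ i t,
      ∫⁻ y, ‖W (sliceEmb i t y)‖ₑ ^ q ≤ C * ENNReal.ofReal R ^ (m + q - m * q / p)
        * (∫⁻ y, ‖gradient W (sliceEmb i t y)‖ₑ ^ p) ^ (q / p)) (i : Fin (m + 1)) :
    ∀ᵐ t, ∫⁻ y, ‖w (sliceEmb i t y)‖ₑ ^ q ≤ C * ENNReal.ofReal R ^ (m + q - m * q / p)
        * (2 ^ (p - 1) * ∫⁻ y, ‖dw (sliceEmb i t y)‖ₑ ^ p) ^ (q / p) := by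
  have hp := hpq.one_le
  have hp0 : 0 < p := by linarith
  have hq0 : 0 < q := by linarith [hpq.lt]
  have hm := measurePreserving_sliceEmb i
  have hqm := hm.quasiMeasurePreserving
  have hgm : ∀ j, AEMeasurable fun x => ‖gradient (W j) x - dw x‖ₑ ^ p := fun j =>
    ((continuous_gradient (h.contDiff j)).aestronglyMeasurable.sub hdw).enorm.pow_const p
  have hE : ∀ᵐ t, Filter.liminf (fun j => ∫⁻ y, ‖gradient (W j) (sliceEmb i t y)
      - dw (sliceEmb i t y)‖ₑ ^ p) Filter.atTop = 0 := by
    have hmeas : ∀ j, AEMeasurable fun t => ∫⁻ y, ‖gradient (W j) (sliceEmb i t y)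
      - dw (sliceEmb i t y)‖ₑ ^ p := fun j =>
      ((hgm j).comp_quasiMeasurePreserving hqm).lintegral_prod_right'
    have hlm : AEMeasurable fun t => Filter.liminf (fun j => ∫⁻ y, ‖gradient (W j)
        (sliceEmb i t y) - dw (sliceEmb i t y)‖ₑ ^ p) Filter.atTop := by
      simp_rw [Filter.liminf_eq_iSup_iInf_of_nat]
      exact AEMeasurable.iSup fun k => AEMeasurable.biInf _ (to_countable _) fun j _ => hmeas j
    refine (lintegral_eq_zero_iff' hlm).1 ?_
    refine le_antisymm ((lintegral_liminf_le' hmeas).trans (le_of_eq ?_)) zero_le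
    refine (h.tendsto_gradient.congr fun j => ?_).liminf_eq
    exact lintegral_eq_lintegral_sliceEmb i (hgm j)
  have hlim : ∀ᵐ t, ∀ᵐ y, Filter.Tendsto (fun j => W j (sliceEmb i t y)) Filter.atTop
      (𝓝 (w (sliceEmb i t y))) := Measure.ae_ae_of_ae_prod (hqm.ae h.tendsto_ae)
  have hdm : ∀ᵐ t, AEStronglyMeasurable fun y => dw (sliceEmb i t y) :=
    (hdw.comp_quasiMeasurePreserving hqm).prodMk_left
  filter_upwards [hE, hlim, hdm] with t h1 h2 h3
  set D := ∫⁻ y, ‖dw (sliceEmb i t y)‖ₑ ^ p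
  set e : ℕ → ℝ≥0∞ := fun j => ∫⁻ y, ‖gradient (W j) (sliceEmb i t y) - dw (sliceEmb i t y)‖ₑ ^ p
  set A : ℝ≥0∞ := C * ENNReal.ofReal R ^ (m + q - m * q / p)
  have hA : A ≠ ⊤ := ENNReal.mul_ne_top ENNReal.coe_ne_top
    (ENNReal.rpow_ne_top_of_ne_zero (by simpa using hR) ENNReal.ofReal_ne_top)
  have h2t : (2 : ℝ≥0∞) ^ (p - 1) ≠ ⊤ := ENNReal.rpow_ne_top_of_nonneg (by linarith) (by simp)
  let Φ : ℝ≥0∞ → ℝ≥0∞ := fun s => A * (2 ^ (p - 1) * (D + s)) ^ (q / p)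
  have hΦm : Monotone Φ := fun a b hab => by
    simp only [Φ]; gcongr
  have hΦc : Continuous Φ := by
    refine (ENNReal.continuous_const_mul hA).comp (ENNReal.continuous_rpow_const.comp
      ((ENNReal.continuous_const_mul h2t).comp (continuous_const.add continuous_id)))
  calc ∫⁻ y, ‖w (sliceEmb i t y)‖ₑ ^ q
      = ∫⁻ y, Filter.liminf (fun j => ‖W j (sliceEmb i t y)‖ₑ ^ q) Filter.atTop := by
        refine lintegral_congr_ae ?_
        filter_upwards [h2] with y hy
        exact ((ENNReal.continuous_rpow_const.tendsto _).comp
          ((continuous_enorm.tendsto _).comp hy)).liminf_eq.symm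
    _ ≤ Filter.liminf (fun j => ∫⁻ y, ‖W j (sliceEmb i t y)‖ₑ ^ q) Filter.atTop := by
        refine lintegral_liminf_le fun j => ?_
        have : Measurable fun y => W j (sliceEmb i t y) :=
          (h.contDiff j).continuous.measurable.comp (hm.measurable.comp measurable_prodMk_left)
        exact this.enorm.pow_const q
    _ ≤ Filter.liminf (fun j => Φ (e j)) Filter.atTop := by
        refine Filter.liminf_le_liminf (Filter.Eventually.of_forall fun j => ?_)
        refine (hC (W j) x₀ R hR (h.contDiff j) (h.tsupport_subset j) i t).trans ?_
        simp only [Φ]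
        gcongr
        calc ∫⁻ y, ‖gradient (W j) (sliceEmb i t y)‖ₑ ^ p
            ≤ ∫⁻ y, 2 ^ (p - 1) * (‖dw (sliceEmb i t y)‖ₑ ^ p
              + ‖gradient (W j) (sliceEmb i t y) - dw (sliceEmb i t y)‖ₑ ^ p) :=
              lintegral_mono fun y => enorm_rpow_le_two_rpow_mul hp _ _
          _ = _ := by
              rw [lintegral_const_mul' _ _ h2t, lintegral_add_left' (h3.enorm.pow_const p)]
    _ = Φ (Filter.liminf e Filter.atTop) :=
        (hΦm.map_liminf_of_continuousAt e hΦc.continuousAt).symm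
    _ = _ := by rw [h1]; simp [Φ]

end SmoothApprox

/-- `H` is a smooth function with values in `[0, 1]` which vanishes on `(-∞, a]` and equals `1` on
`[b, ∞)`. -/
structure IsSmoothStep (a b : ℝ) (H : ℝ → ℝ) : Prop where
  contDiff : ContDiff ℝ (⊤ : ℕ∞) H
  mem : ∀ t, H t ∈ Icc (0 : ℝ) 1
  eq_zero : ∀ t ≤ a, H t = 0
  eq_one : ∀ t, b ≤ t → H t = 1

/-- A smooth transition from `0` to `1` on `(a, b)` whose derivative is concentrated on the set
where a given function `A` is small. -/
theorem exists_smooth_step {A D : ℝ → ℝ≥0∞} (hA : AEMeasurable A) (hD : AEMeasurable D)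
    {a b s q : ℝ} (hab : a < b) (hs : 0 < s) (hq : 0 < q) {C D₀ M ε : ℝ≥0∞}
    (hAD : ∀ᵐ t, A t ≤ C * D t ^ s) (hM : M ≠ ⊤) (hAM : ∀ᵐ t, A t ≤ M)
    (hD₀ : D₀ ≠ ⊤) (hDD : ∫⁻ t in Ioo a b, D t ≤ D₀) (hε : ε ≠ 0) :
    ∃ H : ℝ → ℝ, IsSmoothStep a b H ∧ ∫⁻ t, A t * ‖deriv H t‖ₑ ^ q
        ≤ ENNReal.ofReal (4 / (b - a)) ^ q * (ENNReal.ofReal (b - a) *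
          (C * (ENNReal.ofReal (2 / (b - a)) * D₀) ^ s)) + ε := by
  set ℓ := b - a with hℓ
  have hℓ0 : 0 < ℓ := by linarith
  set A' := hA.mk A with hA'
  have hA'm : Measurable A' := hA.measurable_mk
  have hAA' : A =ᵐ[volume] A' := hA.ae_eq_mk
  set c : ℝ≥0∞ := C * (ENNReal.ofReal (2 / ℓ) * D₀) ^ s with hc
  have h2ℓ : ENNReal.ofReal (2 / ℓ) ≠ 0 := by simpa using by positivity
  have hbad : volume {t | t ∈ Ioo a b ∧ ENNReal.ofReal (2 / ℓ) * D₀ < D t}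
      ≤ ENNReal.ofReal (ℓ / 2) := by
    have hset : volume {t | t ∈ Ioo a b ∧ ENNReal.ofReal (2 / ℓ) * D₀ < D t}
        = (volume.restrict (Ioo a b)) {t | ENNReal.ofReal (2 / ℓ) * D₀ < D t} := by
      rw [Measure.restrict_apply' measurableSet_Ioo]; congr 1; ext t
      exact and_comm
    rw [hset]
    by_cases h0 : D₀ = 0
    · have h1 : ∫⁻ t in Ioo a b, D t = 0 := le_antisymm (h0 ▸ hDD) zero_le
      rw [lintegral_eq_zero_iff' hD.restrict] at h1
      have : (volume.restrict (Ioo a b)) {t | ENNReal.ofReal (2 / ℓ) * D₀ < D t} = 0 := by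
        have h2 : ∀ᵐ t ∂(volume.restrict (Ioo a b)), ¬ (ENNReal.ofReal (2 / ℓ) * D₀ < D t) := by
          filter_upwards [h1] with t ht
          simp [ht]
        have h3 := ae_iff.1 h2
        simp only [not_not] at h3
        exact h3
      rw [this]; exact zero_le
    · have hne : ENNReal.ofReal (2 / ℓ) * D₀ ≠ 0 := mul_ne_zero h2ℓ h0
      have hnt : ENNReal.ofReal (2 / ℓ) * D₀ ≠ ⊤ := ENNReal.mul_ne_top ENNReal.ofReal_ne_top hD₀
      have hsub : {t | ENNReal.ofReal (2 / ℓ) * D₀ < D t} ⊆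
          {t | ENNReal.ofReal (2 / ℓ) * D₀ ≤ D t} := fun t ht => (mem_ofPred_eq.mp ht : _ < _).le
      calc _ ≤ (volume.restrict (Ioo a b)) {t | ENNReal.ofReal (2 / ℓ) * D₀ ≤ D t} :=
            measure_mono hsub
        _ ≤ (∫⁻ t in Ioo a b, D t) / (ENNReal.ofReal (2 / ℓ) * D₀) :=
            meas_ge_le_lintegral_div hD.restrict hne hnt
        _ ≤ D₀ / (ENNReal.ofReal (2 / ℓ) * D₀) := by gcongr
        _ = _ := by
            rw [ENNReal.div_eq_inv_mul, ENNReal.mul_inv (Or.inl h2ℓ) (Or.inr h0), mul_assoc,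
              ENNReal.inv_mul_cancel h0 hD₀, mul_one, ← ENNReal.ofReal_inv_of_pos (by positivity),
              inv_div]
  let E := {t | t ∈ Ioo a b ∧ A' t ≤ c}
  have hEm : MeasurableSet E := measurableSet_Ioo.inter (hA'm measurableSet_Iic)
  have hEv : ENNReal.ofReal (ℓ / 2) ≤ volume E := by
    have hsub : (Ioo a b : Set ℝ) ≤ᵐ[volume] (E ∪ {t | t ∈ Ioo a b ∧
        ENNReal.ofReal (2 / ℓ) * D₀ < D t} : Set ℝ) := by
      filter_upwards [hAA', hAD] with t h1 h2 h3
      by_cases h4 : ENNReal.ofReal (2 / ℓ) * D₀ < D t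
      · exact Or.inr ⟨h3, h4⟩
      · refine Or.inl ⟨h3, ?_⟩
        rw [← h1]
        exact h2.trans (mul_le_mul' le_rfl (ENNReal.rpow_le_rpow (not_lt.1 h4) hs.le))
    have := (measure_mono_ae hsub).trans (measure_union_le _ _)
    rw [Real.volume_Ioo] at this
    have h3 : ENNReal.ofReal (ℓ / 2) + ENNReal.ofReal (ℓ / 2)
        ≤ volume E + ENNReal.ofReal (ℓ / 2) := by
      rw [← ENNReal.ofReal_add (by positivity) (by positivity), add_halves]
      exact this.trans (by gcongr)
    exact (ENNReal.add_le_add_iff_right ENNReal.ofReal_ne_top).1 h3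
  obtain ⟨K, hKE, hKc, hKv⟩ := hEm.exists_lt_isCompact (r := ENNReal.ofReal (ℓ / 4))
    (lt_of_lt_of_le ((ENNReal.ofReal_lt_ofReal_iff (by positivity)).2 (by linarith)) hEv)
  set B := ENNReal.ofReal (4 / ℓ) ^ q * M with hB
  have hBt : B ≠ ⊤ := ENNReal.mul_ne_top (ENNReal.rpow_ne_top_of_nonneg hq.le
    ENNReal.ofReal_ne_top) hM
  obtain ⟨U, hKU, hUo, hUv⟩ := hKc.exists_isOpen_lt_add (μ := volume) (ε := ε / B)
    (ENNReal.div_ne_zero.2 ⟨hε, hBt⟩)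
  have hKab : K ⊆ U ∩ Ioo a b := fun t ht => ⟨hKU ht, (hKE ht).1⟩
  obtain ⟨f, hf, hfc, hfU, hf1, hf01⟩ := exists_smooth_cutoff hKc (hUo.inter isOpen_Ioo) hKab
  have hf1' : ∀ t ∈ K, f t = 1 := fun t ht => (hf1.filter_mono (nhds_le_nhdsSet ht)).self_of_nhds
  have hf0 : ∀ t ∉ U ∩ Ioo a b, f t = 0 := fun t ht =>
    image_eq_zero_of_notMem_tsupport fun h => ht (hfU h)
  have hii : ∀ s t, IntervalIntegrable f volume s t := fun s t => hf.continuous.intervalIntegrable _ _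
  set I := ∫ t in a..b, f t with hI
  have hIlow : ℓ / 4 ≤ I := by
    rw [hI, intervalIntegral.integral_of_le hab.le]
    have h1 : ∫ t in K, (1 : ℝ) ≤ ∫ t in Ioc a b, f t := by
      calc ∫ t in K, (1 : ℝ) = ∫ t in K, f t := by
            refine setIntegral_congr_fun hKc.measurableSet fun t ht => (hf1' t ht).symm
        _ ≤ _ := by
            refine setIntegral_mono_set ((hii a b).1) (Filter.Eventually.of_forall fun t => (hf01 t).1)
              (Filter.Eventually.of_forall fun t ht => Ioo_subset_Ioc_self (hKE ht).1)
    refine le_trans ?_ h1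
    rw [setIntegral_const, smul_eq_mul, mul_one, Measure.real]
    exact (ENNReal.ofReal_le_iff_le_toReal hKc.measure_lt_top.ne).1 hKv.le
  have hI0 : 0 < I := by linarith [div_pos hℓ0 (show (0 : ℝ) < 4 by norm_num)]
  let H : ℝ → ℝ := fun t => I⁻¹ * ∫ τ in a..t, f τ
  have hHd : ∀ t, HasDerivAt H (I⁻¹ * f t) t := fun t =>
    (intervalIntegral.integral_hasDerivAt_right (hii a t)
      (hf.continuous.stronglyMeasurableAtFilter _ _) hf.continuous.continuousAt).const_mul _
  have hHderiv : deriv H = fun t => I⁻¹ * f t := funext fun t => (hHd t).deriv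
  have hmono : Monotone H := monotone_of_deriv_nonneg (fun t => (hHd t).differentiableAt)
    (fun t => by rw [hHderiv]; exact mul_nonneg (inv_nonneg.2 hI0.le) (hf01 t).1)
  have hHa : ∀ t ≤ a, H t = 0 := by
    intro t ht
    simp only [H]
    rw [intervalIntegral.integral_symm, intervalIntegral.integral_of_le ht,
      integral_Ioc_eq_integral_Ioo, setIntegral_eq_zero_of_forall_eq_zero]
    · simp
    · intro τ hτ
      exact hf0 τ fun h => by linarith [h.2.1, hτ.2]
  have hHb : ∀ t, b ≤ t → H t = 1 := by
    intro t ht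
    simp only [H]
    rw [← intervalIntegral.integral_add_adjacent_intervals (hii a b) (hii b t),
      intervalIntegral.integral_of_le ht, setIntegral_eq_zero_of_forall_eq_zero (t := Ioc b t)]
    · rw [add_zero]; exact inv_mul_cancel₀ hI0.ne'
    · intro τ hτ
      exact hf0 τ fun h => by linarith [h.2.2, hτ.1]
  refine ⟨H, ⟨?_, ?_, hHa, hHb⟩, ?_⟩
  · refine contDiff_infty_iff_deriv.2 ⟨fun t => (hHd t).differentiableAt, ?_⟩
    rw [hHderiv]; exact contDiff_const.mul hf
  · intro t
    constructor
    · rw [← hHa (min a t) (min_le_left _ _)]; exact hmono (min_le_right _ _)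
    · rw [← hHb (max b t) (le_max_left _ _)]; exact hmono (le_max_right _ _)
  have hder : ∀ t, ‖deriv H t‖ₑ ≤ ENNReal.ofReal (4 / ℓ) := by
    intro t
    rw [hHderiv, ← ofReal_norm]
    refine ENNReal.ofReal_le_ofReal ?_
    rw [norm_mul, Real.norm_of_nonneg (inv_nonneg.2 hI0.le), Real.norm_of_nonneg (hf01 t).1]
    calc I⁻¹ * f t ≤ (ℓ / 4)⁻¹ * 1 := by
          gcongr
          exacts [(hf01 t).1, (hf01 t).2]
      _ = 4 / ℓ := by rw [mul_one, inv_div]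
  have hKm := hKc.measurableSet
  have hUm : MeasurableSet (U ∩ Ioo a b) := hUo.measurableSet.inter measurableSet_Ioo
  have hdiff : volume ((U ∩ Ioo a b) \ K) ≤ ε / B := by
    have h1 : volume (U \ K) ≤ ε / B := by
      rw [measure_sdiff hKU hKm.nullMeasurableSet hKc.measure_lt_top.ne]
      exact tsub_le_iff_left.2 hUv.le
    exact (measure_mono (sdiff_subset_sdiff_left inter_subset_left)).trans h1
  calc ∫⁻ t, A t * ‖deriv H t‖ₑ ^ q
      ≤ ∫⁻ t, ENNReal.ofReal (4 / ℓ) ^ q * (K.indicator (fun _ => c) t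
          + ((U ∩ Ioo a b) \ K).indicator (fun _ => M) t) := by
        refine lintegral_mono_ae ?_
        filter_upwards [hAA', hAM] with t h1 h2
        by_cases htK : t ∈ K
        · rw [indicator_of_mem htK, mul_comm]
          have : A t ≤ c := h1 ▸ (hKE htK).2
          exact mul_le_mul' (ENNReal.rpow_le_rpow (hder t) hq.le) (this.trans le_self_add)
        by_cases htU : t ∈ U ∩ Ioo a b
        · rw [indicator_of_mem (show t ∈ (U ∩ Ioo a b) \ K from ⟨htU, htK⟩), mul_comm]
          exact mul_le_mul' (ENNReal.rpow_le_rpow (hder t) hq.le) (h2.trans le_add_self)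
        · have : deriv H t = 0 := by rw [hHderiv]; simp [hf0 t htU]
          simp [this, hq]
    _ = ENNReal.ofReal (4 / ℓ) ^ q * (c * volume K + M * volume ((U ∩ Ioo a b) \ K)) := by
        rw [lintegral_const_mul' _ _ (ENNReal.rpow_ne_top_of_nonneg hq.le ENNReal.ofReal_ne_top),
          lintegral_add_left (measurable_const.indicator hKm), lintegral_indicator_const hKm,
          lintegral_indicator_const (hUm.diff hKm)]
    _ ≤ ENNReal.ofReal (4 / ℓ) ^ q * (c * ENNReal.ofReal ℓ + M * (ε / B)) := by
        gcongr
        rw [hℓ, ← Real.volume_Ioo]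
        exact measure_mono fun t ht => (hKE ht).1
    _ = ENNReal.ofReal (4 / ℓ) ^ q * (ENNReal.ofReal ℓ * c) + B * (ε / B) := by
        rw [mul_add, ← mul_assoc _ M, mul_comm c]
    _ ≤ _ := by gcongr; exact ENNReal.mul_div_le

/-- Cutoff functions for cubes built from smooth steps in each variable. -/
theorem exists_cutoff_of_isSmoothStep {n : ℕ} {x₀ : Eu n} {ρ τ : ℝ}
    {Hm Hp : Fin n → ℝ → ℝ} (hm : ∀ i, IsSmoothStep (x₀ i - τ) (x₀ i - ρ) (Hm i))
    (hp : ∀ i, IsSmoothStep (x₀ i + ρ) (x₀ i + τ) (Hp i)) :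
    ∃ η : Eu n → ℝ, ContDiff ℝ (⊤ : ℕ∞) η ∧ (∀ x, η x ∈ Icc (0 : ℝ) 1) ∧
      (∀ x ∈ cube x₀ ρ, η x = 1) ∧ tsupport η ⊆ cube x₀ τ ∧
      ∀ x, ‖gradient η x‖ₑ ≤ ∑ i, (‖deriv (Hm i) (x i)‖ₑ + ‖deriv (Hp i) (x i)‖ₑ) := by
  let g : Fin n → Eu n → ℝ := fun i x => Hm i (x i) * (1 - Hp i (x i))
  have hg01 : ∀ i x, g i x ∈ Icc (0 : ℝ) 1 := by
    intro i x
    have h1 := (hm i).mem (x i)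
    have h2 := (hp i).mem (x i)
    exact ⟨mul_nonneg h1.1 (by linarith [h2.2]),
      mul_le_one₀ h1.2 (by linarith [h2.2]) (by linarith [h2.1])⟩
  have hc : ∀ i, ContDiff ℝ (⊤ : ℕ∞) fun x : Eu n => x i := fun i =>
    (EuclideanSpace.proj (𝕜 := ℝ) i).contDiff
  refine ⟨fun x => ∏ i, g i x, ?_, ?_, ?_, ?_, ?_⟩
  · exact contDiff_prod fun i _ => ((hm i).contDiff.comp (hc i)).mul
      (contDiff_const.sub ((hp i).contDiff.comp (hc i)))
  · exact fun x => ⟨Finset.prod_nonneg fun i _ => (hg01 i x).1,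
      Finset.prod_le_one (fun i _ => (hg01 i x).1) fun i _ => (hg01 i x).2⟩
  · intro x hx
    refine Finset.prod_eq_one fun i _ => ?_
    have := abs_le.1 (hx i)
    simp only [g]
    rw [(hm i).eq_one _ (by linarith [this.1]), (hp i).eq_zero _ (by linarith [this.2])]
    norm_num
  · refine closure_minimal (fun x hx => ?_) (isClosed_cube _ _)
    intro i
    by_contra hcon
    refine hx (Finset.prod_eq_zero (Finset.mem_univ i) ?_)
    simp only [g]
    rw [abs_le, not_and_or] at hcon
    rcases hcon with h | h
    · rw [(hm i).eq_zero _ (by linarith)]; simp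
    · rw [(hp i).eq_one _ (by linarith)]; simp
  · intro x
    let a : Fin n → ℝ := fun i =>
      Hm i (x i) * (0 - deriv (Hp i) (x i)) + (1 - Hp i (x i)) * deriv (Hm i) (x i)
    have hd : ∀ i, HasFDerivAt (g i) (a i • EuclideanSpace.proj (𝕜 := ℝ) i) x := by
      intro i
      have hx : HasFDerivAt (fun x : Eu n => x i) (EuclideanSpace.proj (𝕜 := ℝ) i) x :=
        (EuclideanSpace.proj (𝕜 := ℝ) i).hasFDerivAt
      have h1 := (((hm i).contDiff.differentiable (by simp)) (x i)).hasDerivAt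
      have h2 := (((hp i).contDiff.differentiable (by simp)) (x i)).hasDerivAt
      have h3 := h1.mul ((hasDerivAt_const (x i) (1 : ℝ)).sub h2)
      have h4 := h3.comp_hasFDerivAt x hx
      refine h4.congr_fderiv ?_
      congr 1
      simp only [a, Pi.sub_apply]
      ring
    have hD := HasFDerivAt.finsetProd (u := Finset.univ) (fun i _ => hd i)
    have hpn : ∀ i : Fin n, ‖EuclideanSpace.proj (𝕜 := ℝ) (ι := Fin n) i‖ₑ ≤ 1 := by
      intro i
      rw [← ofReal_norm, ← ENNReal.ofReal_one]
      refine ENNReal.ofReal_le_ofReal (ContinuousLinearMap.opNorm_le_bound _ zero_le_one fun z => ?_)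
      rw [one_mul]; exact PiLp.norm_apply_le z i
    have hle1 : ∀ t ∈ Icc (0 : ℝ) 1, ‖t‖ₑ ≤ 1 := fun t ht => by
      rw [← ofReal_norm, ← ENNReal.ofReal_one, Real.norm_of_nonneg ht.1]
      exact ENNReal.ofReal_le_ofReal ht.2
    have hen : ‖gradient (fun x => ∏ i, g i x) x‖ₑ = ‖fderiv ℝ (fun x => ∏ i, g i x) x‖ₑ := by
      rw [← ofReal_norm, norm_gradient, ofReal_norm]
    rw [hen, hD.fderiv]
    have hsum : ∀ F : Fin n → (Eu n →L[ℝ] ℝ), ‖∑ i, F i‖ₑ ≤ ∑ i, ‖F i‖ₑ := by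
      intro F
      simp_rw [← ofReal_norm]
      rw [← ENNReal.ofReal_sum_of_nonneg fun i _ => norm_nonneg _]
      exact ENNReal.ofReal_le_ofReal (norm_sum_le _ _)
    refine (hsum _).trans (Finset.sum_le_sum fun i _ => ?_)
    rw [enorm_smul, enorm_smul]
    calc _ ≤ 1 * (‖a i‖ₑ * 1) := by
          gcongr
          · exact hle1 _ ⟨Finset.prod_nonneg fun j _ => (hg01 j x).1,
              Finset.prod_le_one (fun j _ => (hg01 j x).1) fun j _ => (hg01 j x).2⟩
          · exact hpn i
      _ = ‖a i‖ₑ := by ring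
      _ ≤ ‖Hm i (x i)‖ₑ * ‖0 - deriv (Hp i) (x i)‖ₑ
          + ‖1 - Hp i (x i)‖ₑ * ‖deriv (Hm i) (x i)‖ₑ := by
          rw [← enorm_mul, ← enorm_mul]; exact enorm_add_le _ _
      _ ≤ 1 * ‖deriv (Hp i) (x i)‖ₑ + 1 * ‖deriv (Hm i) (x i)‖ₑ := by
          have h1 := (hp i).mem (x i)
          rw [zero_sub, enorm_neg]
          gcongr
          · exact hle1 _ ((hm i).mem _)
          · exact hle1 _ ⟨by linarith [h1.2], by linarith [h1.1]⟩
      _ = _ := by ring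

theorem exists_isSmoothStep_bound : ∃ B : ℝ≥0, ∀ a b : ℝ, a < b → ∃ H, IsSmoothStep a b H ∧
    ∀ t, ‖deriv H t‖ₑ ≤ B / ENNReal.ofReal (b - a) := by
  have hS : ContDiff ℝ (⊤ : ℕ∞) Real.smoothTransition := Real.smoothTransition.contDiff
  have hSd : Continuous (deriv Real.smoothTransition) := hS.continuous_deriv (by simp)
  have hcs : HasCompactSupport (deriv Real.smoothTransition) := by
    refine HasCompactSupport.of_support_subset_isCompact (isCompact_Icc (a := (0 : ℝ)) (b := 1)) ?_
    intro t ht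
    by_contra hcon
    rw [mem_Icc, not_and_or, not_le, not_le] at hcon
    refine ht ?_
    rcases hcon with h | h
    · have : Real.smoothTransition =ᶠ[𝓝 t] fun _ => 0 := by
        filter_upwards [Iio_mem_nhds h] with s hs
        exact Real.smoothTransition.zero_of_nonpos (le_of_lt hs)
      rw [this.deriv_eq]; simp
    · have : Real.smoothTransition =ᶠ[𝓝 t] fun _ => 1 := by
        filter_upwards [Ioi_mem_nhds h] with s hs
        exact Real.smoothTransition.one_of_one_le (le_of_lt hs)
      rw [this.deriv_eq]; simp
  obtain ⟨B, hB⟩ := hcs.exists_bound_of_continuous hSd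
  have hB0 : 0 ≤ B := (norm_nonneg _).trans (hB 0)
  refine ⟨⟨B, hB0⟩, fun a b hab => ?_⟩
  have hl : 0 < b - a := by linarith
  refine ⟨fun t => Real.smoothTransition ((t - a) / (b - a)), ⟨?_, ?_, ?_, ?_⟩, ?_⟩
  · exact hS.comp ((contDiff_id.sub contDiff_const).div_const _)
  · exact fun t => ⟨Real.smoothTransition.nonneg _, Real.smoothTransition.le_one _⟩
  · exact fun t ht => Real.smoothTransition.zero_of_nonpos
      (div_nonpos_of_nonpos_of_nonneg (by linarith) hl.le)
  · exact fun t ht => Real.smoothTransition.one_of_one_le ((one_le_div hl).2 (by linarith))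
  · intro t
    have h1 : HasDerivAt (fun t => (t - a) / (b - a)) (1 / (b - a)) t :=
      ((hasDerivAt_id t).sub_const a).div_const _
    have h2 := ((hS.differentiable (by simp)) ((t - a) / (b - a))).hasDerivAt.comp t h1
    have h3 : deriv (fun t => Real.smoothTransition ((t - a) / (b - a))) t
        = deriv Real.smoothTransition ((t - a) / (b - a)) * (1 / (b - a)) := h2.deriv
    rw [h3, ← ofReal_norm, norm_mul, Real.norm_of_nonneg (show 0 ≤ 1 / (b - a) by positivity),
      ENNReal.ofReal_mul (norm_nonneg _), one_div, ENNReal.ofReal_inv_of_pos hl,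
      ENNReal.div_eq_inv_mul, mul_comm]
    gcongr
    exact (ENNReal.ofReal_le_ofReal (hB _)).trans (le_of_eq (ENNReal.ofReal_eq_coe_nnreal hB0))

theorem exists_standard_cutoff (n : ℕ) : ∃ B : ℝ≥0, ∀ (x₀ : Eu n) (ρ τ : ℝ), ρ < τ →
    ∃ ζ : Eu n → ℝ, ContDiff ℝ (⊤ : ℕ∞) ζ ∧ (∀ x, ζ x ∈ Icc (0 : ℝ) 1) ∧
      (∀ x ∈ cube x₀ ρ, ζ x = 1) ∧ tsupport ζ ⊆ cube x₀ τ ∧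
      ∀ x, ‖gradient ζ x‖ₑ ≤ B / ENNReal.ofReal (τ - ρ) := by
  obtain ⟨B, hB⟩ := exists_isSmoothStep_bound
  refine ⟨n * (2 * B), fun x₀ ρ τ hρτ => ?_⟩
  choose Hm hm hmB using fun i => hB (x₀ i - τ) (x₀ i - ρ) (by linarith)
  choose Hp hp hpB using fun i => hB (x₀ i + ρ) (x₀ i + τ) (by linarith)
  obtain ⟨ζ, h1, h2, h3, h4, h5⟩ := exists_cutoff_of_isSmoothStep hm hp
  refine ⟨ζ, h1, h2, h3, h4, fun x => (h5 x).trans ?_⟩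
  calc _ ≤ ∑ _i : Fin n, (B / ENNReal.ofReal (τ - ρ) + B / ENNReal.ofReal (τ - ρ)) := by
        gcongr with i
        · refine (hmB i _).trans (le_of_eq ?_); congr 2; ring
        · refine (hpB i _).trans (le_of_eq ?_); congr 2; ring
    _ = _ := by
        rw [Finset.sum_const, Finset.card_univ, Fintype.card_fin, nsmul_eq_mul, ← two_mul]
        push_cast
        simp only [div_eq_mul_inv]; ring

theorem aemeasurable_lintegral_sliceEmb {m : ℕ} (i : Fin (m + 1)) {F : Eu (m + 1) → ℝ≥0∞}
    (hF : AEMeasurable F) : AEMeasurable fun t => ∫⁻ y, F (sliceEmb i t y) := by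
  have := hF.comp_quasiMeasurePreserving (measurePreserving_sliceEmb i).quasiMeasurePreserving
  exact AEMeasurable.lintegral_prod_right' (μ := volume) (ν := volume) this

theorem lintegral_sliceEmb_le_of_bounded {m : ℕ} {q : ℝ} (hq : 0 < q) {w : Eu (m + 1) → ℝ}
    {x₀ : Eu (m + 1)} {σ M : ℝ} (hwM : ∀ x, |w x| ≤ M) (hw0 : ∀ x ∉ cube x₀ σ, w x = 0)
    (i : Fin (m + 1)) : ∃ A : ℝ≥0∞, A ≠ ⊤ ∧ ∀ t, ∫⁻ y, ‖w (sliceEmb i t y)‖ₑ ^ q ≤ A := by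
  let S : Set (Fin m → ℝ) := closedBall (fun j => x₀ (i.succAbove j)) |σ|
  refine ⟨ENNReal.ofReal M ^ q * volume S, ?_, fun t => ?_⟩
  · exact ENNReal.mul_ne_top (ENNReal.rpow_ne_top_of_nonneg hq.le ENNReal.ofReal_ne_top)
      (isCompact_closedBall _ _).measure_ne_top
  · rw [← setLIntegral_const]
    rw [← lintegral_indicator isClosed_closedBall.measurableSet]
    refine lintegral_mono fun y => ?_
    by_cases hy : y ∈ S
    · rw [indicator_of_mem hy]
      gcongr
      rw [← ofReal_norm]
      exact ENNReal.ofReal_le_ofReal (hwM _)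
    · have : w (sliceEmb i t y) = 0 := by
        refine hw0 _ fun hc => hy ?_
        rw [mem_closedBall, dist_pi_le_iff (abs_nonneg σ)]
        intro j
        have := hc (i.succAbove j)
        rw [sliceEmb_succAbove] at this
        rw [Real.dist_eq]
        exact this.trans (le_abs_self σ)
      rw [this]
      simp [hq]

/-- A cutoff function adapted to `w`: on each slice direction the slope is concentrated where the
slices of `w` are small. -/
theorem exists_cutoff_of_slice_le {m : ℕ} {p q s : ℝ} (hq : 1 ≤ q) (hs : 0 < s)
    {w : Eu (m + 1) → ℝ} {dw : Eu (m + 1) → Eu (m + 1)} (hw : AEStronglyMeasurable w)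
    (hdw : AEStronglyMeasurable dw) {x₀ : Eu (m + 1)} {σ M : ℝ} (hwM : ∀ x, |w x| ≤ M)
    (hw0 : ∀ x ∉ cube x₀ σ, w x = 0) {C : ℝ≥0∞}
    (hslice : ∀ i, ∀ᵐ t, ∫⁻ y, ‖w (sliceEmb i t y)‖ₑ ^ q
      ≤ C * (∫⁻ y, ‖dw (sliceEmb i t y)‖ₑ ^ p) ^ s)
    (hE : ∫⁻ x, ‖dw x‖ₑ ^ p ≠ ⊤) {ρ τ : ℝ} (hρτ : ρ < τ) {ε : ℝ≥0∞} (hε : ε ≠ 0) :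
    ∃ η : Eu (m + 1) → ℝ, ContDiff ℝ (⊤ : ℕ∞) η ∧ (∀ x, η x ∈ Icc (0 : ℝ) 1) ∧
      (∀ x ∈ cube x₀ ρ, η x = 1) ∧ tsupport η ⊆ cube x₀ τ ∧
      ∫⁻ x, ‖w x‖ₑ ^ q * ‖gradient η x‖ₑ ^ q ≤
        ((m + 1 : ℕ) : ℝ≥0∞) ^ (q - 1) * 2 ^ (q - 1) * ((m + 1 : ℕ) * 2) *
          (ENNReal.ofReal (4 / (τ - ρ)) ^ q * (ENNReal.ofReal (τ - ρ) *
            (C * (ENNReal.ofReal (2 / (τ - ρ)) * ∫⁻ x, ‖dw x‖ₑ ^ p) ^ s))) + ε := by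
  have hq0 : 0 < q := by linarith
  set K : ℝ≥0∞ := ((m + 1 : ℕ) : ℝ≥0∞) ^ (q - 1) * 2 ^ (q - 1) * ((m + 1 : ℕ) * 2) with hK
  set T : ℝ≥0∞ := ENNReal.ofReal (4 / (τ - ρ)) ^ q * (ENNReal.ofReal (τ - ρ) *
            (C * (ENNReal.ofReal (2 / (τ - ρ)) * ∫⁻ x, ‖dw x‖ₑ ^ p) ^ s)) with hT
  have hKt : K ≠ ⊤ := by
    refine ENNReal.mul_ne_top (ENNReal.mul_ne_top ?_ ?_) (ENNReal.mul_ne_top ?_ ?_)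
    · exact ENNReal.rpow_ne_top_of_nonneg (by linarith) (ENNReal.natCast_ne_top _)
    · exact ENNReal.rpow_ne_top_of_nonneg (by linarith) (by simp)
    · exact ENNReal.natCast_ne_top _
    · simp
  have hε' : ε / K ≠ 0 := (ENNReal.div_pos hε hKt).ne'
  have hwq : AEMeasurable fun x => ‖w x‖ₑ ^ q := hw.enorm.pow_const q
  have hdp : AEMeasurable fun x => ‖dw x‖ₑ ^ p := hdw.enorm.pow_const p
  have key : ∀ (i : Fin (m + 1)) (a b : ℝ), b - a = τ - ρ → ∃ H, IsSmoothStep a b H ∧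
      ∫⁻ x, ‖w x‖ₑ ^ q * ‖deriv H (x i)‖ₑ ^ q ≤ T + ε / K := by
    intro i a b hab
    obtain ⟨A, hA, hAw⟩ := lintegral_sliceEmb_le_of_bounded hq0 hwM hw0 i
    have hdd : ∫⁻ t in Ioo a b, ∫⁻ y, ‖dw (sliceEmb i t y)‖ₑ ^ p ≤ ∫⁻ x, ‖dw x‖ₑ ^ p := by
      rw [lintegral_eq_lintegral_sliceEmb i hdp]
      exact setLIntegral_le_lintegral _ _
    obtain ⟨H, hH, hHb⟩ := exists_smooth_step (aemeasurable_lintegral_sliceEmb i hwq)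
      (aemeasurable_lintegral_sliceEmb i hdp) (by linarith) hs hq0 (hslice i) hA
      (ae_of_all _ hAw) hE hdd hε'
    refine ⟨H, hH, ?_⟩
    rw [hab] at hHb
    refine le_trans (le_of_eq ?_) hHb
    have hHc : Continuous (deriv H) := hH.contDiff.continuous_deriv (by simp)
    rw [lintegral_eq_lintegral_sliceEmb i]
    · refine lintegral_congr fun t => ?_
      simp_rw [sliceEmb_same]
      rw [lintegral_mul_const']
      exact ENNReal.rpow_ne_top_of_nonneg hq0.le enorm_ne_top
    · refine hwq.mul (AEMeasurable.pow_const (Measurable.aemeasurable ?_) q)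
      have : Continuous fun x : Eu (m + 1) => deriv H (x i) := hHc.comp (by fun_prop)
      exact this.measurable.enorm
  choose Hm hm hmB using fun i => key i (x₀ i - τ) (x₀ i - ρ) (by ring)
  choose Hp hp' hpB using fun i => key i (x₀ i + ρ) (x₀ i + τ) (by ring)
  obtain ⟨η, h1, h2, h3, h4, h5⟩ := exists_cutoff_of_isSmoothStep hm hp'
  refine ⟨η, h1, h2, h3, h4, ?_⟩
  have hmeas : ∀ (H : ℝ → ℝ) (a b : ℝ) (i : Fin (m + 1)), IsSmoothStep a b H →
      AEMeasurable fun x : Eu (m + 1) => ‖w x‖ₑ ^ q * ‖deriv H (x i)‖ₑ ^ q := by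
    intro H a b i hH
    have hHc : Continuous (deriv H) := hH.contDiff.continuous_deriv (by simp)
    refine hwq.mul (AEMeasurable.pow_const (Measurable.aemeasurable ?_) q)
    have : Continuous fun x : Eu (m + 1) => deriv H (x i) := hHc.comp (by fun_prop)
    exact this.measurable.enorm
  calc ∫⁻ x, ‖w x‖ₑ ^ q * ‖gradient η x‖ₑ ^ q
      ≤ ∫⁻ x, ((m + 1 : ℕ) : ℝ≥0∞) ^ (q - 1) * 2 ^ (q - 1) * ∑ i,
          (‖w x‖ₑ ^ q * ‖deriv (Hm i) (x i)‖ₑ ^ q + ‖w x‖ₑ ^ q * ‖deriv (Hp i) (x i)‖ₑ ^ q) := by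
        refine lintegral_mono fun x => ?_
        calc ‖w x‖ₑ ^ q * ‖gradient η x‖ₑ ^ q
            ≤ ‖w x‖ₑ ^ q * (∑ i, (‖deriv (Hm i) (x i)‖ₑ + ‖deriv (Hp i) (x i)‖ₑ)) ^ q := by
              gcongr; exact h5 x
          _ ≤ ‖w x‖ₑ ^ q * (((m + 1 : ℕ) : ℝ≥0∞) ^ (q - 1) *
                ∑ i, (‖deriv (Hm i) (x i)‖ₑ + ‖deriv (Hp i) (x i)‖ₑ) ^ q) := by
              gcongr
              refine (ENNReal.rpow_sum_le_const_mul_sum_rpow _ _ hq).trans ?_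
              simp
          _ ≤ ‖w x‖ₑ ^ q * (((m + 1 : ℕ) : ℝ≥0∞) ^ (q - 1) *
                ∑ i, (2 ^ (q - 1) *
                  (‖deriv (Hm i) (x i)‖ₑ ^ q + ‖deriv (Hp i) (x i)‖ₑ ^ q))) := by
              gcongr with i
              exact ENNReal.rpow_add_le_mul_rpow_add_rpow _ _ hq
          _ = _ := by
              rw [← Finset.mul_sum]
              simp_rw [← mul_add]
              rw [← Finset.mul_sum]
              ring
    _ = ((m + 1 : ℕ) : ℝ≥0∞) ^ (q - 1) * 2 ^ (q - 1) * ∑ i,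
          ((∫⁻ x, ‖w x‖ₑ ^ q * ‖deriv (Hm i) (x i)‖ₑ ^ q)
            + ∫⁻ x, ‖w x‖ₑ ^ q * ‖deriv (Hp i) (x i)‖ₑ ^ q) := by
        rw [lintegral_const_mul'', lintegral_finsetSum']
        · congr 1
          refine Finset.sum_congr rfl fun i _ => ?_
          rw [lintegral_add_left' (hmeas _ _ _ i (hm i))]
        · exact fun i _ => (hmeas _ _ _ i (hm i)).add (hmeas _ _ _ i (hp' i))
        · exact Finset.aemeasurable_fun_sum _ fun i _ =>
            (hmeas _ _ _ i (hm i)).add (hmeas _ _ _ i (hp' i))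
    _ ≤ ((m + 1 : ℕ) : ℝ≥0∞) ^ (q - 1) * 2 ^ (q - 1) * ∑ _i : Fin (m + 1),
          ((T + ε / K) + (T + ε / K)) := by
        gcongr with i
        · exact hmB i
        · exact hpB i
    _ = K * T + K * (ε / K) := by
        rw [Finset.sum_const, Finset.card_univ, Fintype.card_fin, nsmul_eq_mul, hK]
        ring
    _ ≤ _ := by gcongr; exact ENNReal.mul_div_le

/-- The cutoff function between two concentric cubes for which the product with the gradient
is controlled by the critical Sobolev exponent on slices. -/
theorem exists_cube_cutoff {m : ℕ} {p q : ℝ} (hpq : SobolevExponents m p q) :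
    ∃ C : ℝ≥0, ∀ (U : Set (Eu (m + 1))) (v : Eu (m + 1) → ℝ) (dv : Eu (m + 1) → Eu (m + 1)),
      IsWeakGradOn (m + 1) U v dv → LocallyIntegrableOn v U → LocallyIntegrableOn dv U →
      ∀ M : ℝ, (∀ x, |v x| ≤ M) → ∀ (x₀ : Eu (m + 1)) (ρ σ : ℝ), 0 ≤ ρ → ρ < σ → cube x₀ σ ⊆ U →
      ∫⁻ x in cube x₀ σ, ‖dv x‖ₑ ^ p ≠ ⊤ → ∀ ε : ℝ≥0∞, ε ≠ 0 →
      ∃ η : Eu (m + 1) → ℝ, ContDiff ℝ (⊤ : ℕ∞) η ∧ (∀ x, η x ∈ Icc (0 : ℝ) 1) ∧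
        (∀ x ∈ cube x₀ ρ, η x = 1) ∧ tsupport η ⊆ cube x₀ ((ρ + σ) / 2) ∧
        ∫⁻ x, ‖v x‖ₑ ^ q * ‖gradient η x‖ₑ ^ q ≤
          C * (ENNReal.ofReal (σ - ρ) ^ (1 - q - q / p) *
            ENNReal.ofReal σ ^ (m + q - m * q / p)) *
            ((∫⁻ x in cube x₀ σ, ‖dv x‖ₑ ^ p)
              + ENNReal.ofReal (σ - ρ) ^ (-p) * ∫⁻ x in cube x₀ σ, ‖v x‖ₑ ^ p) ^ (q / p) + ε := by
  have hp := hpq.one_le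
  have hplt := hpq.lt
  have hp0 : 0 < p := by linarith
  have hq0 : 0 < q := by linarith
  have hq1 : 1 ≤ q := by linarith
  have hs : 0 < q / p := by positivity
  obtain ⟨C₀, hC₀⟩ := exists_slice_const hpq
  obtain ⟨B, hB⟩ := exists_standard_cutoff (m + 1)
  let K : ℝ≥0∞ := ((m + 1 : ℕ) : ℝ≥0∞) ^ (q - 1) * 2 ^ (q - 1) * ((m + 1 : ℕ) * 2)
  let k₁ : ℝ≥0∞ := 2 ^ (p - 1) * (1 + (4 * B) ^ p)
  let C : ℝ≥0∞ := K * 8 ^ q * C₀ * (2 ^ (p - 1)) ^ (q / p) * 4 ^ (q / p) * k₁ ^ (q / p)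
  have ht : ∀ {x : ℝ≥0∞} {y : ℝ}, 0 ≤ y → x ≠ ⊤ → x ^ y ≠ ⊤ :=
    fun hy hx => ENNReal.rpow_ne_top_of_nonneg hy hx
  have h2 : (2 : ℝ≥0∞) ^ (p - 1) ≠ ⊤ := ht (by linarith) (by simp)
  have hk₁ : k₁ ≠ ⊤ := ENNReal.mul_ne_top h2 (ENNReal.add_ne_top.2 ⟨by simp,
    ht hp0.le (ENNReal.mul_ne_top (by simp) ENNReal.coe_ne_top)⟩)
  have hC : C ≠ ⊤ := by
    have hK : K ≠ ⊤ := by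
      refine ENNReal.mul_ne_top (ENNReal.mul_ne_top ?_ ?_) (ENNReal.mul_ne_top ?_ ?_)
      · exact ht (by linarith) (ENNReal.natCast_ne_top _)
      · exact ht (by linarith) (by simp)
      · exact ENNReal.natCast_ne_top _
      · simp
    refine ENNReal.mul_ne_top (ENNReal.mul_ne_top (ENNReal.mul_ne_top (ENNReal.mul_ne_top
      (ENNReal.mul_ne_top hK ?_) ENNReal.coe_ne_top) ?_) ?_) ?_
    · exact ht hq0.le (by simp)
    · exact ht hs.le h2
    · exact ht hs.le (by simp)
    · exact ht hs.le hk₁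
  refine ⟨C.toNNReal, ?_⟩
  rw [ENNReal.coe_toNNReal hC]
  intro U v dv h hv hdv M hM x₀ ρ σ hρ hρσ hσU hP ε hε
  have hσ : 0 < σ := by linarith
  obtain ⟨ζ, hζ, hζ01, hζ1, hζs, hζg⟩ := hB x₀ ((ρ + σ) / 2) ((ρ + 3 * σ) / 4) (by linarith)
  have hζσ : tsupport ζ ⊆ cube x₀ σ := hζs.trans (cube_mono x₀ (by linarith))
  have hζU : tsupport ζ ⊆ U := hζσ.trans hσU
  have hζc : HasCompactSupport ζ := (isCompact_cube x₀ σ).of_isClosed_subset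
    (isClosed_tsupport ζ) hζσ
  set w : Eu (m + 1) → ℝ := fun x => ζ x * v x with hwdef
  set dw : Eu (m + 1) → Eu (m + 1) := fun x => ζ x • dv x + v x • gradient ζ x with hdwdef
  have hwg : IsWeakGradOn (m + 1) univ w dw := h.smooth_mul hv hdv hζ hζc hζU
  have hwi : Integrable w := by
    have := integrable_smul_of_tsupport_subset hv hζ.continuous hζc hζU
    simpa [hwdef] using this
  have hdwi : Integrable dw := (integrable_smul_of_tsupport_subset hdv hζ.continuous hζc hζU).add
    (integrable_smul_gradient_of_tsupport_subset hv hζ hζc hζU)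
  have hζe : ∀ x, ‖ζ x‖ₑ ≤ 1 := fun x => by
    rw [← ofReal_norm, ← ENNReal.ofReal_one, Real.norm_of_nonneg (hζ01 x).1]
    exact ENNReal.ofReal_le_ofReal (hζ01 x).2
  have hw0 : ∀ x ∉ cube x₀ ((ρ + 3 * σ) / 4), w x = 0 := fun x hx => by
    simp [hwdef, image_eq_zero_of_notMem_tsupport fun hc => hx (hζs hc)]
  set a : ℝ≥0∞ := ENNReal.ofReal (σ - ρ) with ha
  have ha0 : a ≠ 0 := by rw [ha]; simpa using hρσ
  have hat : a ≠ ⊤ := ENNReal.ofReal_ne_top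
  have hfrac : ∀ c : ℝ, 0 ≤ c → ENNReal.ofReal (c / (σ - ρ)) = ENNReal.ofReal c / a := fun c hc =>
    ENNReal.ofReal_div_of_pos (by linarith)
  set P := ∫⁻ x in cube x₀ σ, ‖dv x‖ₑ ^ p with hPdef
  set V := ∫⁻ x in cube x₀ σ, ‖v x‖ₑ ^ p with hVdef
  have hVt : V ≠ ⊤ := by
    refine ne_top_of_le_ne_top (b := ∫⁻ x in cube x₀ σ, ENNReal.ofReal M ^ p) ?_ ?_
    · rw [setLIntegral_const]
      exact ENNReal.mul_ne_top (ht hp0.le ENNReal.ofReal_ne_top)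
        (isCompact_cube x₀ σ).measure_ne_top
    · refine lintegral_mono fun x => ?_
      gcongr
      rw [← ofReal_norm]; exact ENNReal.ofReal_le_ofReal (hM x)
  have hapt : a ^ (-p) ≠ ⊤ := by
    rw [ENNReal.rpow_neg]
    exact ENNReal.inv_ne_top.2 (ENNReal.rpow_pos (pos_iff_ne_zero.2 ha0) hat).ne'
  set E := ∫⁻ x, ‖dw x‖ₑ ^ p with hEdef
  have hdvm : AEStronglyMeasurable dv (volume.restrict (cube x₀ σ)) :=
    (hdv.integrableOn_compact_subset hσU (isCompact_cube x₀ σ)).aestronglyMeasurable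
  have hEle : E ≤ k₁ * (P + a ^ (-p) * V) := by
    have hpt : ∀ x, ‖dw x‖ₑ ^ p ≤ (cube x₀ σ).indicator
        (fun x => 2 ^ (p - 1) * (‖dv x‖ₑ ^ p + ((4 * B) ^ p * a ^ (-p)) * ‖v x‖ₑ ^ p)) x := by
      intro x
      by_cases hx : x ∈ cube x₀ σ
      · rw [indicator_of_mem hx]
        refine (enorm_rpow_le_two_rpow_mul hp (dw x) (ζ x • dv x)).trans ?_
        gcongr
        · rw [enorm_smul]
          exact mul_le_of_le_one_left' (hζe x)
        · rw [hdwdef]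
          simp only [add_sub_cancel_left]
          rw [enorm_smul, ENNReal.mul_rpow_of_nonneg _ _ hp0.le, mul_comm]
          gcongr
          rw [ENNReal.rpow_neg, ← ENNReal.inv_rpow, ← ENNReal.mul_rpow_of_nonneg _ _ hp0.le]
          gcongr
          refine (hζg x).trans (le_of_eq ?_)
          rw [show (ρ + 3 * σ) / 4 - (ρ + σ) / 2 = (σ - ρ) / 4 by ring,
            ENNReal.ofReal_div_of_pos (by norm_num), ← ha]
          rw [ENNReal.div_eq_inv_mul, ENNReal.inv_div (by simp) (by simp), div_eq_mul_inv]
          simp only [ENNReal.ofReal_ofNat]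
          ring
      · have hnt : x ∉ tsupport ζ := fun hc => hx (hζσ hc)
        rw [hdwdef]
        simp only [image_eq_zero_of_notMem_tsupport hnt,
          gradient_eq_zero_of_notMem_tsupport hnt]
        simp [hp0]
    calc E ≤ _ := lintegral_mono hpt
      _ = 2 ^ (p - 1) * (P + ((4 * B) ^ p * a ^ (-p)) * V) := by
        rw [lintegral_indicator (measurableSet_cube x₀ σ), lintegral_const_mul' _ _ h2,
          lintegral_add_left' (hdvm.enorm.pow_const p), lintegral_const_mul']
        exact ENNReal.mul_ne_top (ht hp0.le (ENNReal.mul_ne_top (by simp) ENNReal.coe_ne_top)) hapt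
      _ ≤ 2 ^ (p - 1) * ((1 + (4 * B) ^ p) * P + ((1 + (4 * B) ^ p) * a ^ (-p)) * V) := by
        gcongr
        · exact le_mul_of_one_le_left' le_self_add
        · exact le_add_self
      _ = _ := by simp only [k₁]; ring
  have hEt : E ≠ ⊤ := ne_top_of_le_ne_top (ENNReal.mul_ne_top hk₁
    (ENNReal.add_ne_top.2 ⟨hP, ENNReal.mul_ne_top hapt hVt⟩)) hEle
  have hdwp : MemLp dw (ENNReal.ofReal p) := by
    refine ⟨hdwi.aestronglyMeasurable, ?_⟩
    rw [eLpNorm_lt_top_iff_lintegral_rpow_enorm_lt_top (by simpa using hp0) (by simp),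
      ENNReal.toReal_ofReal hp0.le]
    exact hEt.lt_top
  obtain ⟨W, hW⟩ := hwg.exists_smoothApprox hp hwi hdwi hdwp hw0
    (show (ρ + 3 * σ) / 4 < σ by linarith)
  have hslice : ∀ i, ∀ᵐ t, ∫⁻ y, ‖w (sliceEmb i t y)‖ₑ ^ q ≤
      (C₀ * ENNReal.ofReal σ ^ (m + q - m * q / p) * (2 ^ (p - 1)) ^ (q / p)) *
        (∫⁻ y, ‖dw (sliceEmb i t y)‖ₑ ^ p) ^ (q / p) := by
    intro i
    filter_upwards [hW.ae_slice_le hpq hσ hdwi.aestronglyMeasurable hC₀ i] with t htt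
    refine htt.trans (le_of_eq ?_)
    rw [ENNReal.mul_rpow_of_nonneg _ _ hs.le]
    ring
  have hwM : ∀ x, |w x| ≤ M := fun x => by
    rw [hwdef]; simp only [abs_mul]
    rw [abs_of_nonneg (hζ01 x).1]
    exact (mul_le_of_le_one_left (abs_nonneg _) (hζ01 x).2).trans (hM x)
  obtain ⟨η, h1, h2', h3, h4, h5⟩ := exists_cutoff_of_slice_le hq1 hs
    (σ := σ) hwi.aestronglyMeasurable hdwi.aestronglyMeasurable hwM
    (fun x hx => hw0 x fun hc => hx (cube_mono x₀ (by linarith) hc)) hslice hEt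
    (show ρ < (ρ + σ) / 2 by linarith) hε
  refine ⟨η, h1, h2', h3, h4, ?_⟩
  have hvw : ∀ x, ‖v x‖ₑ ^ q * ‖gradient η x‖ₑ ^ q = ‖w x‖ₑ ^ q * ‖gradient η x‖ₑ ^ q := by
    intro x
    by_cases hx : x ∈ tsupport η
    · rw [hwdef]; simp only [hζ1 x (h4 hx), one_mul]
    · rw [gradient_eq_zero_of_notMem_tsupport hx]; simp [hq0]
  simp_rw [hvw]
  refine h5.trans ?_
  gcongr ?_ + ε
  rw [show (ρ + σ) / 2 - ρ = (σ - ρ) / 2 by ring]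
  have e1 : ENNReal.ofReal (4 / ((σ - ρ) / 2)) = 8 * a⁻¹ := by
    rw [show 4 / ((σ - ρ) / 2) = 8 / (σ - ρ) by field_simp; norm_num, hfrac 8 (by norm_num),
      div_eq_mul_inv]; simp
  have e2 : ENNReal.ofReal (2 / ((σ - ρ) / 2)) = 4 * a⁻¹ := by
    rw [show 2 / ((σ - ρ) / 2) = 4 / (σ - ρ) by field_simp; norm_num, hfrac 4 (by norm_num),
      div_eq_mul_inv]; simp
  have e3 : ENNReal.ofReal ((σ - ρ) / 2) ≤ a := ENNReal.ofReal_le_ofReal (by linarith)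
  rw [e1, e2]
  calc _ ≤ K * ((8 * a⁻¹) ^ q * (a * ((C₀ * ENNReal.ofReal σ ^ (m + q - m * q / p)
          * (2 ^ (p - 1)) ^ (q / p)) * (4 * a⁻¹ * (k₁ * (P + a ^ (-p) * V))) ^ (q / p)))) := by
        gcongr
    _ = C * ((a⁻¹ ^ q * a * a⁻¹ ^ (q / p)) * ENNReal.ofReal σ ^ (m + q - m * q / p))
          * (P + a ^ (-p) * V) ^ (q / p) := by
        rw [ENNReal.mul_rpow_of_nonneg _ _ hs.le, ENNReal.mul_rpow_of_nonneg _ _ hs.le,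
          ENNReal.mul_rpow_of_nonneg _ _ hs.le, ENNReal.mul_rpow_of_nonneg _ _ hq0.le]
        simp only [C]
        ring
    _ = _ := by
        congr 3
        rw [ENNReal.inv_rpow, ENNReal.inv_rpow, ← ENNReal.rpow_neg, ← ENNReal.rpow_neg,
          sub_eq_add_neg, sub_eq_add_neg, ENNReal.rpow_add _ _ ha0 hat,
          ENNReal.rpow_add _ _ ha0 hat, ENNReal.rpow_one]
        ring

theorem SobolevExponents.exponent_nonneg {m : ℕ} {p q : ℝ} (h : SobolevExponents m p q) :
    0 ≤ m + q - m * q / p := by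
  have hp := h.one_le
  have hpq := h.lt
  rcases h.critical with ⟨rfl, rfl⟩ | ⟨hm, he⟩
  · simp
  · have hm0 : (m : ℝ) ≠ 0 := by linarith
    have hp0 : p ≠ 0 := by linarith
    have hq0 : q ≠ 0 := by linarith
    field_simp at he
    have : (m : ℝ) + q - m * q / p = 0 := by
      field_simp; linarith
    rw [this]

theorem exists_smoothApprox_of_hasCompactSupport {n : ℕ} {p : ℝ} (hp : 1 ≤ p) {w : Eu n → ℝ}
    {dw : Eu n → Eu n} (h : IsWeakGradOn n univ w dw) (hw : Integrable w)
    (hdw : Integrable dw) (hdwp : MemLp dw (ENNReal.ofReal p)) (hc : HasCompactSupport w) :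
    ∃ S W, SmoothApprox n p S w dw W := by
  obtain ⟨R, hR⟩ := hc.isBounded.subset_closedBall 0
  refine ⟨cube 0 (R + 1), h.exists_smoothApprox hp hw hdw hdwp (x₀ := 0) (R := R) ?_
    (by linarith)⟩
  intro x hx
  by_contra hne
  exact hx (closedBall_subset_cube 0 R (hR (subset_tsupport w hne)))

/-- On cubes where `φ` is mostly zero and has small energy, there is a cutoff function whose
gradient costs little against `φ`. -/
theorem exists_small_cube_cutoff {m : ℕ} {p q : ℝ} (hpq : SobolevExponents m p q) {δ : ℝ}
    (hδ : 0 < δ) (hδ1 : δ < 1) : ∃ ε : ℝ, 0 < ε ∧ ε ≤ δ ∧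
    ∀ (φ : Eu (m + 1) → ℝ) (dφ : Eu (m + 1) → Eu (m + 1)) (M : ℝ),
      IsWeakGradOn (m + 1) univ φ dφ → Integrable φ → Integrable dφ →
      MemLp dφ (ENNReal.ofReal p) → (∀ x, |φ x| ≤ M) → HasCompactSupport φ →
      ∀ (x₀ : Eu (m + 1)) (h : ℝ), 0 < h →
      ∫⁻ x in cube x₀ h, ‖dφ x‖ₑ ^ p ≤ ENNReal.ofReal (ε * h ^ (m + 1)) →
      volume {x | x ∈ cube x₀ h ∧ φ x ≠ 0} ≤ ENNReal.ofReal (ε * h ^ (m + 1)) →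
      ∃ η : Eu (m + 1) → ℝ, ContDiff ℝ (⊤ : ℕ∞) η ∧ (∀ x, η x ∈ Icc (0 : ℝ) 1) ∧
        (∀ x ∈ cube x₀ ((1 - δ) * h), η x = 1) ∧ tsupport η ⊆ cube x₀ h ∧
        ∫⁻ x, ‖φ x‖ₑ ^ q * ‖gradient η x‖ₑ ^ q ≤ ENNReal.ofReal (δ * h ^ (m + 1)) := by
  have hp := hpq.one_le
  have hplt := hpq.lt
  have hp0 : 0 < p := by linarith
  have hq0 : 0 < q := by linarith
  have hs : 0 < q / p := by positivity
  obtain ⟨C, hC⟩ := exists_cube_cutoff hpq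
  obtain ⟨B, hB⟩ := exists_poincare_const (m + 1) hp
  set d : ℝ≥0∞ := ENNReal.ofReal δ with hd
  have hd0 : d ≠ 0 := by simpa [hd] using hδ
  have hdt : d ≠ ⊤ := ENNReal.ofReal_ne_top
  have hrt : ∀ {x : ℝ≥0∞} (y : ℝ), x ≠ 0 → x ≠ ⊤ → x ^ y ≠ ⊤ := fun y h0 ht hc => by
    rcases ENNReal.rpow_eq_top_iff.1 hc with h | h
    · exact h0 h.1
    · exact ht h.1
  set K : ℝ≥0∞ := C * d ^ (1 - q - q / p) * (1 + B * d ^ (-p)) ^ (q / p) with hK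
  have hKt : K ≠ ⊤ := by
    refine ENNReal.mul_ne_top (ENNReal.mul_ne_top ENNReal.coe_ne_top (hrt _ hd0 hdt)) ?_
    exact ENNReal.rpow_ne_top_of_nonneg hs.le (ENNReal.add_ne_top.2 ⟨by simp,
      ENNReal.mul_ne_top ENNReal.coe_ne_top (hrt _ hd0 hdt)⟩)
  have hK1 : 0 < K.toReal + 1 := by positivity
  set ε₀ : ℝ := ((δ / 2) / (K.toReal + 1)) ^ (p / q) with hε₀
  have hε₀0 : 0 < ε₀ := by positivity
  set ε : ℝ := min (min (1 / 2) δ) ε₀ with hε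
  have hε0 : 0 < ε := by positivity
  have hKε : K * ENNReal.ofReal ε ^ (q / p) ≤ ENNReal.ofReal (δ / 2) := by
    calc K * ENNReal.ofReal ε ^ (q / p) ≤ K * ENNReal.ofReal ε₀ ^ (q / p) := by
          gcongr; exact min_le_right _ _
      _ = ENNReal.ofReal (K.toReal * ((δ / 2) / (K.toReal + 1))) := by
          rw [ENNReal.ofReal_rpow_of_nonneg hε₀0.le hs.le, hε₀, ← Real.rpow_mul (by positivity),
            show p / q * (q / p) = 1 by field_simp, Real.rpow_one,
            ENNReal.ofReal_mul ENNReal.toReal_nonneg, ENNReal.ofReal_toReal hKt]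
      _ ≤ _ := by
          refine ENNReal.ofReal_le_ofReal ?_
          rw [mul_div_assoc', div_le_iff₀ hK1]
          nlinarith
  refine ⟨ε, hε0, (min_le_left _ _).trans (min_le_right _ _), ?_⟩
  intro φ dφ M hwg hφ hdφ hdp hM hcs x₀ h hh hX hvol
  obtain ⟨S, W, hW⟩ := exists_smoothApprox_of_hasCompactSupport hp hwg hφ hdφ hdp hcs
  set H : ℝ≥0∞ := ENNReal.ofReal h with hH
  have hH0 : H ≠ 0 := by simpa [hH] using hh
  have hHt : H ≠ ⊤ := ENNReal.ofReal_ne_top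
  have hε2 : ε ≤ 1 / 2 := (min_le_left _ _).trans (min_le_left _ _)
  have hPo := hB S φ dφ W hW hφ.aestronglyMeasurable hdφ.aestronglyMeasurable x₀ h h hh le_rfl (by
    refine hvol.trans ?_
    rw [← ENNReal.ofReal_pow hh.le, ENNReal.div_eq_inv_mul,
      ← ENNReal.ofReal_ofNat, ← ENNReal.ofReal_inv_of_pos (by norm_num),
      ← ENNReal.ofReal_mul (by norm_num)]
    refine ENNReal.ofReal_le_ofReal ?_
    gcongr
    linarith)
  set X := ∫⁻ x in cube x₀ h, ‖dφ x‖ₑ ^ p with hXdef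
  have hXt : X ≠ ⊤ := ne_top_of_le_ne_top ENNReal.ofReal_ne_top hX
  have hhn : 0 < h ^ (m + 1) := by positivity
  obtain ⟨η, h1, h2, h3, h4, h5⟩ := hC univ φ dφ hwg (hφ.locallyIntegrable.locallyIntegrableOn _)
    (hdφ.locallyIntegrable.locallyIntegrableOn _) M hM x₀ ((1 - δ) * h) h
    (by have : 0 < 1 - δ := by linarith
        positivity) (by nlinarith) (subset_univ _) hXt (ENNReal.ofReal (δ / 2 * h ^ (m + 1)))
    (by simp only [ne_eq, ENNReal.ofReal_eq_zero, not_le]; positivity)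
  refine ⟨η, h1, h2, h3, h4.trans (cube_mono x₀ (by nlinarith)), h5.trans ?_⟩
  rw [show h - (1 - δ) * h = δ * h by ring, ENNReal.ofReal_mul hδ.le, ← hd, ← hH]
  have hdH : ∀ y : ℝ, (d * H) ^ y = d ^ y * H ^ y := fun y =>
    ENNReal.mul_rpow_of_ne_top hdt hHt y
  have hn : ENNReal.ofReal (h ^ (m + 1)) = H ^ ((m : ℝ) + 1) := by
    rw [ENNReal.ofReal_pow hh.le, ← ENNReal.rpow_natCast]; push_cast; rfl
  have hmain : C * ((d * H) ^ (1 - q - q / p) * H ^ (m + q - m * q / p)) *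
      (X + (d * H) ^ (-p) * ∫⁻ x in cube x₀ h, ‖φ x‖ₑ ^ p) ^ (q / p)
      ≤ ENNReal.ofReal (δ / 2) * ENNReal.ofReal (h ^ (m + 1)) := by
    calc _ ≤ C * ((d * H) ^ (1 - q - q / p) * H ^ (m + q - m * q / p)) *
          (X + (d * H) ^ (-p) * (B * H ^ p * X)) ^ (q / p) := by gcongr
      _ = C * ((d * H) ^ (1 - q - q / p) * H ^ (m + q - m * q / p)) *
          ((1 + B * d ^ (-p)) * X) ^ (q / p) := by
          congr 2
          rw [hdH]
          have : H ^ (-p) * H ^ p = 1 := by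
            rw [← ENNReal.rpow_add _ _ hH0 hHt]; simp
          calc _ = X + B * d ^ (-p) * X * (H ^ (-p) * H ^ p) := by ring
            _ = _ := by rw [this]; ring
      _ ≤ C * ((d * H) ^ (1 - q - q / p) * H ^ (m + q - m * q / p)) *
          ((1 + B * d ^ (-p)) * (ENNReal.ofReal ε * H ^ ((m : ℝ) + 1))) ^ (q / p) := by
          rw [ENNReal.ofReal_mul hε0.le, hn] at hX
          gcongr
      _ = (K * ENNReal.ofReal ε ^ (q / p)) * (H ^ (1 - q - q / p) * H ^ (m + q - m * q / p)
            * H ^ (((m : ℝ) + 1) * (q / p))) := by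
          rw [ENNReal.mul_rpow_of_nonneg _ _ hs.le, ENNReal.mul_rpow_of_nonneg _ _ hs.le,
            ← ENNReal.rpow_mul, hdH, hK]
          ring
      _ = (K * ENNReal.ofReal ε ^ (q / p)) * H ^ ((m : ℝ) + 1) := by
          rw [← ENNReal.rpow_add _ _ hH0 hHt, ← ENNReal.rpow_add _ _ hH0 hHt]
          congr 2
          field_simp
          ring
      _ ≤ _ := by rw [hn]; gcongr
  refine (add_le_add_left hmain _).trans (le_of_eq ?_)
  rw [← ENNReal.ofReal_mul (by positivity), ← ENNReal.ofReal_add (by positivity) (by positivity)]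
  congr 1; ring

theorem interior_cube_nonempty {n : ℕ} (x₀ : Eu n) {r : ℝ} (hr : 0 < r) :
    (interior (cube x₀ r)).Nonempty :=
  ⟨x₀, mem_interior.2 ⟨ball x₀ r, ball_subset_closedBall.trans (closedBall_subset_cube x₀ r),
    isOpen_ball, mem_ball_self hr⟩⟩

/-- Vitali covering by finitely many cubes of small density. -/
theorem exists_finset_cubes {m : ℕ} {Ω D : Set (Eu (m + 1))} (hΩ : IsOpen Ω)
    (hΩt : volume Ω ≠ ⊤) (hD : D ⊆ Ω) {f : Eu (m + 1) → ℝ≥0∞} (hf : AEMeasurable f)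
    (hft : ∫⁻ x, f x ≠ ⊤) (hfD : ∀ x ∈ D, f x = 0) {ε δ : ℝ} (hε : 0 < ε) (hδ : 0 < δ) :
    ∃ F : Finset (Eu (m + 1) × ℝ), (∀ a ∈ F, 0 < a.2 ∧ cube a.1 a.2 ⊆ Ω ∧
        ∫⁻ x in cube a.1 a.2, f x ≤ ENNReal.ofReal (ε * a.2 ^ (m + 1))) ∧
      (F : Set (Eu (m + 1) × ℝ)).PairwiseDisjoint (fun a => cube a.1 a.2) ∧
      volume (D \ ⋃ a ∈ F, cube a.1 a.2) ≤ ENNReal.ofReal δ := by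
  set c : ℝ := √(m + 1 : ℕ) with hc
  have hc0 : 0 < c := Real.sqrt_pos.2 (by positivity)
  let t : Set (Eu (m + 1) × ℝ) := {a | 0 < a.2 ∧ cube a.1 a.2 ⊆ Ω ∧
    ∫⁻ x in cube a.1 a.2, f x ≤ ENNReal.ofReal (ε * a.2 ^ (m + 1))}
  let s : Set (Eu (m + 1)) := {x | x ∈ D ∧ ∀ ε' > 0, ∃ a ∈ t, c * a.2 ≤ ε' ∧ a.1 = x}
  have hs : volume (D \ s) = 0 := by
    have hae := (Besicovitch.vitaliFamily (volume : Measure (Eu (m + 1)))).ae_tendsto_lintegral_div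
      hf hft
    refine measure_mono_null ?_ hae
    intro x hx
    by_contra hcon
    rw [mem_compl_iff, not_not] at hcon
    refine hx.2 ⟨hx.1, fun ε' hε' => ?_⟩
    have hT : Filter.Tendsto _ _ _ := hcon
    rw [hfD x hx.1] at hT
    have hT2 := hT.comp (Besicovitch.tendsto_filterAt volume x)
    have hκ : 0 < ENNReal.ofReal (ε / (2 * c) ^ (m + 1)) := by
      rw [ENNReal.ofReal_pos]; positivity
    have hev := (hT2.eventually (gt_mem_nhds hκ))
    obtain ⟨ρ, hρ, hρΩ⟩ := Metric.isOpen_iff.1 hΩ x (hD hx.1)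
    have hev2 : ∀ᶠ r in 𝓝[>] (0 : ℝ), r < ρ ∧ r < ε' ∧ 0 < r := by
      filter_upwards [Ioo_mem_nhdsGT (show 0 < min ρ ε' from lt_min hρ hε')] with r hr
      exact ⟨hr.2.trans_le (min_le_left _ _), hr.2.trans_le (min_le_right _ _), hr.1⟩
    obtain ⟨r, hr, hrρ, hrε, hr0⟩ := (hev.and hev2).exists
    have hcr : c * (r / c) = r := by field_simp
    have hsub : cube x (r / c) ⊆ closedBall x r := by
      have := cube_subset_closedBall x (show 0 ≤ r / c by positivity)
      rwa [← hc, hcr] at this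
    refine ⟨(x, r / c), ⟨by positivity, hsub.trans ((closedBall_subset_ball hrρ).trans hρΩ), ?_⟩,
      by rw [hcr]; exact hrε.le, rfl⟩
    simp only [Function.comp_apply] at hr
    have hv0 : volume (closedBall x r) ≠ 0 := (measure_closedBall_pos _ _ hr0).ne'
    have hvt : volume (closedBall x r) ≠ ⊤ := measure_closedBall_lt_top.ne
    have h1 := (ENNReal.div_lt_iff (Or.inl hv0) (Or.inl hvt)).1 hr
    calc ∫⁻ x in cube x (r / c), f x ≤ ∫⁻ x in closedBall x r, f x := lintegral_mono_set hsub
      _ ≤ ENNReal.ofReal (ε / (2 * c) ^ (m + 1)) * volume (cube x r) :=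
        h1.le.trans (by gcongr; exact closedBall_subset_cube x r)
      _ = _ := by
        rw [volume_cube, ← ENNReal.ofReal_pow (by positivity), ← ENNReal.ofReal_mul (by positivity)]
        congr 1
        simp only
        rw [div_pow, mul_pow, mul_pow]
        field_simp
  obtain ⟨u, hut, huc, hud, hus⟩ := Vitali.exists_disjoint_covering_ae volume s t
    ((3 * Real.toNNReal c) ^ (m + 1)) (fun a => c * a.2) Prod.fst (fun a => cube a.1 a.2)
    (fun a ha => by simpa [hc] using cube_subset_closedBall a.1 ha.1.le)
    (fun a ha => by
      refine (measure_mono (closedBall_subset_cube _ _)).trans (le_of_eq ?_)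
      rw [volume_cube, volume_cube, ENNReal.coe_pow, ← mul_pow]
      congr 1
      rw [show 2 * (3 * (c * a.2)) = (3 * c) * (2 * a.2) by ring,
        ENNReal.ofReal_mul (by positivity), ENNReal.ofReal_mul (by norm_num)]
      push_cast
      simp [ENNReal.ofReal])
    (fun a ha => interior_cube_nonempty _ ha.1) (fun a _ => isClosed_cube _ _)
    (fun x hx ε' hε' => hx.2 ε' hε')
  have := huc.to_subtype
  have hsum : ∑' a : u, volume (cube a.1.1 a.1.2) ≠ ⊤ := by
    rw [← measure_iUnion (f := fun a : u => cube a.1.1 a.1.2) (fun a b hab => hud a.2 b.2 (fun h => hab (Subtype.ext h)))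
      (fun a => measurableSet_cube _ _)]
    exact ne_top_of_le_ne_top hΩt (measure_mono (iUnion_subset fun a => (hut a.2).2.1))
  obtain ⟨F, hF⟩ := ((ENNReal.tendsto_tsum_compl_atTop_zero hsum).eventually
    (gt_mem_nhds (ENNReal.ofReal_pos.2 hδ))).exists
  refine ⟨F.map (Function.Embedding.subtype _), ?_, ?_, ?_⟩
  · intro a ha
    obtain ⟨b, -, rfl⟩ := Finset.mem_map.1 ha
    exact hut b.2
  · refine hud.subset ?_
    intro a ha
    obtain ⟨b, -, rfl⟩ := Finset.mem_map.1 ha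
    exact b.2
  · have hsub : D \ ⋃ a ∈ F.map (Function.Embedding.subtype _), cube a.1 a.2 ⊆
        (D \ s) ∪ ((s \ ⋃ a ∈ u, cube a.1 a.2) ∪
          ⋃ a : {a : u // a ∉ F}, cube a.1.1.1 a.1.1.2) := by
      intro x hx
      by_cases hxs : x ∈ s
      · right
        by_cases hxu : x ∈ ⋃ a ∈ u, cube a.1 a.2
        · right
          obtain ⟨a, ha, hxa⟩ := mem_iUnion₂.1 hxu
          refine mem_iUnion.2 ⟨⟨⟨a, ha⟩, fun hc => hx.2 ?_⟩, hxa⟩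
          exact mem_iUnion₂.2 ⟨a, Finset.mem_map.2 ⟨⟨a, ha⟩, hc, rfl⟩, hxa⟩
        · exact Or.inl ⟨hxs, hxu⟩
      · exact Or.inl ⟨hx.1, hxs⟩
    calc _ ≤ volume (D \ s) + (volume (s \ ⋃ a ∈ u, cube a.1 a.2) +
          volume (⋃ a : {a : u // a ∉ F}, cube a.1.1.1 a.1.1.2)) :=
          (measure_mono hsub).trans ((measure_union_le _ _).trans
            (by gcongr; exact measure_union_le _ _))
      _ ≤ 0 + (0 + ∑' a : {a : u // a ∉ F}, volume (cube a.1.1.1 a.1.1.2)) := by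
          rw [hs, hus]; gcongr; exact measure_iUnion_le _
      _ ≤ _ := by simpa using hF.le

theorem cube_subset_interior_cube {n : ℕ} (x₀ : Eu n) {r s : ℝ} (h : r < s) :
    cube x₀ r ⊆ interior (cube x₀ s) := by
  intro x hx
  refine mem_interior.2 ⟨ball x (s - r), fun y hy i => ?_, isOpen_ball,
    mem_ball_self (by linarith)⟩
  have h1 : |y i - x i| ≤ ‖y - x‖ := PiLp.norm_apply_le (y - x) i
  have h2 : ‖y - x‖ < s - r := by rwa [← dist_eq_norm]
  calc |y i - x₀ i| = |(y i - x i) + (x i - x₀ i)| := by congr 1; ring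
    _ ≤ |y i - x i| + |x i - x₀ i| := abs_add_le _ _
    _ ≤ s := by have := hx i; linarith

theorem gradient_congr_of_eventuallyEq {n : ℕ} {f g : Eu n → ℝ} {x : Eu n} (h : f =ᶠ[𝓝 x] g) :
    gradient f x = gradient g x := by
  unfold gradient
  rw [h.fderiv_eq]

theorem volume_cube_sdiff_le {m : ℕ} (x₀ : Eu (m + 1)) {h δ : ℝ} (hh : 0 < h) (hδ : 0 < δ)
    (hδ2 : δ < 1 / 2) : volume (cube x₀ h \ cube x₀ ((1 - 2 * δ) * h)) ≤
      ENNReal.ofReal δ * (2 * (m + 1 : ℕ)) * volume (cube x₀ h) := by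
  have h1 : (1 - 2 * δ) * h ≤ h := by nlinarith
  have h0 : 0 < 1 - 2 * δ := by linarith
  rw [measure_sdiff (cube_mono x₀ h1) (measurableSet_cube _ _).nullMeasurableSet
    (isCompact_cube _ _).measure_ne_top, volume_cube, volume_cube,
    ← ENNReal.ofReal_pow (by positivity), ← ENNReal.ofReal_pow (by positivity),
    ← ENNReal.ofReal_sub _ (by positivity)]
  have : ENNReal.ofReal δ * (2 * (m + 1 : ℕ)) * ENNReal.ofReal ((2 * h) ^ (m + 1))
      = ENNReal.ofReal (δ * (2 * (m + 1 : ℕ)) * (2 * h) ^ (m + 1)) := by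
    rw [ENNReal.ofReal_mul (by positivity), ENNReal.ofReal_mul (by positivity),
      ENNReal.ofReal_mul (by positivity), ENNReal.ofReal_natCast]
    simp
  rw [this]
  refine ENNReal.ofReal_le_ofReal ?_
  have hb := one_add_mul_le_pow (show -2 ≤ -(2 * δ) by linarith) (m + 1)
  have hpos : 0 < (2 * h) ^ (m + 1) := by positivity
  rw [show 2 * ((1 - 2 * δ) * h) = (1 + -(2 * δ)) * (2 * h) by ring,
    mul_pow (1 + -(2 * δ)) (2 * h)]
  nlinarith [mul_le_mul_of_nonneg_right hb hpos.le]

/-- A cutoff that removes most of the zero set of `φ` from the support of `φ` at a small cost. -/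
theorem exists_zero_set_cutoff {m : ℕ} {p q : ℝ} (hpq : SobolevExponents m p q)
    {Ω : Set (Eu (m + 1))} (hΩ : IsOpen Ω) (hΩt : volume Ω ≠ ⊤) {φ : Eu (m + 1) → ℝ}
    {dφ : Eu (m + 1) → Eu (m + 1)} {M : ℝ} (hwg : IsWeakGradOn (m + 1) univ φ dφ)
    (hφ : Integrable φ) (hdφ : Integrable dφ) (hdp : MemLp dφ (ENNReal.ofReal p))
    (hM : ∀ x, |φ x| ≤ M) (hcs : HasCompactSupport φ) (hφm : Measurable φ) (hdφm : Measurable dφ)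
    (hTΩ : tsupport φ ⊆ Ω) (hd0 : ∀ x, φ x = 0 → dφ x = 0) {δ : ℝ} (hδ : 0 < δ)
    (hδ2 : δ < 1 / 2) :
    ∃ (η : Eu (m + 1) → ℝ) (W : Set (Eu (m + 1))), ContDiff ℝ (⊤ : ℕ∞) η ∧
      (∀ x, η x ∈ Icc (0 : ℝ) 1) ∧ HasCompactSupport η ∧ MeasurableSet W ∧ tsupport η ⊆ W ∧
      volume ({x | φ x ≠ 0} ∩ W) ≤ ENNReal.ofReal δ * volume Ω ∧
      ∫⁻ x, ‖φ x‖ₑ ^ q * ‖gradient η x‖ₑ ^ q ≤ ENNReal.ofReal δ * volume Ω ∧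
      volume {x | x ∈ tsupport φ ∧ φ x = 0 ∧ x ∈ closure {y | η y ≠ 1}} ≤
        ENNReal.ofReal δ * (1 + 2 * (m + 1 : ℕ) * volume Ω) := by
  have hp := hpq.one_le
  have hp0 : 0 < p := by linarith
  have hq0 : 0 < q := by linarith [hpq.lt]
  obtain ⟨ε, hε, hεδ, hcut⟩ := exists_small_cube_cutoff hpq hδ (by linarith)
  have hPm : MeasurableSet {x | φ x ≠ 0} := hφm (measurableSet_singleton 0).compl
  let f : Eu (m + 1) → ℝ≥0∞ := fun x => ‖dφ x‖ₑ ^ p + {x | φ x ≠ 0}.indicator 1 x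
  have hfm : AEMeasurable f := (hdφm.enorm.pow_const p).aemeasurable.add
    (aemeasurable_one.indicator hPm)
  have hft : ∫⁻ x, f x ≠ ⊤ := by
    have h1 : ∫⁻ x, ‖dφ x‖ₑ ^ p ≠ ⊤ := by
      have := (eLpNorm_lt_top_iff_lintegral_rpow_enorm_lt_top (by simpa using hp0)
        (by simp)).1 hdp.2
      rw [ENNReal.toReal_ofReal hp0.le] at this
      exact this.ne
    simp only [f]
    rw [lintegral_add_left (hdφm.enorm.pow_const p), lintegral_indicator_one hPm]
    refine ENNReal.add_ne_top.2 ⟨h1, ne_top_of_le_ne_top hcs.measure_ne_top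
      (measure_mono fun x hx => subset_tsupport φ hx)⟩
  let D : Set (Eu (m + 1)) := {x | x ∈ tsupport φ ∧ φ x = 0}
  have hfD : ∀ x ∈ D, f x = 0 := fun x hx => by
    simp [f, hd0 x hx.2, hx.2, hp0]
  obtain ⟨F, hF, hFd, hFD⟩ := exists_finset_cubes hΩ hΩt (fun x hx => hTΩ hx.1 : D ⊆ Ω) hfm hft hfD
    hε hδ
  have hex : ∀ a : Eu (m + 1) × ℝ, ∃ η : Eu (m + 1) → ℝ, a ∈ F → ContDiff ℝ (⊤ : ℕ∞) η ∧
      (∀ x, η x ∈ Icc (0 : ℝ) 1) ∧ (∀ x ∈ cube a.1 ((1 - δ) * a.2), η x = 1) ∧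
      tsupport η ⊆ cube a.1 a.2 ∧
      ∫⁻ x, ‖φ x‖ₑ ^ q * ‖gradient η x‖ₑ ^ q ≤ ENNReal.ofReal (δ * a.2 ^ (m + 1)) := by
    intro a
    by_cases ha : a ∈ F
    · obtain ⟨h0, -, h2⟩ := hF a ha
      obtain ⟨η, hη⟩ := hcut φ dφ M hwg hφ hdφ hdp hM hcs a.1 a.2 h0
        ((lintegral_mono fun x => le_self_add).trans h2) (by
          refine le_trans ?_ h2
          calc _ = ∫⁻ x in cube a.1 a.2, {x | φ x ≠ 0}.indicator 1 x := by
                rw [lintegral_indicator_one hPm, Measure.restrict_apply hPm, inter_comm]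
                rfl
            _ ≤ _ := lintegral_mono fun x => le_add_self)
      exact ⟨η, fun _ => hη⟩
    · exact ⟨0, fun h => absurd h ha⟩
  choose e he using hex
  let W : Set (Eu (m + 1)) := ⋃ a ∈ F, cube a.1 a.2
  let η : Eu (m + 1) → ℝ := fun x => ∑ a ∈ F, e a x
  have hWc : IsCompact W := F.isCompact_biUnion fun a _ => isCompact_cube _ _
  have hWm : MeasurableSet W := hWc.measurableSet
  have hvW : ∑ a ∈ F, volume (cube a.1 a.2) ≤ volume Ω := by
    rw [← measure_biUnion_finset hFd fun a _ => measurableSet_cube _ _]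
    exact measure_mono (iUnion₂_subset fun a ha => (hF a ha).2.1)
  have hpow : ∀ a ∈ F, ∀ c : ℝ, 0 ≤ c → c ≤ δ → ENNReal.ofReal (c * a.2 ^ (m + 1)) ≤
      ENNReal.ofReal δ * volume (cube a.1 a.2) := by
    intro a ha c hc0 hc
    have h0 := (hF a ha).1
    rw [volume_cube, ← ENNReal.ofReal_pow (by positivity), ← ENNReal.ofReal_mul hδ.le]
    refine ENNReal.ofReal_le_ofReal ?_
    gcongr
    linarith
  have hηW : tsupport η ⊆ W := by
    refine closure_minimal (fun x hx => ?_) hWc.isClosed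
    obtain ⟨a, ha, hxa⟩ := Finset.exists_ne_zero_of_sum_ne_zero hx
    exact mem_iUnion₂.2 ⟨a, ha, (he a ha).2.2.2.1 (subset_tsupport _ hxa)⟩
  have hloc : ∀ a ∈ F, ∀ x ∈ cube a.1 a.2, η =ᶠ[𝓝 x] e a := by
    intro a ha x hx
    have hcl : IsClosed (⋃ b ∈ F.erase a, cube b.1 b.2) :=
      ((F.erase a).isCompact_biUnion fun b _ => isCompact_cube _ _).isClosed
    have hxn : x ∈ (⋃ b ∈ F.erase a, cube b.1 b.2)ᶜ := by
      intro hxc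
      obtain ⟨b, hb, hxb⟩ := mem_iUnion₂.1 hxc
      exact disjoint_left.1 (hFd ha (Finset.mem_of_mem_erase hb)
        (Finset.ne_of_mem_erase hb).symm) hx hxb
    filter_upwards [hcl.isOpen_compl.mem_nhds hxn] with y hy
    refine Finset.sum_eq_single_of_mem a ha fun b hb hba => ?_
    refine image_eq_zero_of_notMem_tsupport fun hc => hy ?_
    exact mem_iUnion₂.2 ⟨b, Finset.mem_erase.2 ⟨hba, hb⟩, (he b hb).2.2.2.1 hc⟩
  have hηd : ContDiff ℝ (⊤ : ℕ∞) η := ContDiff.sum fun a ha => (he a ha).1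
  refine ⟨η, W, hηd, ?_, hWc.of_isClosed_subset (isClosed_tsupport η) hηW, hWm, hηW, ?_, ?_, ?_⟩
  · intro x
    by_cases hx : x ∈ W
    · obtain ⟨a, ha, hxa⟩ := mem_iUnion₂.1 hx
      rw [(hloc a ha x hxa).eq_of_nhds]
      exact (he a ha).2.1 x
    · rw [image_eq_zero_of_notMem_tsupport fun hc => hx (hηW hc)]
      simp
  · calc volume ({x | φ x ≠ 0} ∩ W) ≤ ∑ a ∈ F, volume ({x | φ x ≠ 0} ∩ cube a.1 a.2) := by
          simp only [W, inter_iUnion₂]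
          exact measure_biUnion_finset_le _ _
      _ ≤ ∑ a ∈ F, ENNReal.ofReal δ * volume (cube a.1 a.2) := by
          refine Finset.sum_le_sum fun a ha => le_trans ?_ (hpow a ha ε hε.le hεδ)
          refine le_trans ?_ (hF a ha).2.2
          calc _ = ∫⁻ x in cube a.1 a.2, {x | φ x ≠ 0}.indicator 1 x := by
                rw [lintegral_indicator_one hPm, Measure.restrict_apply hPm]
            _ ≤ _ := lintegral_mono fun x => le_add_self
      _ ≤ _ := by rw [← Finset.mul_sum]; gcongr
  · calc ∫⁻ x, ‖φ x‖ₑ ^ q * ‖gradient η x‖ₑ ^ q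
        ≤ ∫⁻ x, ∑ a ∈ F, ‖φ x‖ₑ ^ q * ‖gradient (e a) x‖ₑ ^ q := by
          refine lintegral_mono fun x => ?_
          by_cases hx : x ∈ W
          · obtain ⟨a, ha, hxa⟩ := mem_iUnion₂.1 hx
            rw [gradient_congr_of_eventuallyEq (hloc a ha x hxa)]
            exact Finset.single_le_sum (f := fun a => ‖φ x‖ₑ ^ q * ‖gradient (e a) x‖ₑ ^ q)
              (fun _ _ => zero_le) ha
          · rw [gradient_eq_zero_of_notMem_tsupport fun hc => hx (hηW hc)]
            simp [hq0]
      _ = ∑ a ∈ F, ∫⁻ x, ‖φ x‖ₑ ^ q * ‖gradient (e a) x‖ₑ ^ q := by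
          refine lintegral_finsetSum _ fun a ha => ?_
          exact (hφm.enorm.pow_const q).mul
            ((continuous_gradient (he a ha).1).measurable.enorm.pow_const q)
      _ ≤ ∑ a ∈ F, ENNReal.ofReal δ * volume (cube a.1 a.2) :=
          Finset.sum_le_sum fun a ha => (he a ha).2.2.2.2.trans (hpow a ha δ hδ.le le_rfl)
      _ ≤ _ := by rw [← Finset.mul_sum]; gcongr
  · have hsub : {x | x ∈ tsupport φ ∧ φ x = 0 ∧ x ∈ closure {y | η y ≠ 1}} ⊆
        (D \ W) ∪ ⋃ a ∈ F, (cube a.1 a.2 \ cube a.1 ((1 - 2 * δ) * a.2)) := by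
      intro x hx
      by_cases hxW : x ∈ W
      · right
        obtain ⟨a, ha, hxa⟩ := mem_iUnion₂.1 hxW
        refine mem_iUnion₂.2 ⟨a, ha, hxa, fun hc => ?_⟩
        have h0 := (hF a ha).1
        have h_int := cube_subset_interior_cube a.1
          (show (1 - 2 * δ) * a.2 < (1 - δ) * a.2 by nlinarith) hc
        have hev : ∀ᶠ y in 𝓝 x, ¬ (η y ≠ 1) := by
          filter_upwards [hloc a ha x hxa, mem_interior_iff_mem_nhds.1 h_int] with y hy1 hy2
          rw [not_not, hy1]
          exact (he a ha).2.2.1 y hy2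
        exact (mem_closure_iff_frequently.1 hx.2.2) hev
      · exact Or.inl ⟨⟨hx.1, hx.2.1⟩, hxW⟩
    calc _ ≤ volume (D \ W) + ∑ a ∈ F, volume (cube a.1 a.2 \ cube a.1 ((1 - 2 * δ) * a.2)) :=
          (measure_mono hsub).trans ((measure_union_le _ _).trans
            (by gcongr; exact measure_biUnion_finset_le _ _))
      _ ≤ ENNReal.ofReal δ + ∑ a ∈ F, ENNReal.ofReal δ * (2 * (m + 1 : ℕ)) *
            volume (cube a.1 a.2) := by
          gcongr with a ha
          exact volume_cube_sdiff_le a.1 (hF a ha).1 hδ hδ2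
      _ ≤ ENNReal.ofReal δ + ENNReal.ofReal δ * (2 * (m + 1 : ℕ)) * volume Ω := by
          rw [← Finset.mul_sum]; gcongr
      _ = _ := by ring

theorem IsWeakGradOn.sub_of_integrable {n : ℕ} {u v : Eu n → ℝ} {du dv : Eu n → Eu n}
    (hu : IsWeakGradOn n univ u du) (hv : IsWeakGradOn n univ v dv) (hui : Integrable u)
    (hvi : Integrable v) (hdui : Integrable du) (hdvi : Integrable dv) :
    IsWeakGradOn n univ (fun x => u x - v x) (fun x => du x - dv x) := by
  intro ψ hψ hψc hψU i
  have h1 := hu ψ hψ hψc hψU i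
  have h2 := hv ψ hψ hψc hψU i
  rw [Measure.restrict_univ] at *
  have hc : Continuous fun x => fderiv ℝ ψ x (EuclideanSpace.single i (1 : ℝ)) :=
    (hψ.continuous_fderiv (by simp)).clm_apply continuous_const
  have hcs : HasCompactSupport fun x => fderiv ℝ ψ x (EuclideanSpace.single i (1 : ℝ)) :=
    hψc.fderiv_apply ℝ _
  have ha : ∀ {w : Eu n → ℝ}, Integrable w →
      Integrable fun x => w x * fderiv ℝ ψ x (EuclideanSpace.single i (1 : ℝ)) := fun hw => by
    have := hw.locallyIntegrable.integrable_smul_left_of_hasCompactSupport hc hcs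
    exact this.congr (ae_of_all _ fun x => by simp [mul_comm])
  have hb : ∀ {w : Eu n → Eu n}, Integrable w → Integrable fun x => w x i * ψ x := fun {w} hw => by
    have hwi : Integrable fun x => w x i :=
      (EuclideanSpace.proj (𝕜 := ℝ) i).integrable_comp hw
    have := hwi.locallyIntegrable.integrable_smul_left_of_hasCompactSupport hψ.continuous hψc
    exact this.congr (ae_of_all _ fun x => by simp [mul_comm])
  simp only [sub_mul, PiLp.sub_apply]
  rw [integral_sub (ha hui) (ha hvi), integral_sub (hb hdui) (hb hdvi), h1, h2]
  ring

/-- The pointwise bounds satisfied by an integrand after normalization. -/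
structure IntegrandBounds {n : ℕ} (p q : ℝ) (L : ℝ≥0) (g : Eu n → ℝ≥0∞) : Prop where
  one_le : ∀ z, 1 ≤ g z
  coercive : ∀ z, ‖z‖ₑ ^ p ≤ g z
  growth : ∀ z, g z ≤ L * (‖z‖ₑ ^ q + 1)
  add_le : ∀ a b, g (a + b) ≤ L * (g a + g b)
  convex_le : ∀ t ∈ Icc (0 : ℝ) 1, ∀ a b, g ((1 - t) • a + t • b) ≤ g a + g b

/-- A quasi-minimizer of a normalized integrand with values in `[1, ∞]`. -/
structure IsNormalizedQuasiMinimizer (m : ℕ) (p q : ℝ) (Ω : Set (Eu (m + 1))) (L Q : ℝ≥0)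
    (G : Eu (m + 1) → Eu (m + 1) → ℝ≥0∞) (u : Eu (m + 1) → ℝ)
    (du : Eu (m + 1) → Eu (m + 1)) : Prop where
  exponents : SobolevExponents m p q
  isOpen : IsOpen Ω
  volume_ne_top : volume Ω ≠ ⊤
  one_le_L : 1 ≤ L
  one_le_Q : 1 ≤ Q
  measurable : Measurable u
  measurable_grad : Measurable du
  isWeakGradOn : IsWeakGradOn (m + 1) Ω u du
  locallyIntegrableOn : LocallyIntegrableOn u Ω
  locallyIntegrableOn_grad : LocallyIntegrableOn du Ω
  aemeasurable : ∀ g : Eu (m + 1) → Eu (m + 1), Measurable g →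
    AEMeasurable (fun x => G x (g x)) (volume.restrict Ω)
  bounds : ∀ᵐ x ∂volume.restrict Ω, IntegrandBounds p q L (G x)
  lintegral_ne_top : ∀ K ⊆ Ω, IsCompact K → ∫⁻ x in K, G x (du x) ≠ ⊤
  lintegral_le : ∀ (φ : Eu (m + 1) → ℝ) (dφ : Eu (m + 1) → Eu (m + 1)),
    IsWeakGradOn (m + 1) univ φ dφ → Integrable φ → Integrable dφ → Measurable dφ →
    HasCompactSupport φ → tsupport φ ⊆ Ω →
    ∫⁻ x in tsupport φ, G x (du x) ≤ Q * ∫⁻ x in tsupport φ, G x (du x + dφ x)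

/-- The quasi-minimality inequality on `{φ ≠ 0}` instead of on the closed support of `φ`. -/
theorem IsNormalizedQuasiMinimizer.lintegral_ne_zero_le {m : ℕ} {p q : ℝ}
    {Ω : Set (Eu (m + 1))} {L Q : ℝ≥0} {G : Eu (m + 1) → Eu (m + 1) → ℝ≥0∞}
    {u : Eu (m + 1) → ℝ} {du : Eu (m + 1) → Eu (m + 1)}
    (h : IsNormalizedQuasiMinimizer m p q Ω L Q G u du) {φ : Eu (m + 1) → ℝ}
    {dφ : Eu (m + 1) → Eu (m + 1)} {M : ℝ} (hwg : IsWeakGradOn (m + 1) univ φ dφ)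
    (hφ : Integrable φ) (hdφ : Integrable dφ) (hdp : MemLp dφ (ENNReal.ofReal p))
    (hM : ∀ x, |φ x| ≤ M) (hcs : HasCompactSupport φ) (hφm : Measurable φ) (hdφm : Measurable dφ)
    (hTΩ : tsupport φ ⊆ Ω) (hd0 : ∀ x, φ x = 0 → dφ x = 0) :
    ∫⁻ x in {x | φ x ≠ 0}, G x (du x) ≤ Q * ∫⁻ x in {x | φ x ≠ 0}, G x (du x + dφ x) := by
  have hq0 : 0 < q := by linarith [h.exponents.one_le, h.exponents.lt]
  set P : Set (Eu (m + 1)) := {x | φ x ≠ 0} with hP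
  have hPm : MeasurableSet P := hφm (measurableSet_singleton 0).compl
  set T := tsupport φ with hT
  have hPT : P ⊆ T := fun x hx => subset_tsupport φ hx
  have hTm : MeasurableSet T := (isClosed_tsupport φ).measurableSet
  set I := ∫⁻ x in P, G x (du x + dφ x) with hI
  by_cases hIt : I = ⊤
  · rw [hIt, ENNReal.mul_top (by have := h.one_le_Q; positivity)]; exact le_top
  let H : Eu (m + 1) → ℝ≥0∞ := fun x => G x (du x) + P.indicator (fun x => G x (du x + dφ x)) x + L
  have hGm : AEMeasurable (fun x => G x (du x)) (volume.restrict T) :=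
    (h.aemeasurable du h.measurable_grad).mono_measure (Measure.restrict_mono hTΩ le_rfl)
  have hHt : ∫⁻ x, T.indicator H x ≠ ⊤ := by
    rw [lintegral_indicator hTm]
    simp only [H]
    rw [lintegral_add_right' _ aemeasurable_const, lintegral_add_left' hGm,
      lintegral_indicator hPm, Measure.restrict_restrict hPm, inter_eq_left.2 hPT,
      setLIntegral_const]
    exact ENNReal.add_ne_top.2 ⟨ENNReal.add_ne_top.2 ⟨h.lintegral_ne_top T hTΩ hcs, hIt⟩,
      ENNReal.mul_ne_top ENNReal.coe_ne_top hcs.measure_ne_top⟩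
  refine ENNReal.le_of_forall_pos_le_add fun ε hε _ => ?_
  set K : ℝ≥0 := 1 + Q * (1 + L * (1 + L)) with hK
  have hK0 : 0 < K := by positivity
  set ε₁ : ℝ≥0 := ε / K with hε₁
  have hε₁0 : 0 < ε₁ := by positivity
  obtain ⟨κ, hκ, hκH⟩ := exists_pos_setLIntegral_lt_of_measure_lt hHt
    (ENNReal.coe_ne_zero.2 hε₁0.ne')
  have hsmall : ∀ s : Set (Eu (m + 1)), MeasurableSet s → s ⊆ T → volume s < κ →
      ∫⁻ x in s, H x ≤ ε₁ := by
    intro s hs hsT hsκ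
    refine le_trans (le_of_eq ?_) (hκH s hsκ).le
    exact setLIntegral_congr_fun hs fun x hx => (indicator_of_mem (hsT hx) H).symm
  set V : ℝ≥0∞ := 1 + 2 * (m + 1 : ℕ) * volume Ω with hV
  have hVt : V ≠ ⊤ := ENNReal.add_ne_top.2 ⟨by simp,
    ENNReal.mul_ne_top (ENNReal.mul_ne_top (by simp) (ENNReal.natCast_ne_top _)) h.volume_ne_top⟩
  have hΩV : volume Ω ≤ V := by
    calc volume Ω = 1 * volume Ω := (one_mul _).symm
      _ ≤ 2 * (m + 1 : ℕ) * volume Ω := by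
        gcongr
        exact_mod_cast (by omega : 1 ≤ 2 * (m + 1))
      _ ≤ V := le_add_self
  obtain ⟨δ, hδ, hδ2, hδV⟩ : ∃ δ : ℝ, 0 < δ ∧ δ < 1 / 2 ∧
      ENNReal.ofReal δ * V < min κ ε₁ := by
    have ht : Filter.Tendsto (fun δ : ℝ => ENNReal.ofReal δ * V) (𝓝[>] 0) (𝓝 0) := by
      have h1 : Filter.Tendsto (fun δ : ℝ => ENNReal.ofReal δ) (𝓝[>] 0) (𝓝 0) := by
        have := ENNReal.tendsto_ofReal (Filter.tendsto_id (α := ℝ) (x := 𝓝 0))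
        simp only [id, ENNReal.ofReal_zero] at this
        exact this.mono_left nhdsWithin_le_nhds
      simpa using ENNReal.Tendsto.mul_const h1 (Or.inr hVt)
    have hpos : (0 : ℝ≥0∞) < min κ ε₁ := lt_min hκ (by exact_mod_cast hε₁0)
    obtain ⟨δ, hd1, hd2⟩ := ((ht.eventually (gt_mem_nhds hpos)).and
      (Ioo_mem_nhdsGT (show (0 : ℝ) < 1 / 2 by norm_num))).exists
    exact ⟨δ, hd2.1, hd2.2, hd1⟩
  have hδΩ : ENNReal.ofReal δ * volume Ω < min κ ε₁ := lt_of_le_of_lt (by gcongr) hδV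
  obtain ⟨η, W, hη, hη01, hηc, hWm, hηW, hPW, hηi, hS⟩ := exists_zero_set_cutoff h.exponents
    h.isOpen h.volume_ne_top hwg hφ hdφ hdp hM hcs hφm hdφm hTΩ hd0 hδ hδ2
  set S : Set (Eu (m + 1)) := {x | x ∈ T ∧ φ x = 0 ∧ x ∈ closure {y | η y ≠ 1}} with hSdef
  have hSm : MeasurableSet S := hTm.inter ((hφm (measurableSet_singleton 0)).inter
    isClosed_closure.measurableSet)
  have hgm : Measurable (gradient η) := (continuous_gradient hη).measurable
  have hφl := hφ.locallyIntegrable.locallyIntegrableOn univ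
  have hdφl := hdφ.locallyIntegrable.locallyIntegrableOn univ
  let ψ : Eu (m + 1) → ℝ := fun x => φ x - η x * φ x
  let dψ : Eu (m + 1) → Eu (m + 1) := fun x => dφ x - (η x • dφ x + φ x • gradient η x)
  have hi1 : Integrable fun x => η x * φ x := by
    simpa using integrable_smul_of_tsupport_subset hφl hη.continuous hηc (subset_univ _)
  have hi2 : Integrable fun x => η x • dφ x + φ x • gradient η x :=
    (integrable_smul_of_tsupport_subset hdφl hη.continuous hηc (subset_univ _)).add
      (integrable_smul_gradient_of_tsupport_subset hφl hη hηc (subset_univ _))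
  have hψw : IsWeakGradOn (m + 1) univ ψ dψ := hwg.sub_of_integrable
    (hwg.smooth_mul hφl hdφl hη hηc (subset_univ _)) hφ hi1 hdφ hi2
  have hψT : tsupport ψ ⊆ T := closure_mono fun x hx => by
    intro h0
    exact hx (by simp [ψ, h0])
  have hdψm : Measurable dψ := hdφm.sub ((hη.continuous.measurable.smul hdφm).add
    (hφm.smul hgm))
  have hmin := h.lintegral_le ψ dψ hψw (hφ.sub hi1) (hdφ.sub hi2) hdψm
    (hcs.of_isClosed_subset (isClosed_tsupport ψ) hψT) (hψT.trans hTΩ)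
  have hη0 : ∀ x ∉ W, η x = 0 := fun x hx => image_eq_zero_of_notMem_tsupport fun hc => hx (hηW hc)
  have hgη0 : ∀ x ∉ W, gradient η x = 0 := fun x hx =>
    gradient_eq_zero_of_notMem_tsupport fun hc => hx (hηW hc)
  have hPWψ : P \ W ⊆ tsupport ψ := fun x hx => subset_tsupport ψ (by
    simp only [ψ, Function.mem_support, hη0 x hx.2]
    simpa using show φ x ≠ 0 from hx.1)
  have hψsub : tsupport ψ ⊆ (P \ W) ∪ ((P ∩ W) ∪ S) := by
    intro x hx
    by_cases hxP : x ∈ P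
    · by_cases hxW : x ∈ W
      · exact Or.inr (Or.inl ⟨hxP, hxW⟩)
      · exact Or.inl ⟨hxP, hxW⟩
    · refine Or.inr (Or.inr ⟨hψT hx, not_not.1 hxP, ?_⟩)
      refine closure_mono (fun y hy => ?_) hx
      intro h1
      exact hy (by simp [ψ, h1])
  have hPWs : ∫⁻ x in P ∩ W, H x ≤ ε₁ := hsmall _ (hPm.inter hWm) (inter_subset_left.trans hPT)
    (hPW.trans_lt (hδΩ.trans_le (min_le_left _ _)))
  have e1 : ∫⁻ x in P \ W, G x (du x + dψ x) ≤ I := by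
    calc _ = ∫⁻ x in P \ W, G x (du x + dφ x) := by
          refine setLIntegral_congr_fun (hPm.diff hWm) fun x hx => ?_
          simp [dψ, hη0 x hx.2, hgη0 x hx.2]
      _ ≤ I := lintegral_mono_set sdiff_subset
  have e2 : ∫⁻ x in S, G x (du x + dψ x) ≤ ε₁ := by
    refine le_trans ?_ (hsmall S hSm (fun x hx => hx.1)
      (hS.trans_lt (hδV.trans_le (min_le_left _ _))))
    refine setLIntegral_mono' hSm fun x hx => ?_
    have : dψ x = 0 := by simp [dψ, hx.2.1, hd0 x hx.2.1]
    rw [this, add_zero]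
    simp only [H, add_assoc]
    exact le_self_add
  have e3 : ∫⁻ x in P ∩ W, G x (du x + dψ x) ≤ L * (ε₁ + L * ε₁) := by
    have hae : ∀ᵐ x ∂volume.restrict (P ∩ W), IntegrandBounds p q L (G x) :=
      ae_restrict_of_ae_restrict_of_subset ((inter_subset_left.trans hPT).trans hTΩ) h.bounds
    calc ∫⁻ x in P ∩ W, G x (du x + dψ x)
        ≤ ∫⁻ x in P ∩ W, L * (H x + L * (‖φ x‖ₑ ^ q * ‖gradient η x‖ₑ ^ q)) := by
          refine lintegral_mono_ae ?_
          filter_upwards [hae, ae_restrict_mem (hPm.inter hWm)] with x hx hxP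
          have hsplit : du x + dψ x = ((1 - η x) • (du x + dφ x) + η x • du x)
              + -(φ x • gradient η x) := by
            simp only [dψ, smul_add, sub_smul, one_smul]
            abel
          rw [hsplit]
          refine (hx.add_le _ _).trans (mul_le_mul' le_rfl ?_)
          calc G x ((1 - η x) • (du x + dφ x) + η x • du x) + G x (-(φ x • gradient η x))
              ≤ (G x (du x + dφ x) + G x (du x)) +
                L * (‖-(φ x • gradient η x)‖ₑ ^ q + 1) := by
                exact add_le_add (hx.convex_le _ (hη01 x) _ _) (hx.growth _)
            _ = _ := by
                rw [enorm_neg, enorm_smul, ENNReal.mul_rpow_of_nonneg _ _ hq0.le]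
                simp only [H, indicator_of_mem hxP.1]
                ring
      _ ≤ L * (ε₁ + L * ε₁) := by
          have hmm : Measurable fun x => ‖φ x‖ₑ ^ q * ‖gradient η x‖ₑ ^ q :=
            (hφm.enorm.pow_const q).mul (hgm.enorm.pow_const q)
          rw [lintegral_const_mul' _ _ ENNReal.coe_ne_top,
            lintegral_add_right _ (hmm.const_mul _),
            lintegral_const_mul' _ _ ENNReal.coe_ne_top]
          gcongr
          exact (setLIntegral_le_lintegral _ _).trans
            (hηi.trans (hδΩ.le.trans (min_le_right _ _)))
  calc ∫⁻ x in P, G x (du x) = (∫⁻ x in P ∩ W, G x (du x)) + ∫⁻ x in P \ W, G x (du x) :=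
        (lintegral_inter_add_sdiff _ _ hWm).symm
    _ ≤ ε₁ + ∫⁻ x in tsupport ψ, G x (du x) := by
        gcongr ?_ + ?_
        · refine le_trans (lintegral_mono fun x => ?_) hPWs
          simp only [H, add_assoc]
          exact le_self_add
        · exact lintegral_mono_set hPWψ
    _ ≤ ε₁ + Q * ((∫⁻ x in P \ W, G x (du x + dψ x)) +
          ((∫⁻ x in P ∩ W, G x (du x + dψ x)) + ∫⁻ x in S, G x (du x + dψ x))) := by
        gcongr
        refine hmin.trans ?_
        gcongr
        refine (lintegral_mono_set hψsub).trans ((lintegral_union_le _ _ _).trans ?_)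
        gcongr
        exact lintegral_union_le _ _ _
    _ ≤ ε₁ + Q * (I + (L * (ε₁ + L * ε₁) + ε₁)) := by gcongr
    _ = Q * I + (K * ε₁ : ℝ≥0) := by
        rw [hK]; push_cast; ring
    _ = Q * I + ε := by
        rw [hε₁, mul_div_cancel₀ _ hK0.ne']

/-- The truncation of `(u - k)₊` at height `M`. -/
def trunc {n : ℕ} (u : Eu n → ℝ) (k M : ℝ) : Eu n → ℝ := fun x => max 0 (min (u x - k) M)

/-- The weak gradient of `trunc u k M`. -/
def truncGrad {n : ℕ} (u : Eu n → ℝ) (du : Eu n → Eu n) (k M : ℝ) : Eu n → Eu n :=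
  fun x => (Ioo k (k + M)).indicator (1 : ℝ → ℝ) (u x) • du x

theorem measurable_trunc {n : ℕ} {u : Eu n → ℝ} (hu : Measurable u) (k M : ℝ) :
    Measurable (trunc u k M) :=
  measurable_const.max ((hu.sub_const k).min measurable_const)

theorem measurable_truncGrad {n : ℕ} {u : Eu n → ℝ} {du : Eu n → Eu n} (hu : Measurable u)
    (hdu : Measurable du) (k M : ℝ) : Measurable (truncGrad u du k M) := by
  have h : Measurable fun x => (Ioo k (k + M)).indicator (1 : ℝ → ℝ) (u x) :=
    (measurable_one.indicator measurableSet_Ioo).comp hu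
  exact h.smul hdu

theorem abs_trunc_le {n : ℕ} (u : Eu n → ℝ) (k : ℝ) {M : ℝ} (hM : 0 ≤ M) (x : Eu n) :
    |trunc u k M x| ≤ M := by
  rw [abs_of_nonneg (le_max_left _ _)]
  exact max_le hM (min_le_right _ _)

theorem trunc_ne_zero_iff {n : ℕ} (u : Eu n → ℝ) (k : ℝ) {M : ℝ} (hM : 0 < M) (x : Eu n) :
    trunc u k M x ≠ 0 ↔ k < u x := by
  simp only [trunc]
  constructor
  · intro h
    by_contra! hc
    exact h (max_eq_left ((min_le_left _ _).trans (by linarith)))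
  · intro h
    have : 0 < min (u x - k) M := lt_min (by linarith) hM
    exact (this.trans_le (le_max_right _ _)).ne'

theorem truncGrad_eq_zero {n : ℕ} (u : Eu n → ℝ) (du : Eu n → Eu n) (k : ℝ) {M : ℝ} (hM : 0 < M)
    {x : Eu n} (h : trunc u k M x = 0) : truncGrad u du k M x = 0 := by
  have : ¬ k < u x := fun hc => (trunc_ne_zero_iff u k hM x).2 hc h
  have h2 : u x ∉ Ioo k (k + M) := fun hc => this hc.1
  simp [truncGrad, h2]

theorem enorm_truncGrad_rpow_le {n : ℕ} (u : Eu n → ℝ) (du : Eu n → Eu n) (k M : ℝ) {p : ℝ}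
    (hp : 0 < p) (x : Eu n) : ‖truncGrad u du k M x‖ₑ ^ p ≤ {x | k < u x}.indicator (fun x => ‖du x‖ₑ ^ p) x := by
  by_cases h : u x ∈ Ioo k (k + M)
  · have : x ∈ {x | k < u x} := h.1
    simp [truncGrad, h, indicator_of_mem this]
  · simp [truncGrad, h, hp]

/-- Vanishing of the integral over high superlevel sets. -/
theorem exists_setLIntegral_superlevel_lt {α : Type*} [MeasurableSpace α] {μ : Measure α}
    {u : α → ℝ} (hu : Measurable u) {S : Set α} {f : α → ℝ≥0∞}
    (hf : ∫⁻ x in S, f x ∂μ ≠ ⊤) {ε : ℝ≥0∞} (hε : 0 < ε) :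
    ∃ k : ℝ, 0 < k ∧ ∫⁻ x in S ∩ {x | k ≤ u x}, f x ∂μ < ε := by
  let ν := (μ.restrict S).withDensity f
  have hm : ∀ k : ℝ, MeasurableSet {x | k ≤ u x} := fun k => measurableSet_le measurable_const hu
  have hν : ∀ k : ℝ, ν {x | k ≤ u x} = ∫⁻ x in S ∩ {x | k ≤ u x}, f x ∂μ := fun k => by
    rw [withDensity_apply _ (hm k), Measure.restrict_restrict (hm k), inter_comm]
  have hνt : ν univ ≠ ⊤ := by rwa [withDensity_apply _ .univ, Measure.restrict_univ]
  have ht := tendsto_measure_iInter_atTop (μ := ν) (s := fun k : ℕ => {x | (k : ℝ) ≤ u x})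
    (fun k => (hm k).nullMeasurableSet)
    (fun a b hab x hx => le_trans (by exact_mod_cast hab) (show (b : ℝ) ≤ u x from hx))
    ⟨0, ne_top_of_le_ne_top hνt (measure_mono (subset_univ _))⟩
  have hempty : ⋂ k : ℕ, {x | (k : ℝ) ≤ u x} = ∅ := by
    refine eq_empty_of_forall_notMem fun x hx => ?_
    obtain ⟨k, hk⟩ := exists_nat_gt (u x)
    exact absurd (mem_iInter.1 hx k) (not_le.2 hk)
  rw [hempty, measure_empty] at ht
  obtain ⟨k, hk, hk1⟩ := ((ht.eventually (gt_mem_nhds hε)).and (Filter.eventually_gt_atTop 0)).exists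
  exact ⟨k, by exact_mod_cast hk1, by rw [← hν]; exact hk⟩

theorem IsNormalizedQuasiMinimizer.bounds_restrict {m : ℕ} {p q : ℝ} {Ω : Set (Eu (m + 1))}
    {L Q : ℝ≥0} {G : Eu (m + 1) → Eu (m + 1) → ℝ≥0∞} {u : Eu (m + 1) → ℝ}
    {du : Eu (m + 1) → Eu (m + 1)} (h : IsNormalizedQuasiMinimizer m p q Ω L Q G u du)
    {S : Set (Eu (m + 1))} (hS : S ⊆ Ω) :
    ∀ᵐ x ∂volume.restrict S, IntegrandBounds p q L (G x) :=
  ae_restrict_of_ae_restrict_of_subset hS h.bounds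

theorem IsNormalizedQuasiMinimizer.aemeasurable_restrict {m : ℕ} {p q : ℝ} {Ω : Set (Eu (m + 1))}
    {L Q : ℝ≥0} {G : Eu (m + 1) → Eu (m + 1) → ℝ≥0∞} {u : Eu (m + 1) → ℝ}
    {du : Eu (m + 1) → Eu (m + 1)} (h : IsNormalizedQuasiMinimizer m p q Ω L Q G u du)
    {S : Set (Eu (m + 1))} (hS : S ⊆ Ω) :
    AEMeasurable (fun x => G x (du x)) (volume.restrict S) :=
  (h.aemeasurable du h.measurable_grad).mono_measure (Measure.restrict_mono hS le_rfl)

/-- Properties of the product of a smooth function and a truncation. -/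
theorem IsNormalizedQuasiMinimizer.smooth_mul_trunc {m : ℕ} {p q : ℝ} {Ω : Set (Eu (m + 1))}
    {L Q : ℝ≥0} {G : Eu (m + 1) → Eu (m + 1) → ℝ≥0∞} {u : Eu (m + 1) → ℝ}
    {du : Eu (m + 1) → Eu (m + 1)} (h : IsNormalizedQuasiMinimizer m p q Ω L Q G u du)
    (k : ℝ) {M : ℝ} (hM : 0 ≤ M) {χ : Eu (m + 1) → ℝ} (hχ : ContDiff ℝ (⊤ : ℕ∞) χ)
    (hχc : HasCompactSupport χ) (hχΩ : tsupport χ ⊆ Ω) (hχ1 : ∀ x, |χ x| ≤ 1) :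
    IsWeakGradOn (m + 1) univ (fun x => χ x * trunc u k M x)
      (fun x => χ x • truncGrad u du k M x + trunc u k M x • gradient χ x) ∧
    Integrable (fun x => χ x * trunc u k M x) ∧
    Integrable (fun x => χ x • truncGrad u du k M x + trunc u k M x • gradient χ x) ∧
    MemLp (fun x => χ x • truncGrad u du k M x + trunc u k M x • gradient χ x)
      (ENNReal.ofReal p) ∧
    Measurable (fun x => χ x * trunc u k M x) ∧
    Measurable (fun x => χ x • truncGrad u du k M x + trunc u k M x • gradient χ x) ∧
    IsWeakGradOn (m + 1) Ω (trunc u k M) (truncGrad u du k M) ∧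
    LocallyIntegrableOn (trunc u k M) Ω ∧ LocallyIntegrableOn (truncGrad u du k M) Ω := by
  have hp0 : 0 < p := by linarith [h.exponents.one_le]
  have hvm := measurable_trunc h.measurable k M
  have hdvm := measurable_truncGrad h.measurable h.measurable_grad k M
  have hvg : IsWeakGradOn (m + 1) Ω (trunc u k M) (truncGrad u du k M) :=
    h.isWeakGradOn.truncate h.isOpen h.locallyIntegrableOn h.locallyIntegrableOn_grad k hM
  have hv : LocallyIntegrableOn (trunc u k M) Ω := by
    refine (locallyIntegrableOn_const M).mono hvm.aestronglyMeasurable (ae_of_all _ fun x => ?_)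
    exact (abs_trunc_le u k hM x).trans (le_abs_self M)
  have hdv : LocallyIntegrableOn (truncGrad u du k M) Ω := by
    refine h.locallyIntegrableOn_grad.mono hdvm.aestronglyMeasurable (ae_of_all _ fun x => ?_)
    by_cases hx : u x ∈ Ioo k (k + M) <;> simp [truncGrad, hx]
  have hgc := continuous_gradient hχ
  have hχm : Measurable χ := hχ.continuous.measurable
  refine ⟨hvg.smooth_mul hv hdv hχ hχc hχΩ, ?_, ?_, ?_, hχm.mul hvm,
    (hχm.smul hdvm).add (hvm.smul hgc.measurable), hvg, hv, hdv⟩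
  · exact integrable_smul_of_tsupport_subset hv hχ.continuous hχc hχΩ
  · exact (integrable_smul_of_tsupport_subset hdv hχ.continuous hχc hχΩ).add
      (integrable_smul_gradient_of_tsupport_subset hv hχ hχc hχΩ)
  · refine MemLp.add ?_ ?_
    · refine ⟨(hχm.smul hdvm).aestronglyMeasurable, ?_⟩
      rw [eLpNorm_lt_top_iff_lintegral_rpow_enorm_lt_top (by simpa using hp0) (by simp),
        ENNReal.toReal_ofReal hp0.le]
      have hK : MeasurableSet (tsupport χ) := (isClosed_tsupport χ).measurableSet
      calc ∫⁻ x, ‖χ x • truncGrad u du k M x‖ₑ ^ p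
          ≤ ∫⁻ x, (tsupport χ).indicator (fun x => ‖du x‖ₑ ^ p) x := by
            refine lintegral_mono fun x => ?_
            by_cases hx : x ∈ tsupport χ
            · rw [indicator_of_mem hx, enorm_smul]
              have h1 : ‖χ x‖ₑ ≤ 1 := by
                rw [← enorm_one (G := ℝ)]
                exact enorm_le_iff_norm_le.2 (by simpa using hχ1 x)
              have h2 : ‖truncGrad u du k M x‖ₑ ≤ ‖du x‖ₑ := by
                by_cases hx : u x ∈ Ioo k (k + M) <;> simp [truncGrad, hx]
              calc (‖χ x‖ₑ * ‖truncGrad u du k M x‖ₑ) ^ p ≤ (1 * ‖du x‖ₑ) ^ p := by gcongr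
                _ = _ := by rw [one_mul]
            · simp [image_eq_zero_of_notMem_tsupport hx, hp0]
        _ = ∫⁻ x in tsupport χ, ‖du x‖ₑ ^ p := lintegral_indicator hK _
        _ ≤ ∫⁻ x in tsupport χ, G x (du x) := by
            refine lintegral_mono_ae ?_
            filter_upwards [h.bounds_restrict hχΩ] with x hx using hx.coercive _
        _ < ⊤ := (h.lintegral_ne_top _ hχΩ hχc).lt_top
    · have hgcs : HasCompactSupport (gradient χ) := by
        refine hχc.of_isClosed_subset (isClosed_tsupport _) (closure_minimal (fun x hx => ?_)
          (isClosed_tsupport χ))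
        by_contra hc
        exact hx (gradient_eq_zero_of_notMem_tsupport hc)
      refine (hgc.memLp_of_hasCompactSupport hgcs).of_le_mul (c := M)
        (hvm.smul hgc.measurable).aestronglyMeasurable (ae_of_all _ fun x => ?_)
      rw [norm_smul]
      gcongr
      exact abs_trunc_le u k hM x

/-- The energy on a superlevel set inside a cube. -/
def levelEnergy {n : ℕ} (G : Eu n → Eu n → ℝ≥0∞) (u : Eu n → ℝ) (du : Eu n → Eu n) (x₀ : Eu n)
    (k r : ℝ) : ℝ≥0∞ :=
  ∫⁻ x in {x | k < u x} ∩ cube x₀ r, G x (du x)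

theorem IsNormalizedQuasiMinimizer.lintegral_truncGrad_le {m : ℕ} {p q : ℝ}
    {Ω : Set (Eu (m + 1))} {L Q : ℝ≥0} {G : Eu (m + 1) → Eu (m + 1) → ℝ≥0∞}
    {u : Eu (m + 1) → ℝ} {du : Eu (m + 1) → Eu (m + 1)}
    (h : IsNormalizedQuasiMinimizer m p q Ω L Q G u du) {x₀ : Eu (m + 1)} {r : ℝ}
    (hr : cube x₀ r ⊆ Ω) (k M : ℝ) :
    ∫⁻ x in cube x₀ r, ‖truncGrad u du k M x‖ₑ ^ p ≤ levelEnergy G u du x₀ k r := by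
  have hp0 : 0 < p := by linarith [h.exponents.one_le]
  have hA : MeasurableSet {x | k < u x} := measurableSet_lt measurable_const h.measurable
  calc _ ≤ ∫⁻ x in cube x₀ r, {x | k < u x}.indicator (fun x => ‖du x‖ₑ ^ p) x :=
        lintegral_mono fun x => enorm_truncGrad_rpow_le u du k M hp0 x
    _ = ∫⁻ x in {x | k < u x} ∩ cube x₀ r, ‖du x‖ₑ ^ p := by
        rw [lintegral_indicator hA, Measure.restrict_restrict hA]
    _ ≤ _ := by
        refine lintegral_mono_ae ?_
        filter_upwards [h.bounds_restrict (inter_subset_right.trans hr)] with x hx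
          using hx.coercive _

/-- Poincaré inequality for truncations which vanish on a large part of a cube. -/
theorem IsNormalizedQuasiMinimizer.exists_lintegral_trunc_le {m : ℕ} {p q : ℝ}
    {Ω : Set (Eu (m + 1))} {L Q : ℝ≥0} {G : Eu (m + 1) → Eu (m + 1) → ℝ≥0∞}
    {u : Eu (m + 1) → ℝ} {du : Eu (m + 1) → Eu (m + 1)}
    (h : IsNormalizedQuasiMinimizer m p q Ω L Q G u du) :
    ∃ C : ℝ≥0, ∀ (x₀ : Eu (m + 1)) (k M s r : ℝ), 0 < M → 0 < s → s ≤ r → cube x₀ r ⊆ Ω →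
      volume ({x | k < u x} ∩ cube x₀ r) ≤ ENNReal.ofReal s ^ (m + 1) / 2 →
      ∫⁻ x in cube x₀ r, ‖trunc u k M x‖ₑ ^ p ≤
        C * ENNReal.ofReal s ^ p * levelEnergy G u du x₀ k r := by
  obtain ⟨C, hC⟩ := exists_poincare_const (m + 1) h.exponents.one_le
  refine ⟨C, fun x₀ k M s r hM hs hsr hr hvol => ?_⟩
  obtain ⟨ψ, hψ, hψc, hψΩ, hψ1, hψ01⟩ := exists_smooth_cutoff (isCompact_cube x₀ r) h.isOpen hr
  have hψ1' : ∀ x ∈ cube x₀ r, ∀ᶠ y in 𝓝 x, ψ y = 1 := fun x hx =>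
    Filter.Eventually.filter_mono (nhds_le_nhdsSet hx) hψ1
  obtain ⟨h1, h2, h3, h4, h5, h6, -⟩ := h.smooth_mul_trunc k hM.le hψ hψc hψΩ
    (fun x => abs_le.2 ⟨by linarith [(hψ01 x).1], (hψ01 x).2⟩)
  obtain ⟨S, W, hW⟩ := exists_smoothApprox_of_hasCompactSupport h.exponents.one_le h1 h2 h3 h4
    hψc.mul_right
  have hsub : {x | x ∈ cube x₀ r ∧ ψ x * trunc u k M x ≠ 0} ⊆ {x | k < u x} ∩ cube x₀ r :=
    fun x hx => ⟨(trunc_ne_zero_iff u k hM x).1 (right_ne_zero_of_mul hx.2), hx.1⟩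
  have key := hC S _ _ W hW h5.aestronglyMeasurable h6.aestronglyMeasurable x₀ s r hs hsr
    ((measure_mono hsub).trans hvol)
  have hcm := measurableSet_cube x₀ r
  calc ∫⁻ x in cube x₀ r, ‖trunc u k M x‖ₑ ^ p
      = ∫⁻ x in cube x₀ r, ‖ψ x * trunc u k M x‖ₑ ^ p :=
        setLIntegral_congr_fun hcm fun x hx => by
          simp only [(hψ1' x hx).self_of_nhds, one_mul]
    _ ≤ _ := key
    _ = C * ENNReal.ofReal s ^ p * ∫⁻ x in cube x₀ r, ‖truncGrad u du k M x‖ₑ ^ p := by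
        congr 1
        refine setLIntegral_congr_fun hcm fun x hx => ?_
        simp only [(hψ1' x hx).self_of_nhds, one_smul,
          gradient_eq_zero_of_eventually_eq_one (hψ1' x hx), smul_zero, add_zero]
    _ ≤ _ := by
        gcongr
        exact h.lintegral_truncGrad_le hr k M

theorem gradient_neg' {n : ℕ} (η : Eu n → ℝ) (x : Eu n) :
    gradient (fun x => -η x) x = -gradient η x := by
  rw [gradient, gradient, fderiv_fun_neg, map_neg]

theorem gradient_eq_zero_of_forall_le {n : ℕ} {η : Eu n → ℝ} {x : Eu n} (h : ∀ y, η y ≤ η x) :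
    gradient η x = 0 := by
  have : IsLocalMax η x := Filter.Eventually.of_forall h
  rw [gradient, this.fderiv_eq_zero, map_zero]

theorem gradient_eq_zero_of_forall_ge {n : ℕ} {η : Eu n → ℝ} {x : Eu n} (h : ∀ y, η x ≤ η y) :
    gradient η x = 0 := by
  have : IsLocalMin η x := Filter.Eventually.of_forall h
  rw [gradient, this.fderiv_eq_zero, map_zero]

/-- Pointwise estimate of the energy density of the competitor `u - η (u - k)₊`. -/
theorem IntegrandBounds.competitor_le {n : ℕ} {p q : ℝ} {L : ℝ≥0} {g : Eu n → ℝ≥0∞}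
    (hg : IntegrandBounds p q L g) (hq : 0 < q) (hL : 1 ≤ L) {t : ℝ} (ht : t ∈ Icc (0 : ℝ) 1)
    (a b : Eu n) :
    g ((1 - t) • a - b) ≤ L * g a + (3 * L ^ 2 + L ^ 2 * ‖b‖ₑ ^ q) := by
  have hL' : (1 : ℝ≥0∞) ≤ L := by exact_mod_cast hL
  have h0 : g 0 ≤ L := by simpa [hq] using hg.growth 0
  have h1 : g ((1 - t) • a) ≤ g a + L := by
    have := hg.convex_le t ht a 0
    rw [smul_zero, add_zero] at this
    exact this.trans (by gcongr)
  rw [sub_eq_add_neg]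
  calc g ((1 - t) • a + -b) ≤ L * (g ((1 - t) • a) + g (-b)) := hg.add_le _ _
    _ ≤ L * ((g a + L) + L * (‖b‖ₑ ^ q + 1)) := by
        refine mul_le_mul' le_rfl (add_le_add h1 ?_)
        simpa using hg.growth (-b)
    _ = L * g a + (2 * L ^ 2 + L ^ 2 * ‖b‖ₑ ^ q) := by ring
    _ ≤ _ := by gcongr; norm_num

/-- Caccioppoli inequality for a truncation, with the optimized cutoff. -/
theorem IsNormalizedQuasiMinimizer.levelEnergy_le_of_cutoff {m : ℕ} {p q : ℝ}
    {Ω : Set (Eu (m + 1))} {L Q : ℝ≥0} {G : Eu (m + 1) → Eu (m + 1) → ℝ≥0∞}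
    {u : Eu (m + 1) → ℝ} {du : Eu (m + 1) → Eu (m + 1)}
    (h : IsNormalizedQuasiMinimizer m p q Ω L Q G u du) {x₀ : Eu (m + 1)} {k M ρ σ : ℝ}
    (hM : 0 < M) (hσ : cube x₀ σ ⊆ Ω)
    {η : Eu (m + 1) → ℝ} (hη : ContDiff ℝ (⊤ : ℕ∞) η) (hη01 : ∀ x, η x ∈ Icc (0 : ℝ) 1)
    (hη1 : ∀ x ∈ cube x₀ ρ, η x = 1) (hηs : tsupport η ⊆ cube x₀ σ) :
    levelEnergy G u du x₀ k ρ ≤ Q * (L * (∫⁻ x in {x | k < u x} ∩ (cube x₀ σ \ cube x₀ ρ), G x (du x))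
      + L * (∫⁻ x in cube x₀ σ ∩ {x | k + M ≤ u x}, G x (du x))
      + 3 * L ^ 2 * volume ({x | k < u x} ∩ cube x₀ σ)
      + L ^ 2 * ∫⁻ x, ‖trunc u k M x‖ₑ ^ q * ‖gradient η x‖ₑ ^ q) := by
  have hq0 : 0 < q := by linarith [h.exponents.one_le, h.exponents.lt]
  have hum := h.measurable
  have hA : MeasurableSet {x | k < u x} := measurableSet_lt measurable_const hum
  have hB : MeasurableSet {x | k + M ≤ u x} := measurableSet_le measurable_const hum
  have hcσ := measurableSet_cube x₀ σ
  have hcρ := measurableSet_cube x₀ ρ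
  have hηc : HasCompactSupport η :=
    (isCompact_cube x₀ σ).of_isClosed_subset (isClosed_tsupport η) hηs
  have hχs : tsupport (fun x => -η x) ⊆ tsupport η := closure_mono fun x hx => by
    simpa using hx
  have hχc : HasCompactSupport fun x => -η x :=
    hηc.of_isClosed_subset (isClosed_tsupport _) hχs
  obtain ⟨h1, h2, h3, h4, h5, h6, -⟩ := h.smooth_mul_trunc k hM.le hη.neg hχc
    (hχs.trans (hηs.trans hσ)) (fun x => by
      rw [abs_neg]; exact abs_le.2 ⟨by linarith [(hη01 x).1], (hη01 x).2⟩)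
  set v := trunc u k M with hv
  set dv := truncGrad u du k M with hdv
  set φ : Eu (m + 1) → ℝ := fun x => -η x * v x with hφ
  set dφ : Eu (m + 1) → Eu (m + 1) :=
    fun x => -η x • dv x + v x • gradient (fun x => -η x) x with hdφ
  have hφη : ∀ x, φ x = 0 → dφ x = 0 := by
    intro x hx
    rcases mul_eq_zero.1 hx with h0 | h0
    · have h0' : η x = 0 := by simpa using h0
      have hg : gradient η x = 0 := gradient_eq_zero_of_forall_ge fun y => by
        rw [h0']; exact (hη01 y).1
      simp only [hdφ, gradient_neg', h0', hg, neg_zero, zero_smul, smul_zero, add_zero]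
    · simp only [hdφ, h0, hdv, truncGrad_eq_zero u du k hM h0, zero_smul, smul_zero, add_zero]
  have hφM : ∀ x, |φ x| ≤ M := fun x => by
    simp only [hφ, abs_mul, abs_neg]
    calc |η x| * |v x| ≤ 1 * M := by
          gcongr
          · exact abs_le.2 ⟨by linarith [(hη01 x).1], (hη01 x).2⟩
          · exact abs_trunc_le u k hM.le x
      _ = M := one_mul M
  have hφs : tsupport φ ⊆ cube x₀ σ :=
    (tsupport_mul_subset_left (f := fun x => -η x) (g := v)).trans (hχs.trans hηs)
  have key := h.lintegral_ne_zero_le h1 h2 h3 h4 hφM (hχc.mul_right) h5 h6 (hφs.trans hσ) hφη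
  set P : Set (Eu (m + 1)) := {x | φ x ≠ 0} with hP
  have hPA : P ⊆ {x | k < u x} ∩ cube x₀ σ := fun x hx =>
    ⟨(trunc_ne_zero_iff u k hM x).1 (right_ne_zero_of_mul hx), hφs (subset_tsupport φ hx)⟩
  have hPm : MeasurableSet P := h5 (measurableSet_singleton 0).compl
  have hAP : {x | k < u x} ∩ cube x₀ ρ ⊆ P := fun x hx =>
    mul_ne_zero (by simp [hη1 x hx.2]) ((trunc_ne_zero_iff u k hM x).2 hx.1)
  have hPΩ : P ⊆ Ω := hPA.trans (inter_subset_right.trans hσ)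
  have hGm := h.aemeasurable_restrict hPΩ
  let D : Set (Eu (m + 1)) := cube x₀ σ \ cube x₀ ρ
  let B : Set (Eu (m + 1)) := {x | k + M ≤ u x}
  have hDm : MeasurableSet D := hcσ.diff hcρ
  have hgm : Measurable fun x => ‖v x‖ₑ ^ q * ‖gradient η x‖ₑ ^ q :=
    ((measurable_trunc hum k M).enorm.pow_const q).mul
      ((continuous_gradient hη).measurable.enorm.pow_const q)
  have hpt : ∀ᵐ x ∂volume.restrict P, G x (du x + dφ x) ≤
      L * D.indicator (fun x => G x (du x)) x + (L * B.indicator (fun x => G x (du x)) x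
      + (3 * L ^ 2 + L ^ 2 * (‖v x‖ₑ ^ q * ‖gradient η x‖ₑ ^ q))) := by
    filter_upwards [h.bounds_restrict hPΩ, ae_restrict_mem hPm] with x hx hxP
    have hku : k < u x := (hPA hxP).1
    have hsm : ‖v x • gradient η x‖ₑ ^ q = ‖v x‖ₑ ^ q * ‖gradient η x‖ₑ ^ q := by
      rw [enorm_smul, ENNReal.mul_rpow_of_nonneg _ _ hq0.le]
    rw [← hsm]
    by_cases hxB : k + M ≤ u x
    · have hdv0 : dv x = 0 := by
        have : u x ∉ Ioo k (k + M) := fun hc => absurd hc.2 (not_lt.2 hxB)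
        simp [hdv, truncGrad, this]
      have he : du x + dφ x = (1 - 0 : ℝ) • du x - v x • gradient η x := by
        simp only [hdφ, gradient_neg', hdv0, smul_zero, zero_add, smul_neg, sub_zero, one_smul]
        exact (sub_eq_add_neg _ _).symm
      rw [he, indicator_of_mem (show x ∈ B from hxB)]
      exact (hx.competitor_le hq0 h.one_le_L (by simp) _ _).trans le_add_self
    · have hdv0 : dv x = du x := by
        have : u x ∈ Ioo k (k + M) := ⟨hku, not_le.1 hxB⟩
        simp [hdv, truncGrad, this]
      have he : du x + dφ x = (1 - η x) • du x - v x • gradient η x := by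
        simp only [hdφ, gradient_neg', hdv0, smul_neg, sub_smul, one_smul, neg_smul]
        abel
      rw [he]
      by_cases hxρ : x ∈ cube x₀ ρ
      · have hg : gradient η x = 0 := gradient_eq_zero_of_forall_le fun y => by
          rw [hη1 x hxρ]; exact (hη01 y).2
        rw [hη1 x hxρ, hg]
        have h0 : G x 0 ≤ L := by simpa [hq0] using hx.growth 0
        have hL' : (1 : ℝ≥0∞) ≤ L := by exact_mod_cast h.one_le_L
        simp only [sub_self, zero_smul, smul_zero]
        calc G x 0 ≤ 1 * L ^ 2 := by
              refine h0.trans ?_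
              rw [one_mul, sq]
              exact le_mul_of_one_le_left' hL'
          _ ≤ 3 * L ^ 2 := by gcongr; norm_num
          _ ≤ 3 * L ^ 2 + L ^ 2 * ‖(0 : Eu (m + 1))‖ₑ ^ q := le_self_add
          _ ≤ _ := le_add_self.trans le_add_self
      · rw [indicator_of_mem (show x ∈ D from ⟨(hPA hxP).2, hxρ⟩)]
        refine (hx.competitor_le hq0 h.one_le_L (hη01 x) _ _).trans (add_le_add le_rfl ?_)
        exact le_add_self
  calc levelEnergy G u du x₀ k ρ ≤ ∫⁻ x in P, G x (du x) := lintegral_mono_set hAP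
    _ ≤ Q * ∫⁻ x in P, G x (du x + dφ x) := key
    _ ≤ Q * ∫⁻ x in P, (L * D.indicator (fun x => G x (du x)) x +
          (L * B.indicator (fun x => G x (du x)) x
          + (3 * L ^ 2 + L ^ 2 * (‖v x‖ₑ ^ q * ‖gradient η x‖ₑ ^ q)))) := by
        exact mul_le_mul' le_rfl (lintegral_mono_ae hpt)
    _ = Q * (L * (∫⁻ x in D ∩ P, G x (du x)) + (L * (∫⁻ x in B ∩ P, G x (du x)) +
          (3 * L ^ 2 * volume P + L ^ 2 * ∫⁻ x in P, ‖v x‖ₑ ^ q * ‖gradient η x‖ₑ ^ q))) := by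
        rw [lintegral_add_left' ((hGm.indicator hDm).const_mul _),
          lintegral_add_left' ((hGm.indicator hB).const_mul _),
          lintegral_add_left' aemeasurable_const, setLIntegral_const,
          lintegral_const_mul' _ _ ENNReal.coe_ne_top, lintegral_const_mul' _ _ ENNReal.coe_ne_top,
          lintegral_const_mul' _ _ (by simp), lintegral_indicator hDm, lintegral_indicator hB,
          Measure.restrict_restrict hDm, Measure.restrict_restrict hB]
    _ ≤ _ := by
        rw [add_assoc, add_assoc]
        have hDP : D ∩ P ⊆ {x | k < u x} ∩ (cube x₀ σ \ cube x₀ ρ) :=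
          fun x hx => ⟨(hPA hx.2).1, hx.1⟩
        have hBP : B ∩ P ⊆ cube x₀ σ ∩ {x | k + M ≤ u x} := fun x hx => ⟨(hPA hx.2).2, hx.1⟩
        exact mul_le_mul' le_rfl (add_le_add (mul_le_mul' le_rfl (lintegral_mono_set hDP))
          (add_le_add (mul_le_mul' le_rfl (lintegral_mono_set hBP)) (add_le_add
          (mul_le_mul' le_rfl (measure_mono hPA))
          (mul_le_mul' le_rfl (setLIntegral_le_lintegral _ _)))))

/-- Caccioppoli inequality on superlevel sets. -/
theorem IsNormalizedQuasiMinimizer.exists_levelEnergy_le {m : ℕ} {p q : ℝ}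
    {Ω : Set (Eu (m + 1))} {L Q : ℝ≥0} {G : Eu (m + 1) → Eu (m + 1) → ℝ≥0∞}
    {u : Eu (m + 1) → ℝ} {du : Eu (m + 1) → Eu (m + 1)}
    (h : IsNormalizedQuasiMinimizer m p q Ω L Q G u du) (R : ℝ) :
    ∃ C : ℝ≥0, ∀ (x₀ : Eu (m + 1)) (k ρ σ : ℝ), 0 ≤ ρ → ρ < σ → σ ≤ R → cube x₀ σ ⊆ Ω →
      volume ({x | k < u x} ∩ cube x₀ σ) ≤ ENNReal.ofReal σ ^ (m + 1) / 2 →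
      levelEnergy G u du x₀ k ρ ≤
        C * (∫⁻ x in {x | k < u x} ∩ (cube x₀ σ \ cube x₀ ρ), G x (du x))
          + C * volume ({x | k < u x} ∩ cube x₀ σ)
          + C * ENNReal.ofReal (σ - ρ) ^ (1 - 2 * q - q / p) *
            levelEnergy G u du x₀ k σ ^ (q / p) := by
  have hp := h.exponents.one_le
  have hp0 : 0 < p := by linarith
  have hpq := h.exponents.lt
  have hq0 : 0 < q := by linarith
  have hs : 0 < q / p := by positivity
  have he := h.exponents.exponent_nonneg
  set e := (m : ℝ) + q - m * q / p with he'
  obtain ⟨C₁, hC₁⟩ := exists_cube_cutoff h.exponents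
  obtain ⟨C₂, hC₂⟩ := h.exists_lintegral_trunc_le
  set r := ENNReal.ofReal R with hr
  have hrt : r ≠ ⊤ := ENNReal.ofReal_ne_top
  let D : ℝ≥0∞ := C₁ * r ^ e * ((1 + C₂) * r ^ p) ^ (q / p)
  have hD : D ≠ ⊤ := by
    refine ENNReal.mul_ne_top (ENNReal.mul_ne_top (by simp)
      (ENNReal.rpow_ne_top_of_nonneg he hrt)) (ENNReal.rpow_ne_top_of_nonneg hs.le
      (ENNReal.mul_ne_top (by simp) (ENNReal.rpow_ne_top_of_nonneg hp0.le hrt)))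
  let K : ℝ≥0 := Q * (L + 3 * L ^ 2 + L ^ 2 * D.toNNReal)
  refine ⟨K, fun x₀ k ρ σ hρ hρσ hσR hσΩ hvol => ?_⟩
  have hK1 : Q * L ≤ K := by
    simp only [K]; gcongr; rw [add_assoc]; exact le_self_add
  have hK2 : Q * (3 * L ^ 2) ≤ K := by
    simp only [K]; gcongr; exact le_add_self.trans le_self_add
  have hK3 : Q * (L ^ 2 * D.toNNReal) ≤ K := by
    simp only [K]; gcongr; exact le_add_self
  set b := ENNReal.ofReal (σ - ρ) with hb
  have hb0 : b ≠ 0 := (ENNReal.ofReal_pos.2 (by linarith)).ne'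
  have hbt : b ≠ ⊤ := ENNReal.ofReal_ne_top
  set J := levelEnergy G u du x₀ k σ with hJ
  have hcs := (h.lintegral_ne_top _ hσΩ (isCompact_cube x₀ σ))
  refine ENNReal.le_of_forall_pos_le_add fun ε hε _ => ?_
  set N : ℝ≥0 := Q * (L + L ^ 2) with hN
  have hN0 : 0 < N := by
    have := h.one_le_Q; have := h.one_le_L; positivity
  set ε₁ : ℝ≥0 := ε / N with hε₁
  have hε₁0 : 0 < ε₁ := by positivity
  obtain ⟨k', -, hk'⟩ := exists_setLIntegral_superlevel_lt h.measurable hcs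
    (ε := ε₁) (by exact_mod_cast hε₁0)
  set M : ℝ := max 1 (k' - k) with hM
  have hM0 : 0 < M := by positivity
  have hkM : k' ≤ k + M := by linarith [le_max_right 1 (k' - k)]
  have hχ : ContDiff ℝ (⊤ : ℕ∞) fun _ : Eu (m + 1) => (0 : ℝ) := contDiff_const
  have h0s : tsupport (fun _ : Eu (m + 1) => (0 : ℝ)) = ∅ := by
    rw [tsupport_eq_empty_iff]; rfl
  obtain ⟨-, -, -, -, -, -, hv1, hv2, hv3⟩ := h.smooth_mul_trunc k hM0.le hχ
    (HasCompactSupport.zero) (by rw [h0s]; exact empty_subset _) (by simp)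
  have hdvJ := h.lintegral_truncGrad_le hσΩ k M
  have hJt : J ≠ ⊤ := ne_top_of_le_ne_top hcs (lintegral_mono_set inter_subset_right)
  obtain ⟨η, hη, hη01, hη1, hηs, hηi⟩ := hC₁ Ω _ _ hv1 hv2 hv3 M (abs_trunc_le u k hM0.le) x₀ ρ σ
    hρ hρσ hσΩ (ne_top_of_le_ne_top hJt hdvJ) ε₁ (by exact_mod_cast hε₁0.ne')
  have hσ0 : 0 < σ := by linarith
  have hvJ := hC₂ x₀ k M σ σ hM0 hσ0 le_rfl hσΩ hvol
  have hσr : ENNReal.ofReal σ ≤ r := ENNReal.ofReal_le_ofReal hσR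
  have hbr : b ≤ r := ENNReal.ofReal_le_ofReal (by linarith)
  have hmain : (∫⁻ x, ‖trunc u k M x‖ₑ ^ q * ‖gradient η x‖ₑ ^ q) ≤
      D * b ^ (1 - 2 * q - q / p) * J ^ (q / p) + ε₁ := by
    refine hηi.trans ?_
    gcongr ?_ + _
    have h1 : 1 ≤ b ^ (-p) * r ^ p := by
      rw [ENNReal.rpow_neg, mul_comm, ← div_eq_mul_inv, ENNReal.le_div_iff_mul_le (by simp [hb0, hbt, hp0])
        (by simp [hb0, hbt]), one_mul]
      gcongr
    have h2 : (∫⁻ x in cube x₀ σ, ‖truncGrad u du k M x‖ₑ ^ p)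
        + b ^ (-p) * ∫⁻ x in cube x₀ σ, ‖trunc u k M x‖ₑ ^ p ≤
        b ^ (-p) * ((1 + C₂) * r ^ p * J) := by
      calc _ ≤ 1 * J + b ^ (-p) * (C₂ * ENNReal.ofReal σ ^ p * J) := by
            rw [one_mul]
            gcongr
        _ ≤ (b ^ (-p) * r ^ p) * J + b ^ (-p) * (C₂ * r ^ p * J) := by gcongr
        _ = _ := by ring
    calc C₁ * (b ^ (1 - q - q / p) * ENNReal.ofReal σ ^ e) *
          ((∫⁻ x in cube x₀ σ, ‖truncGrad u du k M x‖ₑ ^ p)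
          + b ^ (-p) * ∫⁻ x in cube x₀ σ, ‖trunc u k M x‖ₑ ^ p) ^ (q / p)
        ≤ C₁ * (b ^ (1 - q - q / p) * r ^ e) * (b ^ (-p) * ((1 + C₂) * r ^ p * J)) ^ (q / p) := by
          gcongr
      _ = D * (b ^ (1 - q - q / p) * b ^ (-q)) * J ^ (q / p) := by
          rw [ENNReal.mul_rpow_of_nonneg _ _ hs.le, ENNReal.mul_rpow_of_nonneg _ J hs.le,
            ← ENNReal.rpow_mul, show -p * (q / p) = -q by field_simp]
          simp only [D]
          ring
      _ = _ := by
          rw [← ENNReal.rpow_add _ _ hb0 hbt]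
          congr 3
          ring
  have hcac := h.levelEnergy_le_of_cutoff (k := k) hM0 hσΩ hη hη01 hη1
    (hηs.trans (cube_mono x₀ (by linarith)))
  have hsup : ∫⁻ x in cube x₀ σ ∩ {x | k + M ≤ u x}, G x (du x) ≤ ε₁ :=
    (lintegral_mono_set (inter_subset_inter_right _ fun x hx => hkM.trans hx)).trans hk'.le
  refine hcac.trans ?_
  calc _ ≤ Q * (L * (∫⁻ x in {x | k < u x} ∩ (cube x₀ σ \ cube x₀ ρ), G x (du x))
      + L * ε₁ + 3 * L ^ 2 * volume ({x | k < u x} ∩ cube x₀ σ)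
      + L ^ 2 * (D * b ^ (1 - 2 * q - q / p) * J ^ (q / p) + ε₁)) := by
        gcongr
    _ = ((Q * L : ℝ≥0) : ℝ≥0∞) * (∫⁻ x in {x | k < u x} ∩ (cube x₀ σ \ cube x₀ ρ), G x (du x))
      + ((Q * (3 * L ^ 2) : ℝ≥0) : ℝ≥0∞) * volume ({x | k < u x} ∩ cube x₀ σ)
      + ((Q * (L ^ 2 * D.toNNReal) : ℝ≥0) : ℝ≥0∞) * b ^ (1 - 2 * q - q / p) * J ^ (q / p)
      + ((N * ε₁ : ℝ≥0) : ℝ≥0∞) := by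
        rw [hN]
        push_cast
        rw [ENNReal.coe_toNNReal hD]
        ring
    _ ≤ _ := by
        rw [hε₁, mul_div_cancel₀ _ hN0.ne']
        have := ENNReal.coe_le_coe.2 hK1
        have := ENNReal.coe_le_coe.2 hK2
        have := ENNReal.coe_le_coe.2 hK3
        gcongr

theorem levelEnergy_mono {n : ℕ} (G : Eu n → Eu n → ℝ≥0∞) (u : Eu n → ℝ) (du : Eu n → Eu n)
    (x₀ : Eu n) {k k' r r' : ℝ} (hk : k' ≤ k) (hr : r ≤ r') :
    levelEnergy G u du x₀ k r ≤ levelEnergy G u du x₀ k' r' :=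
  lintegral_mono_set (inter_subset_inter (fun _ hx => hk.trans_lt hx) (cube_mono x₀ hr))

theorem IsNormalizedQuasiMinimizer.volume_le_levelEnergy {m : ℕ} {p q : ℝ}
    {Ω : Set (Eu (m + 1))} {L Q : ℝ≥0} {G : Eu (m + 1) → Eu (m + 1) → ℝ≥0∞}
    {u : Eu (m + 1) → ℝ} {du : Eu (m + 1) → Eu (m + 1)}
    (h : IsNormalizedQuasiMinimizer m p q Ω L Q G u du) {x₀ : Eu (m + 1)} {r : ℝ}
    (hr : cube x₀ r ⊆ Ω) (k : ℝ) :
    volume ({x | k < u x} ∩ cube x₀ r) ≤ levelEnergy G u du x₀ k r := by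
  rw [levelEnergy, ← setLIntegral_one]
  refine lintegral_mono_ae ?_
  filter_upwards [h.bounds_restrict (inter_subset_right.trans hr)] with x hx using hx.one_le _

/-- Measure decay of superlevel sets. -/
theorem IsNormalizedQuasiMinimizer.exists_volume_superlevel_le {m : ℕ} {p q : ℝ}
    {Ω : Set (Eu (m + 1))} {L Q : ℝ≥0} {G : Eu (m + 1) → Eu (m + 1) → ℝ≥0∞}
    {u : Eu (m + 1) → ℝ} {du : Eu (m + 1) → Eu (m + 1)}
    (h : IsNormalizedQuasiMinimizer m p q Ω L Q G u du) :
    ∃ C : ℝ≥0, ∀ (x₀ : Eu (m + 1)) (k d σ : ℝ), 0 < d → d ≤ 1 → 0 < σ → cube x₀ σ ⊆ Ω →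
      volume ({x | k < u x} ∩ cube x₀ σ) ≤ ENNReal.ofReal σ ^ (m + 1) / 2 →
      volume ({x | k + d < u x} ∩ cube x₀ σ) ≤ C * ENNReal.ofReal d ^ (-p) *
        (levelEnergy G u du x₀ k σ ^ (p / (m + 1)) * levelEnergy G u du x₀ k σ) := by
  obtain ⟨C, hC⟩ := h.exists_lintegral_trunc_le
  have hp0 : 0 < p := by linarith [h.exponents.one_le]
  have hpn : 0 ≤ p / (m + 1) := by positivity
  have h2 : (2 : ℝ≥0∞) ^ (p / (m + 1)) ≠ ⊤ := ENNReal.rpow_ne_top_of_nonneg hpn (by simp)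
  refine ⟨C * (2 ^ (p / (m + 1))), fun x₀ k d σ hd hd1 hσ hσΩ hvol => ?_⟩
  set a := volume ({x | k < u x} ∩ cube x₀ σ) with ha
  set J := levelEnergy G u du x₀ k σ with hJ
  have haJ : a ≤ J := h.volume_le_levelEnergy hσΩ k
  have hsub : {x | k + d < u x} ∩ cube x₀ σ ⊆ {x | k < u x} ∩ cube x₀ σ :=
    inter_subset_inter_left _ fun x hx => lt_trans (by linarith) (show k + d < u x from hx)
  by_cases ha0 : a = 0
  · rw [measure_mono_null hsub ha0]; exact zero_le
  have hat : a ≠ ⊤ := ne_top_of_le_ne_top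
    (ENNReal.div_ne_top (ENNReal.pow_ne_top ENNReal.ofReal_ne_top) (by simp)) hvol
  set s : ℝ := (2 * a).toReal ^ ((m + 1 : ℝ)⁻¹) with hs
  have h2a : 2 * a ≠ ⊤ := ENNReal.mul_ne_top (by simp) hat
  have h2pos : 0 < (2 * a).toReal := ENNReal.toReal_pos (mul_ne_zero (by simp) ha0) h2a
  have hs0 : 0 < s := by positivity
  have hsn : ENNReal.ofReal s ^ (m + 1) = 2 * a := by
    rw [← ENNReal.ofReal_pow hs0.le, hs, ← Real.rpow_natCast, ← Real.rpow_mul h2pos.le]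
    push_cast
    rw [inv_mul_cancel₀ (by positivity), Real.rpow_one, ENNReal.ofReal_toReal h2a]
  have hsp : ENNReal.ofReal s ^ p = (2 * a) ^ (p / (m + 1)) := by
    rw [← hsn, ← ENNReal.rpow_natCast, ← ENNReal.rpow_mul]
    congr 1
    push_cast
    field_simp
  have h2a' : 2 * a ≤ ENNReal.ofReal σ ^ (m + 1) := by
    have := mul_le_mul' (le_refl (2 : ℝ≥0∞)) hvol
    rwa [ENNReal.mul_div_cancel (by simp) (by simp)] at this
  have hsσ : s ≤ σ := by
    rw [← hsn] at h2a'
    have := (ENNReal.pow_le_pow_left_iff (by omega)).1 h2a'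
    exact (ENNReal.ofReal_le_ofReal_iff hσ.le).1 this
  have hP := hC x₀ k 1 s σ one_pos hs0 hsσ hσΩ (by
    rw [hsn, mul_comm, ENNReal.mul_div_cancel_right (by simp) (by simp)])
  have hvm := measurable_trunc h.measurable k 1
  have hcheb : ENNReal.ofReal d ^ p * volume ({x | k + d < u x} ∩ cube x₀ σ) ≤
      ∫⁻ x in cube x₀ σ, ‖trunc u k 1 x‖ₑ ^ p := by
    have h1 := mul_meas_ge_le_lintegral (μ := volume.restrict (cube x₀ σ))
      (hvm.enorm.pow_const p) (ENNReal.ofReal d ^ p)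
    refine le_trans (mul_le_mul' le_rfl ?_) h1
    rw [Measure.restrict_apply' (measurableSet_cube x₀ σ)]
    refine measure_mono (inter_subset_inter_left _ fun x hx => ?_)
    have hx' : k + d < u x := hx
    have : d ≤ trunc u k 1 x := le_max_of_le_right (le_min (by linarith) hd1)
    show ENNReal.ofReal d ^ p ≤ ‖trunc u k 1 x‖ₑ ^ p
    gcongr
    rw [Real.enorm_of_nonneg (hd.le.trans this)]
    exact ENNReal.ofReal_le_ofReal this
  have hd0 : ENNReal.ofReal d ^ p ≠ 0 := by simp [hd, ENNReal.rpow_eq_zero_iff]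
  have hdt : ENNReal.ofReal d ^ p ≠ ⊤ := ENNReal.rpow_ne_top_of_nonneg hp0.le ENNReal.ofReal_ne_top
  rw [ENNReal.rpow_neg]
  calc volume ({x | k + d < u x} ∩ cube x₀ σ)
      = (ENNReal.ofReal d ^ p)⁻¹ *
          (ENNReal.ofReal d ^ p * volume ({x | k + d < u x} ∩ cube x₀ σ)) := by
        rw [← mul_assoc, ENNReal.inv_mul_cancel hd0 hdt, one_mul]
    _ ≤ (ENNReal.ofReal d ^ p)⁻¹ * (C * (2 * J) ^ (p / (m + 1)) * J) := by
        refine mul_le_mul' le_rfl (hcheb.trans (hP.trans ?_))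
        rw [hsp]
        gcongr
    _ = _ := by
        rw [ENNReal.mul_rpow_of_nonneg _ _ hpn]
        push_cast
        rw [ENNReal.coe_rpow_of_nonneg _ hpn]
        push_cast
        ring

/-- One step of the De Giorgi iteration. -/
theorem IsNormalizedQuasiMinimizer.exists_levelEnergy_step {m : ℕ} {p q : ℝ}
    {Ω : Set (Eu (m + 1))} {L Q : ℝ≥0} {G : Eu (m + 1) → Eu (m + 1) → ℝ≥0∞}
    {u : Eu (m + 1) → ℝ} {du : Eu (m + 1) → Eu (m + 1)}
    (h : IsNormalizedQuasiMinimizer m p q Ω L Q G u du) (R : ℝ) :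
    ∃ C : ℝ≥0, ∀ (x₀ : Eu (m + 1)) (k d ρ σ : ℝ) (N : ℕ), 0 < N → 0 < d → d ≤ 1 → 0 < ρ → ρ < σ →
      σ ≤ R → cube x₀ σ ⊆ Ω →
      volume ({x | k < u x} ∩ cube x₀ σ) ≤ ENNReal.ofReal ρ ^ (m + 1) / 2 →
      levelEnergy G u du x₀ (k + d) ρ ≤ C / N * levelEnergy G u du x₀ k σ
        + C * ENNReal.ofReal d ^ (-p) *
          (levelEnergy G u du x₀ k σ ^ (p / (m + 1)) * levelEnergy G u du x₀ k σ)
        + C * ENNReal.ofReal ((σ - ρ) / N) ^ (1 - 2 * q - q / p) *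
          levelEnergy G u du x₀ k σ ^ (q / p) := by
  obtain ⟨C₁, hC₁⟩ := h.exists_levelEnergy_le R
  obtain ⟨C₂, hC₂⟩ := h.exists_volume_superlevel_le
  have hp0 : 0 < p := by linarith [h.exponents.one_le]
  have hq0 : 0 < q := by linarith [h.exponents.lt]
  refine ⟨C₁ * (1 + C₂), fun x₀ k d ρ σ N hN hd hd1 hρ hρσ hσR hσΩ hvol => ?_⟩
  have hNr : (0 : ℝ) < N := by exact_mod_cast hN
  set J := levelEnergy G u du x₀ k σ with hJ
  let A : Set (Eu (m + 1)) := {x | k + d < u x}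
  have hA : MeasurableSet A := measurableSet_lt measurable_const h.measurable
  have hAk : A ⊆ {x | k < u x} := fun x hx => lt_trans (by linarith) (show k + d < u x from hx)
  let b : ℝ := (σ - ρ) / N
  have hb : 0 < b := div_pos (by linarith) hNr
  let r : ℕ → ℝ := fun i => ρ + i * b
  have hr0 : r 0 = ρ := by simp [r]
  have hrN : r N = σ := by simp only [r, b]; field_simp; ring
  have hrs : ∀ i, r (i + 1) = r i + b := fun i => by simp only [r]; push_cast; ring
  have hrm : Monotone r := monotone_nat_of_le_succ fun i => by rw [hrs]; linarith
  let S : ℕ → Set (Eu (m + 1)) := fun i => A ∩ (cube x₀ (r (i + 1)) \ cube x₀ (r i))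
  have hsum : ∀ j, ∑ i ∈ Finset.range j, ∫⁻ x in S i, G x (du x) ≤
      ∫⁻ x in A ∩ cube x₀ (r j), G x (du x) := by
    intro j
    induction j with
    | zero => simp
    | succ j ih =>
      rw [Finset.sum_range_succ, ← lintegral_inter_add_sdiff _ (A ∩ cube x₀ (r (j + 1)))
        (measurableSet_cube x₀ (r j))]
      refine add_le_add (ih.trans (lintegral_mono_set fun x hx => ?_))
        (lintegral_mono_set fun x hx => ⟨⟨hx.1, hx.2.1⟩, hx.2.2⟩)
      exact ⟨⟨hx.1, cube_mono x₀ (hrm (Nat.le_succ j)) hx.2⟩, hx.2⟩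
  have hsum' : ∑ i ∈ Finset.range N, ∫⁻ x in S i, G x (du x) ≤ J := by
    refine (hsum N).trans ?_
    rw [hrN]
    exact lintegral_mono_set (inter_subset_inter_left _ hAk)
  obtain ⟨i, hi, hiJ⟩ : ∃ i ∈ Finset.range N, ∫⁻ x in S i, G x (du x) ≤ J / N := by
    by_contra! hc
    have hlt := ENNReal.sum_lt_sum_of_nonempty (Finset.nonempty_range_iff.2 hN.ne') hc
    rw [Finset.sum_const, Finset.card_range, nsmul_eq_mul,
      ENNReal.mul_div_cancel (by exact_mod_cast hN.ne') (ENNReal.natCast_ne_top N)] at hlt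
    exact absurd hsum' (not_le.2 hlt)
  have hiN : i + 1 ≤ N := Finset.mem_range.1 hi
  have hρi : ρ ≤ r i := by rw [← hr0]; exact hrm (Nat.zero_le i)
  have hiσ : r (i + 1) ≤ σ := by rw [← hrN]; exact hrm hiN
  have hii : r i < r (i + 1) := by rw [hrs]; linarith
  have hsubσ : cube x₀ (r (i + 1)) ⊆ cube x₀ σ := cube_mono x₀ hiσ
  have hcac := hC₁ x₀ (k + d) (r i) (r (i + 1)) (by linarith) hii (hiσ.trans hσR)
    (hsubσ.trans hσΩ) ((measure_mono (inter_subset_inter hAk hsubσ)).trans (hvol.trans (by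
      gcongr; linarith)))
  have hvolσ := hC₂ x₀ k d σ hd hd1 (by linarith) hσΩ (hvol.trans (by gcongr))
  have hC1 : (C₁ : ℝ≥0∞) ≤ (C₁ * (1 + C₂) : ℝ≥0) := by
    push_cast; exact le_mul_of_one_le_right' le_self_add
  have hC12 : (C₁ * C₂ : ℝ≥0∞) ≤ (C₁ * (1 + C₂) : ℝ≥0) := by
    push_cast; gcongr; exact le_add_self
  have hri : r (i + 1) - r i = (σ - ρ) / N := by rw [hrs]; simp [b]
  rw [hri] at hcac
  calc levelEnergy G u du x₀ (k + d) ρ ≤ levelEnergy G u du x₀ (k + d) (r i) :=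
        levelEnergy_mono G u du x₀ le_rfl hρi
    _ ≤ _ := hcac
    _ ≤ C₁ * (J / N) + C₁ * (C₂ * ENNReal.ofReal d ^ (-p) * (J ^ (p / (m + 1)) * J))
        + C₁ * ENNReal.ofReal ((σ - ρ) / N) ^ (1 - 2 * q - q / p) * J ^ (q / p) := by
        gcongr
        · exact (measure_mono (inter_subset_inter_right _ hsubσ)).trans hvolσ
        · exact levelEnergy_mono G u du x₀ (by linarith) hiσ
    _ = C₁ / N * J + (C₁ * C₂) * ENNReal.ofReal d ^ (-p) * (J ^ (p / (m + 1)) * J)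
        + C₁ * ENNReal.ofReal ((σ - ρ) / N) ^ (1 - 2 * q - q / p) * J ^ (q / p) := by
        simp only [div_eq_mul_inv]
        ring
    _ ≤ _ := by gcongr

/-- Geometric decay for superlinear recursions. -/
theorem le_mul_pow_of_superlinear_step {J : ℕ → ℝ≥0∞} {a C τ θ Λ : ℝ≥0∞} {α : ℝ} (hα : 0 < α)
    (hτ : τ ≤ 1) (hτΛ : τ ^ α * Λ ≤ 1) (ha : a ≤ τ / 2) (hθ : C * θ ^ α ≤ τ / 2)
    (h0 : J 0 ≤ θ)
    (hstep : ∀ l, J l ≤ θ → J (l + 1) ≤ a * J l + C * Λ ^ l * J l ^ α * J l) :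
    ∀ l, J l ≤ θ * τ ^ l := by
  intro l
  induction l with
  | zero => simpa using h0
  | succ l ih =>
    have hl : J l ≤ θ := ih.trans (by
      calc θ * τ ^ l ≤ θ * 1 := by gcongr; exact pow_le_one' hτ l
        _ = θ := mul_one θ)
    calc J (l + 1) ≤ a * J l + C * Λ ^ l * J l ^ α * J l := hstep l hl
      _ ≤ τ / 2 * J l + C * Λ ^ l * (θ * τ ^ l) ^ α * J l := by gcongr
      _ = τ / 2 * J l + C * θ ^ α * (τ ^ α * Λ) ^ l * J l := by
          rw [ENNReal.mul_rpow_of_nonneg _ _ hα.le, mul_pow, ← ENNReal.rpow_natCast τ l,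
            ← ENNReal.rpow_natCast (τ ^ α) l, ← ENNReal.rpow_mul, ← ENNReal.rpow_mul,
            mul_comm (l : ℝ) α]
          ring
      _ ≤ τ / 2 * J l + τ / 2 * 1 * J l := by
          gcongr
          exact pow_le_one' hτΛ l
      _ = τ * J l := by rw [mul_one, ← add_mul, ENNReal.add_halves]
      _ ≤ τ * (θ * τ ^ l) := by gcongr
      _ = θ * τ ^ (l + 1) := by ring

theorem ofReal_mul_half_pow_rpow_neg_le {c g γ : ℝ} (hc : 0 < c) (hγg : γ ≤ g) (l : ℕ) :
    ENNReal.ofReal (c * (1 / 2) ^ (l + 1)) ^ (-γ) ≤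
      ENNReal.ofReal (c ^ (-γ) * 2 ^ g) * ENNReal.ofReal (2 ^ g) ^ l := by
  rw [ENNReal.ofReal_rpow_of_pos (by positivity), ← ENNReal.ofReal_pow (by positivity),
    ← ENNReal.ofReal_mul (by positivity)]
  refine ENNReal.ofReal_le_ofReal ?_
  rw [Real.mul_rpow hc.le (by positivity), mul_assoc]
  gcongr
  rw [one_div, inv_pow, Real.inv_rpow (by positivity), Real.rpow_neg (by positivity), inv_inv,
    ← Real.rpow_natCast, ← Real.rpow_mul (by norm_num), mul_comm (((l + 1 : ℕ)) : ℝ) γ,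
    Real.rpow_mul (by norm_num), Real.rpow_natCast, pow_succ']
  gcongr <;> norm_num

/-- Local boundedness from above on cubes. -/
theorem IsNormalizedQuasiMinimizer.exists_volume_superlevel_eq_zero {m : ℕ} {p q : ℝ}
    {Ω : Set (Eu (m + 1))} {L Q : ℝ≥0} {G : Eu (m + 1) → Eu (m + 1) → ℝ≥0∞}
    {u : Eu (m + 1) → ℝ} {du : Eu (m + 1) → Eu (m + 1)}
    (h : IsNormalizedQuasiMinimizer m p q Ω L Q G u du) {x₀ : Eu (m + 1)} {R : ℝ} (hR : 0 < R)
    (hRΩ : cube x₀ R ⊆ Ω) : ∃ k, volume ({x | k < u x} ∩ cube x₀ (R / 2)) = 0 := by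
  have hp := h.exponents.one_le
  have hp0 : 0 < p := by linarith
  have hpq := h.exponents.lt
  have hqp : 1 < q / p := (one_lt_div hp0).2 hpq
  obtain ⟨C, hC⟩ := h.exists_levelEnergy_step R
  set γ : ℝ := 2 * q + q / p - 1 with hγ
  have hγ' : 1 - 2 * q - q / p = -γ := by rw [hγ]; ring
  rw [hγ'] at hC
  set g : ℝ := max p γ with hg
  have hg0 : 0 < g := hp0.trans_le (le_max_left _ _)
  set α : ℝ := min (p / (m + 1)) (q / p - 1) with hα
  have hα0 : 0 < α := lt_min (by positivity) (by linarith)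
  set t : ℝ := (2 ^ g) ^ (-(1 / α)) with ht
  have h2g : (1 : ℝ) < 2 ^ g := Real.one_lt_rpow (by norm_num) hg0
  have ht0 : 0 < t := by positivity
  have ht1 : t < 1 := Real.rpow_lt_one_of_one_lt_of_neg h2g (by
    have : 0 < 1 / α := by positivity
    linarith)
  have htα : t ^ α * 2 ^ g = 1 := by
    rw [ht, ← Real.rpow_mul (by positivity), show -(1 / α) * α = -1 by field_simp,
      Real.rpow_neg_one, inv_mul_cancel₀ (by positivity)]
  obtain ⟨N, hN⟩ := exists_nat_gt (2 * C / t)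
  have hNr : (0 : ℝ) < N := lt_of_le_of_lt (by positivity) hN
  have hN0 : 0 < N := by exact_mod_cast hNr
  set τ := ENNReal.ofReal t with hτ
  have hτ0 : 0 < τ := ENNReal.ofReal_pos.2 ht0
  have hτ1 : τ < 1 := by rw [hτ]; exact ENNReal.ofReal_lt_one.2 ht1
  have ha : (C : ℝ≥0∞) / N ≤ τ / 2 := by
    have h1 : (C : ℝ≥0∞) / N = ENNReal.ofReal (C / N) := by
      rw [ENNReal.ofReal_div_of_pos hNr, ENNReal.ofReal_coe_nnreal, ENNReal.ofReal_natCast]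
    have h2 : τ / 2 = ENNReal.ofReal (t / 2) := by
      rw [ENNReal.ofReal_div_of_pos two_pos, ENNReal.ofReal_ofNat]
    rw [h1, h2]
    refine ENNReal.ofReal_le_ofReal ?_
    rw [div_lt_iff₀ ht0] at hN
    rw [div_le_div_iff₀ hNr two_pos]
    linarith
  set Λ := ENNReal.ofReal (2 ^ g) with hΛ
  have hτΛ : τ ^ α * Λ ≤ 1 := by
    rw [hτ, ENNReal.ofReal_rpow_of_pos ht0, hΛ, ← ENNReal.ofReal_mul (by positivity), htα,
      ENNReal.ofReal_one]
  set c : ℝ := R / 2 / N with hc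
  have hc0 : 0 < c := by positivity
  set D : ℝ≥0∞ := C * (ENNReal.ofReal (1 ^ (-p) * 2 ^ g) + ENNReal.ofReal (c ^ (-γ) * 2 ^ g)) with hD
  have hDt : D ≠ ⊤ := ENNReal.mul_ne_top (by simp) (by simp)
  set V := ENNReal.ofReal (R / 2) ^ (m + 1) / 2 with hV
  have hV0 : 0 < V := ENNReal.div_pos (by simp [hR]) (by simp)
  set θ := min (min 1 V) ((τ / 2 / D) ^ (1 / α)) with hθ
  have hθ0 : 0 < θ := lt_min (lt_min one_pos hV0)
    (ENNReal.rpow_pos_of_nonneg (ENNReal.div_pos (ENNReal.div_pos hτ0.ne' (by simp)).ne' hDt)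
      (by positivity))
  have hθ1 : θ ≤ 1 := (min_le_left _ _).trans (min_le_left _ _)
  have hθV : θ ≤ V := (min_le_left _ _).trans (min_le_right _ _)
  have hDθ : D * θ ^ α ≤ τ / 2 := by
    calc D * θ ^ α ≤ D * ((τ / 2 / D) ^ (1 / α)) ^ α := by gcongr; exact min_le_right _ _
      _ = D * (τ / 2 / D) := by
        rw [← ENNReal.rpow_mul, one_div, inv_mul_cancel₀ hα0.ne', ENNReal.rpow_one]
      _ ≤ τ / 2 := ENNReal.mul_div_le
  obtain ⟨k₀, -, hk₀⟩ := exists_setLIntegral_superlevel_lt h.measurable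
    (h.lintegral_ne_top _ hRΩ (isCompact_cube x₀ R)) hθ0
  let r : ℕ → ℝ := fun l => R / 2 * (1 + (1 / 2) ^ l)
  let k : ℕ → ℝ := fun l => k₀ + 1 - (1 / 2) ^ l
  have hhalf : ∀ l : ℕ, (0 : ℝ) < (1 / 2) ^ l ∧ ((1 : ℝ) / 2) ^ l ≤ 1 := fun l =>
    ⟨by positivity, pow_le_one₀ (by norm_num) (by norm_num)⟩
  have hrR : ∀ l, r l ≤ R := fun l => by
    simp only [r]; nlinarith [hhalf l]
  have hrR2 : ∀ l, R / 2 ≤ r l := fun l => by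
    simp only [r]; nlinarith [hhalf l]
  let J : ℕ → ℝ≥0∞ := fun l => levelEnergy G u du x₀ (k l) (r l)
  have hJ0 : J 0 ≤ θ := by
    refine le_trans (lintegral_mono_set fun x hx => ?_) hk₀.le
    refine ⟨cube_mono x₀ (hrR 0) hx.2, ?_⟩
    have : k 0 < u x := hx.1
    simp only [k, pow_zero, add_sub_cancel_right] at this
    exact this.le
  have hstep : ∀ l, J l ≤ θ → J (l + 1) ≤ C / N * J l + D * Λ ^ l * J l ^ α * J l := by
    intro l hl
    have hk : k (l + 1) = k l + 1 * (1 / 2) ^ (l + 1) := by simp only [k, pow_succ]; ring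
    have hrr : (r l - r (l + 1)) / N = c * (1 / 2) ^ (l + 1) := by
      simp only [r, c, pow_succ]; ring
    have hrl : r (l + 1) < r l := by
      simp only [r, pow_succ]; nlinarith [hhalf l]
    have hlΩ : cube x₀ (r l) ⊆ Ω := (cube_mono x₀ (hrR l)).trans hRΩ
    have hvol : volume ({x | k l < u x} ∩ cube x₀ (r l)) ≤
        ENNReal.ofReal (r (l + 1)) ^ (m + 1) / 2 := by
      refine (h.volume_le_levelEnergy hlΩ (k l)).trans (hl.trans (hθV.trans ?_))
      rw [hV]
      gcongr
      exact hrR2 _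
    have hst := hC x₀ (k l) (1 * (1 / 2) ^ (l + 1)) (r (l + 1)) (r l) N hN0 (by positivity)
      (by rw [one_mul]; exact (hhalf _).2) (lt_of_lt_of_le (by positivity) (hrR2 _)) hrl (hrR l)
      hlΩ hvol
    rw [← hk, hrr] at hst
    have hJl1 : J l ≤ 1 := hl.trans hθ1
    have hα1 : J l ^ (p / (m + 1)) ≤ J l ^ α :=
      ENNReal.rpow_le_rpow_of_exponent_ge hJl1 (min_le_left _ _)
    have hα2 : J l ^ (q / p) ≤ J l ^ α * J l := by
      calc J l ^ (q / p) = J l ^ (q / p - 1) * J l := by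
            conv_rhs => rw [← ENNReal.rpow_one (J l), ← ENNReal.rpow_mul, one_mul]
            rw [← ENNReal.rpow_add_of_nonneg _ _ (by linarith) zero_le_one, sub_add_cancel]
        _ ≤ _ := by
            gcongr ?_ * _
            exact ENNReal.rpow_le_rpow_of_exponent_ge hJl1 (min_le_right _ _)
    calc J (l + 1) ≤ _ := hst
      _ ≤ C / N * J l + C * (ENNReal.ofReal (1 ^ (-p) * 2 ^ g) * Λ ^ l) * (J l ^ α * J l)
          + C * (ENNReal.ofReal (c ^ (-γ) * 2 ^ g) * Λ ^ l) * (J l ^ α * J l) := by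
          have e1 := ofReal_mul_half_pow_rpow_neg_le one_pos (le_max_left p γ) l
          have e2 := ofReal_mul_half_pow_rpow_neg_le hc0 (le_max_right p γ) l
          gcongr
      _ = _ := by rw [hD]; ring
  have hdecay := le_mul_pow_of_superlinear_step hα0 hτ1.le hτΛ ha hDθ hJ0 hstep
  refine ⟨k₀ + 1, le_antisymm ?_ zero_le⟩
  have hlim : Filter.Tendsto (fun l : ℕ => θ * τ ^ l) Filter.atTop (𝓝 0) := by
    have := ENNReal.Tendsto.const_mul (a := θ)
      (ENNReal.tendsto_pow_atTop_nhds_zero_of_lt_one hτ1)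
      (Or.inr (ne_top_of_le_ne_top ENNReal.one_ne_top hθ1))
    simpa using this
  refine ge_of_tendsto' hlim fun l => ?_
  refine (h.volume_le_levelEnergy ((cube_mono x₀ (by linarith)).trans hRΩ) (k₀ + 1)).trans
    (le_trans (levelEnergy_mono G u du x₀ ?_ (hrR2 l)) (hdecay l))
  simp only [k]
  linarith [hhalf l]

/-- Local boundedness from above on compact sets. -/
theorem IsNormalizedQuasiMinimizer.exists_ae_le {m : ℕ} {p q : ℝ}
    {Ω : Set (Eu (m + 1))} {L Q : ℝ≥0} {G : Eu (m + 1) → Eu (m + 1) → ℝ≥0∞}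
    {u : Eu (m + 1) → ℝ} {du : Eu (m + 1) → Eu (m + 1)}
    (h : IsNormalizedQuasiMinimizer m p q Ω L Q G u du) {K : Set (Eu (m + 1))} (hK : IsCompact K)
    (hKΩ : K ⊆ Ω) : ∃ C : ℝ, ∀ᵐ x ∂volume.restrict K, u x ≤ C := by
  refine hK.induction_on (p := fun S => ∃ C : ℝ, ∀ᵐ x ∂volume.restrict S, u x ≤ C) ?_ ?_ ?_ ?_
  · exact ⟨0, by simp⟩
  · rintro s t hst ⟨C, hC⟩
    exact ⟨C, ae_restrict_of_ae_restrict_of_subset hst hC⟩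
  · rintro s t ⟨C, hC⟩ ⟨D, hD⟩
    refine ⟨max C D, (ae_restrict_union_iff s t _).2 ⟨?_, ?_⟩⟩
    · filter_upwards [hC] with x hx using hx.trans (le_max_left _ _)
    · filter_upwards [hD] with x hx using hx.trans (le_max_right _ _)
  · intro x hx
    obtain ⟨ε, hε, hball⟩ := Metric.isOpen_iff.1 h.isOpen x (hKΩ hx)
    set R : ℝ := ε / (2 * (√((m + 1 : ℕ) : ℝ))) with hR
    have hs : 0 < √((m + 1 : ℕ) : ℝ) := Real.sqrt_pos.2 (by positivity)
    have hR0 : 0 < R := by positivity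
    have hcube : cube x R ⊆ Ω := by
      refine (cube_subset_closedBall x hR0.le).trans (Subset.trans ?_ hball)
      refine closedBall_subset_ball ?_
      rw [hR]
      field_simp
      norm_num
    obtain ⟨k, hk⟩ := h.exists_volume_superlevel_eq_zero hR0 hcube
    refine ⟨cube x (R / 2), mem_nhdsWithin_of_mem_nhds (Filter.mem_of_superset
      (closedBall_mem_nhds x (half_pos hR0)) (closedBall_subset_cube x _)), k, ?_⟩
    rw [ae_iff, Measure.restrict_apply' (measurableSet_cube x _)]
    simpa only [not_le] using hk

theorem exists_sobolevExponents {m : ℕ} (hm : 1 ≤ m) {p q : ℝ} (hp : 1 ≤ p) (hpq : p ≤ q)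
    (hq : 1 / p - 1 / (m : ℝ) ≤ 1 / q) :
    ∃ p' q', p' ≤ p ∧ q ≤ q' ∧ SobolevExponents m p' q' := by
  have hp0 : 0 < p := by linarith
  have hq0 : 0 < q := by linarith
  rcases hm.eq_or_lt with rfl | hm2
  · exact ⟨1, q + 1, hp, by linarith, le_rfl, by linarith, Or.inl ⟨rfl, rfl⟩⟩
  have hm2 : (2 : ℝ) ≤ m := by exact_mod_cast hm2
  have hm0 : (0 : ℝ) < m := by linarith
  rcases lt_or_ge p m with hpm | hpm
  · have hd : 0 < 1 / p - 1 / (m : ℝ) := sub_pos.2 (one_div_lt_one_div_of_lt hp0 hpm)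
    have hle : q ≤ 1 / (1 / p - 1 / (m : ℝ)) := by
      rw [le_one_div hq0 hd]; exact hq
    refine ⟨p, 1 / (1 / p - 1 / (m : ℝ)), le_rfl, hle, hp, ?_, Or.inr ⟨hpm, by rw [one_div_one_div]⟩⟩
    rw [lt_one_div hp0 hd]
    have : 0 < 1 / (m : ℝ) := by positivity
    linarith
  · have hQ2 : (2 : ℝ) ≤ max q 2 := le_max_right _ _
    have hQ0 : 0 < max q 2 := by linarith
    have h1 : 1 / (m : ℝ) ≤ 1 / 2 := one_div_le_one_div_of_le two_pos hm2
    have h2 : 1 / max q 2 ≤ 1 / 2 := one_div_le_one_div_of_le two_pos hQ2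
    have hm' : 0 < 1 / (m : ℝ) := by positivity
    have hQ' : 0 < 1 / max q 2 := by positivity
    have hs : 0 < 1 / (m : ℝ) + 1 / max q 2 := by positivity
    have hlt : 1 / (1 / (m : ℝ) + 1 / max q 2) < m := by
      rw [one_div_lt hs hm0]; linarith
    refine ⟨1 / (1 / (m : ℝ) + 1 / max q 2), max q 2, hlt.le.trans hpm, le_max_left _ _, ?_, ?_,
      Or.inr ⟨hlt, by rw [one_div_one_div]; ring⟩⟩
    · rw [le_one_div one_pos hs]; linarith
    · rw [one_div_lt hs hQ0]; linarith

theorem IntegrandBounds.of_convexOn {n : ℕ} {p q p' q' L μ : ℝ} (hp' : 1 ≤ p') (hpp' : p' ≤ p)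
    (hpq : p ≤ q) (hqq' : q ≤ q') (hL : 1 ≤ L) (hμ : 0 ≤ μ) {g : Eu n → ℝ}
    (hconv : ConvexOn ℝ univ g) (hgrowth : ∀ z, ‖z‖ ^ p ≤ g z ∧ g z ≤ L * ‖z‖ ^ q + 1)
    (hdouble : ∀ z, g (2 • z) ≤ μ + L * g z) :
    IntegrandBounds p' q' (L + μ + 2).toNNReal fun z => ENNReal.ofReal (g z + 1) := by
  have hg0 : ∀ z, 0 ≤ g z := fun z => (by positivity : 0 ≤ ‖z‖ ^ p).trans (hgrowth z).1
  have hpow : ∀ {a b : ℝ}, 1 ≤ a → a ≤ b → ∀ z : Eu n, ‖z‖ ^ a ≤ ‖z‖ ^ b + 1 := by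
    intro a b ha hab z
    rcases le_total ‖z‖ 1 with hz | hz
    · exact (Real.rpow_le_one (norm_nonneg z) hz (by linarith)).trans
        (le_add_of_nonneg_left (by positivity))
    · exact (Real.rpow_le_rpow_of_exponent_le hz hab).trans (by linarith)
  have hen : ∀ {a : ℝ}, 1 ≤ a → ∀ z : Eu n, ‖z‖ₑ ^ a = ENNReal.ofReal (‖z‖ ^ a) := by
    intro a ha z
    rw [← ofReal_norm, ENNReal.ofReal_rpow_of_nonneg (norm_nonneg z) (by linarith)]
  refine ⟨fun z => ?_, fun z => ?_, fun z => ?_, fun a b => ?_, fun t ht a b => ?_⟩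
  · rw [ENNReal.one_le_ofReal]; linarith [hg0 z]
  · rw [hen hp']
    exact ENNReal.ofReal_le_ofReal ((hpow hp' hpp' z).trans (by linarith [(hgrowth z).1]))
  · rw [hen (by linarith), ← ENNReal.ofReal_one, ← ENNReal.ofReal_add (by positivity) zero_le_one,
      ENNReal.ofNNReal_toNNReal, ← ENNReal.ofReal_mul (by positivity)]
    refine ENNReal.ofReal_le_ofReal ?_
    have h1 := hpow (by linarith) hqq' z
    have h2 : 0 ≤ ‖z‖ ^ q' := by positivity
    nlinarith [(hgrowth z).2]
  · rw [← ENNReal.ofReal_add (by linarith [hg0 a]) (by linarith [hg0 b]),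
      ENNReal.ofNNReal_toNNReal, ← ENNReal.ofReal_mul (by positivity)]
    refine ENNReal.ofReal_le_ofReal ?_
    have h1 := hconv.2 (mem_univ (2 • a)) (mem_univ (2 • b))
      (by norm_num : (0 : ℝ) ≤ 1 / 2) (by norm_num : (0 : ℝ) ≤ 1 / 2) (by norm_num)
    have h2 : (1 / 2 : ℝ) • (2 • a) + (1 / 2 : ℝ) • (2 • b) = a + b := by
      rw [two_nsmul, two_nsmul, ← two_smul ℝ a, ← two_smul ℝ b, smul_smul, smul_smul]
      norm_num
    rw [h2, smul_eq_mul, smul_eq_mul] at h1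
    nlinarith [hdouble a, hdouble b, hg0 a, hg0 b, mul_nonneg hμ (hg0 a), mul_nonneg hμ (hg0 b)]
  · rw [← ENNReal.ofReal_add (by linarith [hg0 a]) (by linarith [hg0 b])]
    refine ENNReal.ofReal_le_ofReal ?_
    have h1 := hconv.2 (mem_univ a) (mem_univ b)
      (by linarith [ht.2] : 0 ≤ 1 - t) ht.1 (by ring)
    rw [smul_eq_mul, smul_eq_mul] at h1
    nlinarith [ht.1, ht.2, hg0 a, hg0 b]

/-- Superposition with a Carathéodory function preserves measurability. -/
theorem aemeasurable_caratheodory_comp {α E : Type*} [MeasurableSpace α] {ν : Measure α}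
    [TopologicalSpace E] [TopologicalSpace.PseudoMetrizableSpace E]
    [SecondCountableTopology E] [MeasurableSpace E] [BorelSpace E]
    {f : α → E → ℝ} (hf : ∀ z, AEMeasurable (fun x => f x z) ν)
    (hc : ∀ᵐ x ∂ν, Continuous (f x)) {g : α → E} (hg : Measurable g) :
    AEMeasurable (fun x => f x (g x)) ν := by
  have hs := hg.stronglyMeasurable
  refine aemeasurable_of_tendsto_metrizable_ae' (f := fun k x => f x (hs.approx k x)) ?_ ?_
  · intro k
    have heq : (fun x => f x (hs.approx k x)) = fun x =>
        ∑ z ∈ (hs.approx k).range, (hs.approx k ⁻¹' {z}).indicator (fun x => f x z) x := by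
      ext x
      rw [Finset.sum_eq_single (hs.approx k x)]
      · rw [indicator_of_mem (by simp)]
      · intro z _ hz
        exact indicator_of_notMem (fun h => hz h.symm) _
      · intro h
        exact absurd (SimpleFunc.mem_range_self _ x) h
    rw [heq]
    exact Finset.aemeasurable_fun_sum _ fun z _ =>
      (hf z).indicator ((hs.approx k).measurableSet_fiber z)
  · filter_upwards [hc] with x hx
    exact (hx.tendsto _).comp (hs.tendsto_approx x)

theorem IsWeakGradOn.congr {n : ℕ} {Ω : Set (Eu n)} {u v : Eu n → ℝ} {du dv : Eu n → Eu n}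
    (h : IsWeakGradOn n Ω u du) (huv : u =ᵐ[volume.restrict Ω] v)
    (hd : du =ᵐ[volume.restrict Ω] dv) : IsWeakGradOn n Ω v dv := by
  intro φ hφ hφc hφΩ i
  have h1 : (∫ x in Ω, u x * fderiv ℝ φ x (EuclideanSpace.single i 1)) =
      ∫ x in Ω, v x * fderiv ℝ φ x (EuclideanSpace.single i 1) :=
    integral_congr_ae (huv.mono fun x hx => by simp only [hx])
  have h2 : (∫ x in Ω, du x i * φ x) = ∫ x in Ω, dv x i * φ x :=
    integral_congr_ae (hd.mono fun x hx => by simp only [hx])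
  rw [← h1, ← h2]
  exact h φ hφ hφc hφΩ i

theorem LocallyIntegrableOn.congr_ae_restrict {X F : Type*} [TopologicalSpace X]
    [MeasurableSpace X] [NormedAddCommGroup F] {ν : Measure X}
    {Ω : Set X} {u v : X → F} (h : LocallyIntegrableOn u Ω ν)
    (huv : u =ᵐ[ν.restrict Ω] v) : LocallyIntegrableOn v Ω ν := by
  intro x hx
  obtain ⟨s, hs, hi⟩ := h x hx
  refine ⟨s ∩ Ω, Filter.inter_mem hs self_mem_nhdsWithin, ?_⟩
  refine (hi.mono_set inter_subset_left).congr ?_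
  exact ae_restrict_of_ae_restrict_of_subset inter_subset_right huv

theorem IsQMinimizer.congr {n : ℕ} {Ω : Set (Eu n)} {f : Eu n → Eu n → ℝ} {Q : ℝ}
    {u v : Eu n → ℝ} {du dv : Eu n → Eu n} (h : IsQMinimizer n Ω f Q u du)
    (huv : u =ᵐ[volume.restrict Ω] v) (hd : du =ᵐ[volume.restrict Ω] dv) :
    IsQMinimizer n Ω f Q v dv := by
  obtain ⟨h1, h2, h3, h4⟩ := h
  refine ⟨h1.congr huv hd, LocallyIntegrableOn.congr_ae_restrict h2 huv,
    LocallyIntegrableOn.congr_ae_restrict h3 hd,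
    fun φ dφ hw hi hdi hc hΩ' => ?_⟩
  obtain ⟨h5, h6⟩ := h4 φ dφ hw hi hdi hc hΩ'
  have hd' := ae_restrict_of_ae_restrict_of_subset hΩ' hd
  have e1 : (fun x => f x (du x)) =ᵐ[volume.restrict (tsupport φ)] fun x => f x (dv x) :=
    hd'.mono fun x hx => by simp only [hx]
  have e2 : (fun x => f x (du x + dφ x)) =ᵐ[volume.restrict (tsupport φ)]
      fun x => f x (dv x + dφ x) := hd'.mono fun x hx => by simp only [hx]
  refine ⟨h5.congr e1, fun h7 => ?_⟩
  rw [← integral_congr_ae e1, ← integral_congr_ae e2]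
  exact h6 (h7.congr e2.symm)

theorem IsQMinimizer.neg {n : ℕ} {Ω : Set (Eu n)} {f : Eu n → Eu n → ℝ} {Q : ℝ}
    {u : Eu n → ℝ} {du : Eu n → Eu n} (h : IsQMinimizer n Ω f Q u du) :
    IsQMinimizer n Ω (fun x z => f x (-z)) Q (-u) (-du) := by
  have hw : ∀ {v : Eu n → ℝ} {dv : Eu n → Eu n}, IsWeakGradOn n Ω v dv →
      IsWeakGradOn n Ω (-v) (-dv) := by
    intro v dv hv φ hφ hφc hφΩ i
    have := congrArg Neg.neg (hv φ hφ hφc hφΩ i)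
    simpa [integral_neg] using this
  obtain ⟨h1, h2, h3, h4⟩ := h
  refine ⟨hw h1, h2.neg, h3.neg, fun φ dφ hφ hi hdi hc hΩ => ?_⟩
  have hts : tsupport (-φ) = tsupport φ := by
    simp [tsupport, Function.support_neg]
  have := h4 (-φ) (-dφ) (hw hφ) hi.neg hdi.neg (hts ▸ hc) (hts ▸ hΩ)
  rw [hts] at this
  simpa [neg_add_rev, add_comm] using this

theorem isWeakGradOn_gradient {n : ℕ} {ψ : Eu n → ℝ} (hψ : ContDiff ℝ (⊤ : ℕ∞) ψ) :
    IsWeakGradOn n univ ψ (gradient ψ) := by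
  intro φ hφ hφc _ i
  have hd : ∀ {g : Eu n → ℝ}, ContDiff ℝ (⊤ : ℕ∞) g →
      Continuous fun x => fderiv ℝ g x (EuclideanSpace.single i 1) := fun hg =>
    (hg.continuous_fderiv (by simp)).clm_apply continuous_const
  simp only [Measure.restrict_univ, gradient_coord]
  refine integral_mul_fderiv_eq_neg_fderiv_mul_of_integrable ?_ ?_ ?_
    (fun x _ => hψ.differentiable (by simp) x) (fun x _ => hφ.differentiable (by simp) x)
  · exact ((hd hψ).mul hφ.continuous).integrable_of_hasCompactSupport hφc.mul_left
  · exact (hψ.continuous.mul (hd hφ)).integrable_of_hasCompactSupport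
      (hφc.fderiv_apply (𝕜 := ℝ) _).mul_left
  · exact (hψ.continuous.mul hφ.continuous).integrable_of_hasCompactSupport hφc.mul_left

/-- A quasi-minimizer has finite energy on compact subsets. -/
theorem IsQMinimizer.integrableOn_of_isCompact {n : ℕ} {Ω : Set (Eu n)} (hΩ : IsOpen Ω)
    {f : Eu n → Eu n → ℝ} {Q : ℝ} {u : Eu n → ℝ} {du : Eu n → Eu n} (h : IsQMinimizer n Ω f Q u du)
    {K : Set (Eu n)} (hK : IsCompact K) (hKΩ : K ⊆ Ω) :
    IntegrableOn (fun x => f x (du x)) K := by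
  obtain ⟨ψ, hψ, hψc, hψΩ, hψ1, -⟩ := exists_smooth_cutoff hK hΩ hKΩ
  have hgc : HasCompactSupport (gradient ψ) := HasCompactSupport.intro hψc fun x hx =>
    gradient_eq_zero_of_notMem_tsupport hx
  have hg : Continuous (gradient ψ) := continuous_gradient hψ
  refine (h.2.2.2 ψ (gradient ψ) ((isWeakGradOn_gradient hψ).of_univ Ω)
    (hψ.continuous.integrable_of_hasCompactSupport hψc).integrableOn
    (hg.integrable_of_hasCompactSupport hgc).integrableOn hψc hψΩ).1.mono_set fun x hx => ?_
  refine subset_tsupport ψ ?_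
  rw [Function.mem_support, (hψ1.filter_mono (nhds_le_nhdsSet hx)).self_of_nhds]
  exact one_ne_zero

theorem IsQMinimizer.isNormalizedQuasiMinimizer {m : ℕ} {p q p' q' : ℝ} {Ω : Set (Eu (m + 1))}
    (hΩ : IsOpen Ω) (hΩb : Bornology.IsBounded Ω) (hpp' : p' ≤ p) (hpq : p ≤ q) (hqq' : q ≤ q')
    (hpq' : SobolevExponents m p' q') {f : Eu (m + 1) → Eu (m + 1) → ℝ}
    (hf_meas : ∀ z, AEMeasurable (fun x => f x z) (volume.restrict Ω))
    (hf_cont : ∀ᵐ x ∂volume.restrict Ω, Continuous (f x))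
    (hf_conv : ∀ᵐ x ∂volume.restrict Ω, ConvexOn ℝ univ (f x))
    {L μ : ℝ} (hL : 1 ≤ L) (hμ : 0 ≤ μ)
    (hgrowth : ∀ᵐ x ∂volume.restrict Ω, ∀ z, ‖z‖ ^ p ≤ f x z ∧ f x z ≤ L * ‖z‖ ^ q + 1)
    (hdouble : ∀ᵐ x ∂volume.restrict Ω, ∀ z, f x (2 • z) ≤ μ + L * f x z)
    {Q : ℝ} (hQ : 1 ≤ Q) {u : Eu (m + 1) → ℝ} {du : Eu (m + 1) → Eu (m + 1)}
    (hu : Measurable u) (hdu : Measurable du) (h : IsQMinimizer (m + 1) Ω f Q u du) :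
    IsNormalizedQuasiMinimizer m p' q' Ω (L + μ + 2).toNNReal Q.toNNReal
      (fun x z => ENNReal.ofReal (f x z + 1)) u du := by
  have hf0 : ∀ᵐ x ∂volume.restrict Ω, ∀ z, 0 ≤ f x z := hgrowth.mono fun x hx z =>
    (by positivity : 0 ≤ ‖z‖ ^ p).trans (hx z).1
  have hfin : ∀ {S : Set (Eu (m + 1))} {g : Eu (m + 1) → Eu (m + 1)}, IsCompact S → S ⊆ Ω →
      IntegrableOn (fun x => f x (g x)) S →
      ∫⁻ x in S, ENNReal.ofReal (f x (g x) + 1) =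
        ENNReal.ofReal ((∫ x in S, f x (g x)) + volume.real S) := by
    intro S g hS hSΩ hi
    have h1 : IntegrableOn (fun _ => (1 : ℝ)) S :=
      integrableOn_const hS.measure_lt_top.ne
    rw [← ofReal_integral_eq_lintegral_ofReal (f := fun x => f x (g x) + 1) (hi.add h1),
      integral_add hi h1]
    · simp
    · filter_upwards [ae_restrict_of_ae_restrict_of_subset hSΩ hf0] with x hx
      exact add_nonneg (hx _) zero_le_one
  have hmeas : ∀ g : Eu (m + 1) → Eu (m + 1), Measurable g →
      AEMeasurable (fun x => f x (g x)) (volume.restrict Ω) := fun g hg =>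
    aemeasurable_caratheodory_comp hf_meas hf_cont hg
  refine ⟨hpq', hΩ, hΩb.measure_lt_top.ne, ?_, ?_, hu, hdu, h.1, h.2.1, h.2.2.1, ?_, ?_, ?_, ?_⟩
  · rw [← Real.toNNReal_one]; exact Real.toNNReal_le_toNNReal (by linarith)
  · rw [← Real.toNNReal_one]; exact Real.toNNReal_le_toNNReal hQ
  · exact fun g hg => ((hmeas g hg).add_const 1).ennreal_ofReal
  · filter_upwards [hf_conv, hgrowth, hdouble] with x h1 h2 h3
    exact .of_convexOn hpq'.one_le hpp' hpq hqq' hL hμ h1 h2 h3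
  · intro K hKΩ hK
    rw [hfin hK hKΩ (h.integrableOn_of_isCompact hΩ hK hKΩ)]
    exact ENNReal.ofReal_ne_top
  · intro φ dφ hw hφ hdφ hdφm hc hcΩ
    have hQ0 : Q.toNNReal ≠ 0 := (Real.toNNReal_pos.2 (by linarith)).ne'
    by_cases htop : ∫⁻ x in tsupport φ, ENNReal.ofReal (f x (du x + dφ x) + 1) = ⊤
    · rw [htop, ENNReal.mul_top (by exact_mod_cast hQ0)]
      exact le_top
    obtain ⟨h1, h2⟩ := h.2.2.2 φ dφ (hw.of_univ Ω) hφ.integrableOn hdφ.integrableOn hc hcΩ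
    have hf0' := ae_restrict_of_ae_restrict_of_subset hcΩ hf0
    have hi : IntegrableOn (fun x => f x (du x + dφ x)) (tsupport φ) := by
      refine ⟨((hmeas _ (hdu.add hdφm)).mono_measure
        (Measure.restrict_mono hcΩ le_rfl)).aestronglyMeasurable, ?_⟩
      rw [hasFiniteIntegral_iff_ofReal (hf0'.mono fun x hx => hx _)]
      refine lt_of_le_of_lt (lintegral_mono fun x => ENNReal.ofReal_le_ofReal ?_)
        (lt_top_iff_ne_top.2 htop)
      exact (lt_add_one _).le
    rw [hfin hc hcΩ h1, hfin (g := fun x => du x + dφ x) hc hcΩ hi, ENNReal.ofNNReal_toNNReal,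
      ← ENNReal.ofReal_mul (by linarith)]
    refine ENNReal.ofReal_le_ofReal ?_
    have h3 : 0 ≤ volume.real (tsupport φ) := measureReal_nonneg
    nlinarith [h2 hi]

/-- One-sided local boundedness of quasi-minimizers. -/
theorem IsQMinimizer.exists_ae_le {m : ℕ} (hm : 1 ≤ m) {p q : ℝ} {Ω : Set (Eu (m + 1))}
    (hΩ : IsOpen Ω) (hΩb : Bornology.IsBounded Ω) (hp : 1 ≤ p) (hpq : p ≤ q)
    (hq : 1 / p - 1 / (m : ℝ) ≤ 1 / q) {f : Eu (m + 1) → Eu (m + 1) → ℝ}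
    (hf_meas : ∀ z, AEMeasurable (fun x => f x z) (volume.restrict Ω))
    (hf_cont : ∀ᵐ x ∂volume.restrict Ω, Continuous (f x))
    (hf_conv : ∀ᵐ x ∂volume.restrict Ω, ConvexOn ℝ univ (f x))
    {L μ : ℝ} (hL : 1 ≤ L) (hμ : 0 ≤ μ)
    (hgrowth : ∀ᵐ x ∂volume.restrict Ω, ∀ z, ‖z‖ ^ p ≤ f x z ∧ f x z ≤ L * ‖z‖ ^ q + 1)
    (hdouble : ∀ᵐ x ∂volume.restrict Ω, ∀ z, f x (2 • z) ≤ μ + L * f x z)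
    {Q : ℝ} (hQ : 1 ≤ Q) {u : Eu (m + 1) → ℝ} {du : Eu (m + 1) → Eu (m + 1)}
    (h : IsQMinimizer (m + 1) Ω f Q u du) {K : Set (Eu (m + 1))} (hK : IsCompact K)
    (hKΩ : K ⊆ Ω) : ∃ C : ℝ, ∀ᵐ x ∂volume.restrict K, u x ≤ C := by
  obtain ⟨p', q', hpp', hqq', hpq'⟩ := exists_sobolevExponents hm hp hpq hq
  have hu := h.2.1.aestronglyMeasurable
  have hdu := h.2.2.1.aestronglyMeasurable
  have h' := (h.congr hu.ae_eq_mk hdu.ae_eq_mk).isNormalizedQuasiMinimizer hΩ hΩb hpp' hpq hqq' hpq'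
    hf_meas hf_cont hf_conv hL hμ hgrowth hdouble hQ hu.stronglyMeasurable_mk.measurable
    hdu.stronglyMeasurable_mk.measurable
  obtain ⟨C, hC⟩ := h'.exists_ae_le hK hKΩ
  refine ⟨C, ?_⟩
  filter_upwards [hC, ae_restrict_of_ae_restrict_of_subset hKΩ hu.ae_eq_mk] with x h1 h2
  rwa [h2]

/-- **Local boundedness of quasi-minimizers under optimal (p,q)-growth.**
Let `n ≥ 2`, `Ω ⊂ ℝⁿ` a bounded domain, and `f : Ω × ℝⁿ → ℝ` a Carathéodory function,
convex in the second variable for a.e. `x`, with `|z|^p ≤ f(x,z) ≤ L|z|^q + 1` and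
`f(x,2z) ≤ μ + L f(x,z)` for some `1 ≤ L < ∞`, `μ ≥ 0`, where `1 ≤ p ≤ q < ∞` satisfy
`1/q ≥ 1/p − 1/(n−1)`. Then every quasi-minimizer `u ∈ W^{1,1}_loc(Ω)` of
`F[u,A] = ∫_A f(x,∇u) dx` belongs to `L^∞_loc(Ω)`. -/
theorem local_boundedness_of_quasi_minimizer
    (n : ℕ) (hn : 2 ≤ n)
    (Ω : Set (EuclideanSpace ℝ (Fin n)))
    (hΩopen : IsOpen Ω) (hΩconn : IsConnected Ω) (hΩbdd : Bornology.IsBounded Ω)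
    (p q : ℝ) (hp : 1 ≤ p) (hpq : p ≤ q)
    (hqn : 1 / p - 1 / ((n : ℝ) - 1) ≤ 1 / q)
    (f : EuclideanSpace ℝ (Fin n) → EuclideanSpace ℝ (Fin n) → ℝ)
    (hf_meas : ∀ z : EuclideanSpace ℝ (Fin n),
      AEMeasurable (fun x => f x z) (volume.restrict Ω))
    (hf_cont : ∀ᵐ x ∂volume.restrict Ω, Continuous fun z => f x z)
    (hf_conv : ∀ᵐ x ∂volume.restrict Ω, ConvexOn ℝ univ fun z => f x z)
    (L μ : ℝ) (hL : 1 ≤ L) (hμ : 0 ≤ μ)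
    (hgrowth : ∀ᵐ x ∂volume.restrict Ω, ∀ z : EuclideanSpace ℝ (Fin n),
      ‖z‖ ^ p ≤ f x z ∧ f x z ≤ L * ‖z‖ ^ q + 1)
    (hdouble : ∀ᵐ x ∂volume.restrict Ω, ∀ z : EuclideanSpace ℝ (Fin n),
      f x (2 • z) ≤ μ + L * f x z)
    (u : EuclideanSpace ℝ (Fin n) → ℝ)
    (du : EuclideanSpace ℝ (Fin n) → EuclideanSpace ℝ (Fin n))
    (hquasi : ∃ Q : ℝ, 1 ≤ Q ∧ IsQMinimizer n Ω f Q u du) :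
    ∀ K : Set (EuclideanSpace ℝ (Fin n)), K ⊆ Ω → IsCompact K →
      ∃ C : ℝ, ∀ᵐ x ∂volume.restrict K, |u x| ≤ C := by
  obtain ⟨m, rfl⟩ : ∃ m, n = m + 1 := ⟨n - 1, by omega⟩
  obtain ⟨Q, hQ, h⟩ := hquasi
  intro K hKΩ hK
  have hm : 1 ≤ m := by omega
  have hq : 1 / p - 1 / (m : ℝ) ≤ 1 / q := by simpa using hqn
  obtain ⟨C, hC⟩ := h.exists_ae_le hm hΩopen hΩbdd hp hpq hq hf_meas hf_cont hf_conv hL hμ hgrowth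
    hdouble hQ hK hKΩ
  obtain ⟨D, hD⟩ := h.neg.exists_ae_le hm hΩopen hΩbdd hp hpq hq (fun z => hf_meas (-z))
    (hf_cont.mono fun x hx => hx.comp continuous_neg)
    (hf_conv.mono fun x hx => hx.comp_linearMap (-LinearMap.id)) hL hμ
    (hgrowth.mono fun x hx z => by simpa using hx (-z))
    (hdouble.mono fun x hx z => by simpa using hx (-z)) hQ hK hKΩ
  refine ⟨max C D, ?_⟩
  filter_upwards [hC, hD] with x h1 h2
  exact abs_le.2 ⟨by linarith [le_max_right C D, show -u x ≤ D from h2], h1.trans (le_max_left _ _)⟩
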